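/- Let L = F_{2^n} and let f ∈ L[x] be a polynomial whose degree d is odd and is neither a Gold number 2^k + 1 nor a Kasami–Welch number 2^{2k} − 2^k + 1 for any k ≥ 1. Then f is not exceptional APN: there are only finitely many m ≥ 1 such that f is APN on F_{2^{nm}}. -/

import Mathlib

/-- `g` is almost perfect nonlinear (APN) on the field `K`: for all `a ≠ 0` and all `b`,
the equation `g(x+a) + g(x) = b` has at most two solutions. -/
def IsAPN {K : Type} [Field K] (g : K → K) : Prop :=
  ∀ a b : K, a ≠ 0 → {x : K | g (x + a) + g x = b}.ncard ≤ 2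

namespace ExcAPN
open Polynomial

/-- bivariate polynomials of weighted degree at most `e` (weight of `x` is 1, of `y` is `κ`). -/
def Wt (k : Type*) [Field k] (κ e : ℕ) : Submodule k k[X][X] where
  carrier := {p | ∀ i j, (p.coeff j).coeff i ≠ 0 → i + κ * j ≤ e}
  add_mem' := by
    intro p q hp hq i j h
    by_cases h1 : (p.coeff j).coeff i = 0
    · apply hq; intro h2; apply h; simp [h1, h2]
    · exact hp i j h1
  zero_mem' := by intro i j h; simp at h
  smul_mem' := by
    intro c p hp i j h
    apply hp; intro h2; apply h; simp [h2]

section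
variable {k : Type*} [Field k] {κ : ℕ}

lemma mem_Wt {e : ℕ} {p : k[X][X]} :
    p ∈ Wt k κ e ↔ ∀ i j, (p.coeff j).coeff i ≠ 0 → i + κ * j ≤ e := Iff.rfl

lemma Wt_mono {e e' : ℕ} (h : e ≤ e') {p : k[X][X]} (hp : p ∈ Wt k κ e) : p ∈ Wt k κ e' :=
  fun i j hh => (hp i j hh).trans h

lemma Wt_mul {e e' : ℕ} {p q : k[X][X]} (hp : p ∈ Wt k κ e) (hq : q ∈ Wt k κ e') :
    p * q ∈ Wt k κ (e + e') := by
  intro i j h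
  rw [coeff_mul, finsetSum_coeff] at h
  obtain ⟨⟨j1, j2⟩, hj, h⟩ := Finset.exists_ne_zero_of_sum_ne_zero h
  rw [coeff_mul] at h
  obtain ⟨⟨i1, i2⟩, hi, h⟩ := Finset.exists_ne_zero_of_sum_ne_zero h
  have hi := Finset.HasAntidiagonal.mem_antidiagonal.1 hi
  have hj := Finset.HasAntidiagonal.mem_antidiagonal.1 hj
  dsimp only at hi hj h
  have h1 := hp i1 j1 (left_ne_zero_of_mul h)
  have h2 := hq i2 j2 (right_ne_zero_of_mul h)
  subst hi hj
  nlinarith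

lemma Wt_one {e : ℕ} : (1 : k[X][X]) ∈ Wt k κ e := by
  intro i j h
  rw [coeff_one] at h
  split_ifs at h with hj
  · rw [coeff_one] at h
    split_ifs at h with hi
    · subst hi hj; simp
    · simp at h
  · simp at h

lemma Wt_pow {e : ℕ} {p : k[X][X]} (hp : p ∈ Wt k κ e) (m : ℕ) : p ^ m ∈ Wt k κ (m * e) := by
  induction m with
  | zero => simpa using Wt_one
  | succ m ih =>
    rw [pow_succ, Nat.succ_mul]
    exact Wt_mul ih hp

lemma Wt_CX : (C X : k[X][X]) ∈ Wt k κ 1 := by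
  intro i j h
  rw [coeff_C] at h
  split_ifs at h with hj
  · rw [coeff_X] at h
    split_ifs at h with hi
    · subst hi hj; simp
    · simp at h
  · simp at h

lemma Wt_X : (X : k[X][X]) ∈ Wt k κ κ := by
  intro i j h
  rw [coeff_X] at h
  split_ifs at h with hj
  · rw [coeff_one] at h
    split_ifs at h with hi
    · subst hi hj; simp
    · simp at h
  · simp at h

lemma Wt_CC (c : k) {e : ℕ} : (C (C c) : k[X][X]) ∈ Wt k κ e := by
  have : (C (C c) : k[X][X]) = c • 1 := by
    ext i j; by_cases hi : i = 0 <;> simp [coeff_C, coeff_one, hi]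
  rw [this]
  exact (Wt k κ e).smul_mem c Wt_one

lemma Wt_lead {e : ℕ} {p : k[X][X]} (hp : p ∈ Wt k κ e) (hp0 : p ≠ 0) :
    κ * p.natDegree ≤ e := by
  have := hp p.leadingCoeff.natDegree p.natDegree (by
    change p.leadingCoeff.leadingCoeff ≠ 0
    simpa using hp0)
  omega

lemma Wt_mod {h : k[X][X]} (hm : h.Monic) (hw : h ∈ Wt k κ (κ * h.natDegree)) {e : ℕ} :
    ∀ (N : ℕ) (p : k[X][X]), p.natDegree ≤ N → p ∈ Wt k κ e → p %ₘ h ∈ Wt k κ e := by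
  intro N
  induction N with
  | zero =>
    intro p hN hp
    by_cases hd : p.degree < h.degree
    · rwa [(modByMonic_eq_self_iff hm).2 hd]
    · have : h.natDegree = 0 := by
        have := natDegree_le_natDegree (not_lt.1 hd); omega
      have : h = 1 := by
        exact eq_one_of_monic_natDegree_zero hm this
      subst this
      simp
  | succ N ih =>
    intro p hN hp
    by_cases hd : p.degree < h.degree
    · rwa [(modByMonic_eq_self_iff hm).2 hd]
    have hle : h.natDegree ≤ p.natDegree := natDegree_le_natDegree (not_lt.1 hd)
    have hp0 : p ≠ 0 := by
      rintro rfl; apply hd; simp [bot_lt_iff_ne_bot, hm.ne_zero]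
    set q := C p.leadingCoeff * X ^ (p.natDegree - h.natDegree) with hq
    have key : (p - h * q) %ₘ h = p %ₘ h := by
      rw [sub_modByMonic, (modByMonic_eq_zero_iff_dvd hm).2 (Dvd.intro _ rfl), sub_zero]
    rw [← key]
    have hqW : h * q ∈ Wt k κ e := by
      have : q ∈ Wt k κ (e - κ * h.natDegree) := by
        intro i j hij
        rw [hq, coeff_C_mul_X_pow] at hij
        split_ifs at hij with hj
        · have := hp i p.natDegree hij
          subst hj
          have h5 : κ * h.natDegree ≤ κ * p.natDegree := Nat.mul_le_mul_left _ hle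
          rw [Nat.mul_sub]
          omega
        · simp at hij
      have h2 := Wt_mul hw this
      refine Wt_mono ?_ h2
      have := Wt_lead hp hp0
      have : κ * h.natDegree ≤ κ * p.natDegree := Nat.mul_le_mul_left _ hle
      omega
    by_cases h0 : p - h * q = 0
    · rw [h0]; simp
    apply ih
    · have := div_wf_lemma ⟨not_lt.1 hd, hp0⟩ hm
      have := natDegree_lt_natDegree h0 this
      omega
    · exact (Wt k κ e).sub_mem hp hqW

/-- The reduced polynomials with parameter `M`. -/
noncomputable def redMap (k : Type*) [Field k] (n M : ℕ) : (Fin n → Fin M → k) →ₗ[k] k[X][X] :=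
  ∑ j : Fin n, ∑ i : Fin M,
    (LinearMap.toSpanSingleton k k[X][X] (C (X ^ (i : ℕ)) * X ^ (j : ℕ))).comp
      ((LinearMap.proj (R := k) (φ := fun _ : Fin M => k) i).comp
        (LinearMap.proj (R := k) (φ := fun _ : Fin n => Fin M → k) j))

lemma redMap_apply (n M : ℕ) (a : Fin n → Fin M → k) :
    redMap k n M a = ∑ j : Fin n, ∑ i : Fin M, a j i • (C (X ^ (i : ℕ)) * X ^ (j : ℕ)) := by
  simp [redMap]

lemma redMap_coeff (n M : ℕ) (a : Fin n → Fin M → k) (i j : ℕ) :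
    ((redMap k n M a).coeff j).coeff i =
      if h : j < n ∧ i < M then a ⟨j, h.1⟩ ⟨i, h.2⟩ else 0 := by
  rw [redMap_apply]
  simp only [finsetSum_coeff, coeff_smul, coeff_C_mul_X_pow, smul_eq_mul]
  have : ∀ (x : Fin n) (y : Fin M), (a x y) * ((if j = (x : ℕ) then (X ^ (y : ℕ) : k[X]) else 0).coeff i)
      = if j = (x : ℕ) ∧ i = (y : ℕ) then a x y else 0 := by
    intro x y
    by_cases h1 : j = x <;> by_cases h2 : i = y <;> simp [h1, h2, coeff_X_pow]
  simp only [this]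
  split_ifs with h
  · rw [Finset.sum_eq_single ⟨j, h.1⟩, Finset.sum_eq_single ⟨i, h.2⟩]
    · simp
    · intro b _ hb; rw [if_neg]; rintro ⟨_, h2⟩; apply hb; ext; exact h2.symm
    · simp
    · intro b _ hb; apply Finset.sum_eq_zero; intro c _; rw [if_neg]; rintro ⟨h2, _⟩; apply hb; ext; exact h2.symm
    · simp
  · apply Finset.sum_eq_zero; intro x _; apply Finset.sum_eq_zero; intro y _
    rw [if_neg]; rintro ⟨h1, h2⟩; apply h; omega

lemma redMap_injective (n M : ℕ) : Function.Injective (redMap k n M) := by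
  intro a b hab
  ext j i
  have := congrArg (fun p : k[X][X] => (p.coeff j).coeff i) hab
  simpa [redMap_coeff] using this

lemma redMap_degree (n M : ℕ) (a : Fin n → Fin M → k) : (redMap k n M a).degree < n := by
  rw [degree_lt_iff_coeff_zero]
  intro m hm
  ext i
  rw [redMap_coeff, dif_neg (by omega)]; simp

lemma redMap_Wt {n M : ℕ} (a : Fin n → Fin M → k) : redMap k n M a ∈ Wt k κ (M + κ * n) := by
  intro i j h
  rw [redMap_coeff] at h
  split_ifs at h with hh
  · have : κ * j ≤ κ * n := Nat.mul_le_mul_left _ hh.1.le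
    omega
  · simp at h

lemma mem_range_redMap {n M : ℕ} {p : k[X][X]} (hd : p.degree < n)
    (hM : ∀ i j, (p.coeff j).coeff i ≠ 0 → i < M) : p ∈ LinearMap.range (redMap k n M) := by
  refine ⟨fun j i => (p.coeff j).coeff i, ?_⟩
  ext j i
  rw [redMap_coeff]
  split_ifs with h
  · rfl
  · symm; by_contra hc
    apply h
    refine ⟨?_, hM _ _ hc⟩
    by_contra hj
    rw [degree_lt_iff_coeff_zero] at hd
    rw [hd j (by omega)] at hc
    simp at hc

lemma range_redMap_mono {n M M' : ℕ} (h : M ≤ M') :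
    LinearMap.range (redMap k n M) ≤ LinearMap.range (redMap k n M') := by
  rintro _ ⟨a, rfl⟩
  apply mem_range_redMap (redMap_degree _ _ _)
  intro i j hij
  rw [redMap_coeff] at hij
  split_ifs at hij with hh
  · omega
  · simp at hij

/-- Bezout-type bound. -/
lemma bezout_bound {h : k[X][X]} (hm : h.Monic) (hw : h ∈ Wt k κ (κ * h.natDegree))
    (hp : Prime h) {g : k[X][X]} (hg : ¬ h ∣ g) {e : ℕ} (hge : g ∈ Wt k κ e)
    {E : Type*} [AddCommGroup E] [Module k E] [Module.Finite k E] (L : k[X][X] →ₗ[k] E)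
    (hLs : Function.Surjective L) (hLh : ∀ p, L (h * p) = 0) (hLg : ∀ p, L (g * p) = 0) :
    Module.finrank k E ≤ h.natDegree * (e + κ * h.natDegree + 1) := by
  set n := h.natDegree with hn
  have hmod : ∀ p, L (p %ₘ h) = L p := by
    intro p
    conv_rhs => rw [← modByMonic_add_div p h]
    rw [map_add, hLh, add_zero]
  have hdeg : ∀ p : k[X][X], (p %ₘ h).degree < n := by
    intro p
    have := degree_modByMonic_lt p hm
    rwa [degree_eq_natDegree hm.ne_zero] at this
  -- find M
  obtain ⟨M, hM⟩ : ∃ M, LinearMap.range (L.comp (redMap k n M)) = ⊤ := by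
    let b := Module.finBasis k E
    choose f hf using fun i => hLs (b i)
    have : ∀ i, ∃ M, f i %ₘ h ∈ LinearMap.range (redMap k n M) := by
      intro i
      refine ⟨(f i %ₘ h).support.sup (fun j => ((f i %ₘ h).coeff j).natDegree) + 1, ?_⟩
      apply mem_range_redMap (hdeg _)
      intro a j hj
      have h1 : j ∈ (f i %ₘ h).support := by
        rw [mem_support_iff]; intro h0; rw [h0] at hj; simp at hj
      have h2 := Finset.le_sup (f := fun j => ((f i %ₘ h).coeff j).natDegree) h1
      have h3 := le_natDegree_of_ne_zero hj
      omega
    choose M hM using this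
    refine ⟨Finset.univ.sup M, ?_⟩
    rw [eq_top_iff, ← b.span_eq, Submodule.span_le]
    rintro _ ⟨i, rfl⟩
    obtain ⟨a, ha⟩ := range_redMap_mono (Finset.le_sup (f := M) (Finset.mem_univ i)) (hM i)
    exact ⟨a, by simp [ha, hmod, hf]⟩
  set e' := e + κ * n + 1 with he'
  have hM' : LinearMap.range (L.comp (redMap k n (M + e'))) = ⊤ := by
    rw [eq_top_iff, ← hM]
    rintro _ ⟨a, rfl⟩
    obtain ⟨b, hb⟩ := range_redMap_mono (n := n) (Nat.le_add_right M e') ⟨a, rfl⟩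
    exact ⟨b, by simp [hb]⟩
  have hrn := LinearMap.finrank_range_add_finrank_ker (L.comp (redMap k n (M + e')))
  rw [hM', finrank_top] at hrn
  have hdim : ∀ M, Module.finrank k (Fin n → Fin M → k) = n * M := by
    intro M; simp [Module.finrank_pi_fintype]
  rw [hdim] at hrn
  -- the kernel is large
  have hex : ∀ a : Fin n → Fin M → k, ∃ b, redMap k n (M + e') b = (g * redMap k n M a) %ₘ h := by
    intro a
    have hW : (g * redMap k n M a) %ₘ h ∈ Wt k κ (e + (M + κ * n)) :=
      Wt_mod hm hw _ _ le_rfl (Wt_mul hge (redMap_Wt a))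
    refine mem_range_redMap (hdeg _) ?_
    intro i j hij
    have := hW i j hij
    omega
  choose G hG using hex
  have hker : n * M ≤ Module.finrank k (LinearMap.ker (L.comp (redMap k n (M + e')))) := by
    rw [← hdim M]
    let Γ : (Fin n → Fin M → k) →ₗ[k] LinearMap.ker (L.comp (redMap k n (M + e'))) :=
      { toFun := fun a => ⟨G a, by
          simp [hG, hmod, hLg]⟩
        map_add' := by
          intro a b
          ext1
          apply redMap_injective n (M + e')
          simp [hG, mul_add, add_modByMonic]
        map_smul' := by
          intro c a
          ext1
          apply redMap_injective n (M + e')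
          simp only [map_smul, hG, RingHom.id_apply, SetLike.mk_smul_mk]
          rw [mul_smul_comm]
          have : ∀ p : k[X][X], c • p = (C c : k[X]) • p := by intro p; ext; simp [coeff_smul]
          rw [this, this, smul_modByMonic] }
    apply LinearMap.finrank_le_finrank_of_injective (f := Γ)
    rw [← LinearMap.ker_eq_bot, LinearMap.ker_eq_bot']
    intro a ha
    have h0 : G a = 0 := by simpa [Γ] using congrArg Subtype.val ha
    have h1 := hG a
    rw [h0, map_zero, eq_comm, modByMonic_eq_zero_iff_dvd hm] at h1
    rcases hp.dvd_or_dvd h1 with h2 | h2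
    · exact absurd h2 hg
    · have : redMap k n M a = 0 := by
        by_contra hne
        have h3 := degree_le_of_dvd h2 hne
        rw [degree_eq_natDegree hm.ne_zero] at h3
        exact absurd (redMap_degree n M a) (not_lt.2 h3)
      exact redMap_injective n M (by simpa using this)
  have : n * (M + e') = n * M + n * e' := by ring
  omega

end
end ExcAPN

namespace ExcAPN
open Polynomial
section
variable {k : Type*} [Field k] {κ : ℕ}

lemma zeros_bound {h : k[X][X]} (hm : h.Monic) (hw : h ∈ Wt k κ (κ * h.natDegree))
    (hp : Prime h) {g : k[X][X]} (hg : ¬ h ∣ g) {e : ℕ} (hge : g ∈ Wt k κ e)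
    (S : Finset (k × k)) (hSh : ∀ s ∈ S, h.evalEval s.1 s.2 = 0)
    (hSg : ∀ s ∈ S, g.evalEval s.1 s.2 = 0) :
    S.card ≤ h.natDegree * (e + κ * h.natDegree + 1) := by
  classical
  let L : k[X][X] →ₗ[k] (S → k) :=
    { toFun := fun p s => p.evalEval s.1.1 s.1.2
      map_add' := by intro p q; ext s; simp
      map_smul' := by intro c p; ext s; simp [evalEval_smul] }
  have hL : ∀ p s, L p s = p.evalEval s.1.1 s.1.2 := fun p s => rfl
  have := bezout_bound hm hw hp hg hge L ?_ ?_ ?_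
  · simpa using this
  · rw [← LinearMap.range_eq_top, eq_top_iff, ← (Pi.basisFun k S).span_eq, Submodule.span_le]
    rintro _ ⟨s, rfl⟩
    let F : S → k[X][X] := fun t =>
      if t.1.1 = s.1.1 then X - C (C t.1.2) else C (X - C t.1.1)
    let P : k[X][X] := ∏ t ∈ Finset.univ.erase s, F t
    have hFs : ∀ t, t ≠ s → (F t).evalEval s.1.1 s.1.2 ≠ 0 := by
      intro t hts
      by_cases h1 : t.1.1 = s.1.1
      · simp only [F, h1, if_true]
        simp only [evalEval_sub, evalEval_X, evalEval_C, eval_C]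
        intro h2
        apply hts; ext
        · exact h1
        · exact (sub_eq_zero.1 h2).symm
      · simp only [F, h1, if_false]
        simp only [evalEval_C, eval_sub, eval_X, eval_C]
        intro h2; exact h1 (sub_eq_zero.1 h2).symm
    have hFt : ∀ t, (F t).evalEval t.1.1 t.1.2 = 0 := by
      intro t
      by_cases h1 : t.1.1 = s.1.1
      · simp only [F, h1, if_true]
        simp
      · simp only [F, h1, if_false]
        simp only [evalEval_C, eval_sub, eval_X, eval_C, sub_self]
    have hPs : P.evalEval s.1.1 s.1.2 ≠ 0 := by
      simp only [P, evalEval_prod]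
      rw [Finset.prod_ne_zero_iff]
      intro t ht
      exact hFs t (Finset.ne_of_mem_erase ht)
    refine ⟨(P.evalEval s.1.1 s.1.2)⁻¹ • P, ?_⟩
    ext t
    rw [hL, evalEval_smul, Pi.basisFun_apply]
    by_cases hts : t = s
    · subst hts; simp [hPs]
    · have : P.evalEval t.1.1 t.1.2 = 0 := by
        simp only [P, evalEval_prod]
        exact Finset.prod_eq_zero (Finset.mem_erase.2 ⟨hts, Finset.mem_univ _⟩) (hFt t)
      simp [this, hts]
  · intro p; ext s; rw [hL, evalEval_mul, hSh _ s.2]; simp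
  · intro p; ext s; rw [hL, evalEval_mul, hSg _ s.2]; simp

/-- evaluation in power series at a branch `x = x0 + t, y = η(t)`. -/
noncomputable def branch (x0 : k) (η : PowerSeries k) : k[X][X] →ₐ[k] PowerSeries k :=
  { eval₂RingHom (aeval (PowerSeries.C x0 + PowerSeries.X) : k[X] →ₐ[k] PowerSeries k).toRingHom η
    with
    commutes' := by
      intro r
      simp [Polynomial.algebraMap_apply] }

lemma branch_C (x0 : k) (η : PowerSeries k) (p : k[X]) :
    branch x0 η (C p) = aeval (PowerSeries.C x0 + PowerSeries.X) p := by
  simp [branch]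

lemma branch_X (x0 : k) (η : PowerSeries k) : branch x0 η X = η := by
  simp [branch]

lemma branch_exists {h : k[X][X]} (hm : h.Monic) {x0 y0 : k} (h0 : h.evalEval x0 y0 = 0)
    (h1 : h.derivative.evalEval x0 y0 ≠ 0) : ∃ η : PowerSeries k, branch x0 η h = 0 := by
  have hen : HenselianRing (PowerSeries k) (Ideal.span {PowerSeries.X}) := inferInstance
  let φ : k[X] →+* PowerSeries k := (aeval (PowerSeries.C x0 + PowerSeries.X) : k[X] →ₐ[k] PowerSeries k).toRingHom
  have hφ : (PowerSeries.constantCoeff (R := k)).comp φ = evalRingHom x0 := by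
    ext <;> simp [φ]
  have key : ∀ p : k[X][X], PowerSeries.constantCoeff ((p.map φ).eval (PowerSeries.C y0)) = p.evalEval x0 y0 := by
    intro p
    rw [eval_map, hom_eval₂, hφ, evalEval]
    rw [← coe_evalRingHom, eval, hom_eval₂]
    simp
  obtain ⟨η, hη, -⟩ := hen.is_henselian (h.map φ) (hm.map φ) (PowerSeries.C y0) (by
    rw [Ideal.mem_span_singleton, PowerSeries.X_dvd_iff, key, h0]) (by
    apply IsUnit.map
    rw [derivative_map, PowerSeries.isUnit_iff_constantCoeff, key]
    exact isUnit_iff_ne_zero.2 h1)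
  refine ⟨η, ?_⟩
  rw [IsRoot, eval_map] at hη
  exact hη

lemma order_bound {h : k[X][X]} (hm : h.Monic) (hw : h ∈ Wt k κ (κ * h.natDegree))
    (hp : Prime h) {g : k[X][X]} (hg : ¬ h ∣ g) {e : ℕ} (hge : g ∈ Wt k κ e)
    {x0 : k} {η : PowerSeries k} (hb : branch x0 η h = 0) {N : ℕ}
    (hN : PowerSeries.X ^ N ∣ branch x0 η g) :
    N ≤ h.natDegree * (e + κ * h.natDegree + 1) := by
  let L : k[X][X] →ₗ[k] (Fin N → k) :=
    LinearMap.pi (fun i => (PowerSeries.coeff (R := k) (i : ℕ)).comp (branch x0 η).toLinearMap)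
  have hL : ∀ p i, L p i = PowerSeries.coeff (i : ℕ) (branch x0 η p) := fun p s => rfl
  have := bezout_bound hm hw hp hg hge L ?_ ?_ ?_
  · simpa using this
  · rw [← LinearMap.range_eq_top, eq_top_iff, ← (Pi.basisFun k (Fin N)).span_eq, Submodule.span_le]
    rintro _ ⟨s, rfl⟩
    refine ⟨C ((X - C x0) ^ (s : ℕ)), ?_⟩
    ext t
    rw [hL, branch_C]
    simp only [map_pow, map_sub, aeval_X, aeval_C]
    rw [show (algebraMap k (PowerSeries k)) x0 = PowerSeries.C x0 from rfl, add_sub_cancel_left,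
      PowerSeries.coeff_X_pow, Pi.basisFun_apply]
    simp [Pi.single_apply, Fin.ext_iff]
  · intro p; ext s; rw [hL, map_mul, hb]; simp
  · intro p; ext s; rw [hL, map_mul]
    have : PowerSeries.X ^ N ∣ branch x0 η g * branch x0 η p := Dvd.dvd.mul_right hN _
    rw [PowerSeries.X_pow_dvd_iff] at this
    simpa using this s s.2

end
end ExcAPN

namespace ExcAPN
open Polynomial
section
variable {k : Type*} [Field k] {κ : ℕ}

lemma ps_frob [CharP k 2] (r : ℕ) {ι : Type*} [Fintype ι] (v w : ι → PowerSeries k)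
    (hw : ∃ s, w s ≠ 0) (h0 : ∑ s, v s * (w s) ^ (2 ^ r) = 0) :
    ∃ a : ι → k, a ≠ 0 ∧ PowerSeries.X ^ (2 ^ r) ∣ ∑ s, a s • v s := by
  classical
  have hch : CharP (PowerSeries k) 2 :=
    charP_of_injective_ringHom (f := (PowerSeries.C : k →+* PowerSeries k))
      PowerSeries.C_injective 2
  obtain ⟨s0, hs0⟩ := hw
  have hex : ∃ N : ℕ, ∃ s, ¬ (PowerSeries.X ^ (N + 1) ∣ w s) := by
    obtain ⟨N, hN⟩ : ∃ N, PowerSeries.coeff N (w s0) ≠ 0 := by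
      by_contra! h
      exact hs0 (PowerSeries.ext (by simpa using h))
    refine ⟨N, s0, ?_⟩
    rw [PowerSeries.X_pow_dvd_iff]
    intro h
    exact hN (h N (by omega))
  obtain ⟨s1, hs1⟩ := Nat.find_spec hex
  set N := Nat.find hex with hNdef
  have hdvd : ∀ s, PowerSeries.X ^ N ∣ w s := by
    intro s
    rcases Nat.eq_zero_or_pos N with h | h
    · rw [h]; simp
    · have := Nat.find_min hex (m := N - 1) (by omega)
      push Not at this
      have := this s
      rwa [Nat.sub_add_cancel h] at this
  choose u hu using hdvd
  have hu1 : ∀ s, ∃ z, u s = PowerSeries.C (PowerSeries.constantCoeff (u s)) + PowerSeries.X * z := by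
    intro s
    have : PowerSeries.X ∣ u s - PowerSeries.C (PowerSeries.constantCoeff (u s)) := by
      rw [PowerSeries.X_dvd_iff]; simp
    obtain ⟨z, hz⟩ := this
    exact ⟨z, by rw [← hz]; ring⟩
  choose z hz using hu1
  have h1 : ∑ s, v s * (u s) ^ (2 ^ r) = 0 := by
    have : PowerSeries.X ^ (N * 2 ^ r) * ∑ s, v s * (u s) ^ (2 ^ r) = 0 := by
      rw [Finset.mul_sum, ← h0]
      apply Finset.sum_congr rfl
      intro s _
      rw [hu s, mul_pow, pow_mul]; ring
    rcases mul_eq_zero.1 this with h | h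
    · exact absurd h (pow_ne_zero _ PowerSeries.X_ne_zero)
    · exact h
  refine ⟨fun s => (PowerSeries.constantCoeff (u s)) ^ (2 ^ r), ?_, ?_⟩
  · intro h
    have h2 := congrFun h s1
    simp only [Pi.zero_apply] at h2
    have h3 := pow_eq_zero_iff (by positivity) |>.1 h2
    rw [← PowerSeries.X_dvd_iff] at h3
    apply hs1
    rw [pow_succ, hu s1]
    exact mul_dvd_mul_left _ h3
  · have h2 : ∀ s, (u s) ^ (2 ^ r) = PowerSeries.C ((PowerSeries.constantCoeff (u s)) ^ (2 ^ r))
        + PowerSeries.X ^ (2 ^ r) * (z s) ^ (2 ^ r) := by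
      intro s
      conv_lhs => rw [hz s]
      rw [add_pow_char_pow, mul_pow, map_pow]
    have h3 : ∑ s, ((PowerSeries.constantCoeff (u s)) ^ (2 ^ r)) • v s =
        - (PowerSeries.X ^ (2 ^ r) * ∑ s, v s * (z s) ^ (2 ^ r)) := by
      rw [eq_neg_iff_add_eq_zero, Finset.mul_sum, ← Finset.sum_add_distrib, ← h1]
      apply Finset.sum_congr rfl
      intro s _
      rw [h2 s, PowerSeries.smul_eq_C_mul]; ring
    rw [h3]
    exact (Dvd.intro _ rfl).neg_right

lemma not_dvd_of_degree {h g : k[X][X]} (hm : h.Monic) (hg0 : g ≠ 0)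
    (hd : g.degree < h.natDegree) : ¬ h ∣ g := by
  apply hm.not_dvd_of_degree_lt hg0
  rwa [degree_eq_natDegree hm.ne_zero]

lemma branch_ne_zero {h : k[X][X]} (hm : h.Monic) (hw : h ∈ Wt k κ (κ * h.natDegree))
    (hp : Prime h) {g : k[X][X]} (hg : ¬ h ∣ g) {e : ℕ} (hge : g ∈ Wt k κ e)
    {x0 : k} {η : PowerSeries k} (hb : branch x0 η h = 0) : branch x0 η g ≠ 0 := by
  intro h0
  have := order_bound hm hw hp hg hge hb
    (N := h.natDegree * (e + κ * h.natDegree + 1) + 1) (by rw [h0]; exact dvd_zero _)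
  omega

/-- the auxiliary polynomial -/
noncomputable def aux (n l m c : ℕ) (μ : Fin n × Fin l → Fin n → Fin m → k) : k[X][X] :=
  ∑ s : Fin n × Fin l, (C (X ^ (s.2 : ℕ)) * X ^ (s.1 : ℕ)) * (redMap k n m (μ s)) ^ c

lemma aux_Wt (n l m c : ℕ) (μ : Fin n × Fin l → Fin n → Fin m → k) :
    aux n l m c μ ∈ Wt k κ (l + κ * n + c * (m + κ * n)) := by
  apply Submodule.sum_mem
  intro s _
  apply Wt_mul
  · rw [map_pow]
    refine Wt_mono ?_ (Wt_mul (Wt_pow Wt_CX _) (Wt_pow Wt_X _))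
    have h1 := s.1.2
    have h2 := s.2.2
    have : (s.1 : ℕ) * κ ≤ κ * n := by rw [mul_comm]; exact Nat.mul_le_mul_left _ h1.le
    omega
  · exact Wt_pow (redMap_Wt _) _

lemma aux_not_dvd [CharP k 2] {h : k[X][X]} (hm : h.Monic) (hw : h ∈ Wt k κ (κ * h.natDegree))
    (hp : Prime h) {x0 : k} {η : PowerSeries k} (hb : branch x0 η h = 0) (l m r : ℕ)
    (hr : h.natDegree * (l + κ * h.natDegree + κ * h.natDegree + 1) < 2 ^ r)
    (μ : Fin h.natDegree × Fin l → Fin h.natDegree → Fin m → k) (hμ : μ ≠ 0) :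
    ¬ h ∣ aux h.natDegree l m (2 ^ r) μ := by
  rintro ⟨q, hq⟩
  have h0 : branch x0 η (aux h.natDegree l m (2 ^ r) μ) = 0 := by rw [hq, map_mul, hb, zero_mul]
  rw [aux, map_sum] at h0
  simp only [map_mul, map_pow (branch x0 η) (redMap k _ _ _)] at h0
  obtain ⟨s0, hs0⟩ : ∃ s, μ s ≠ 0 := by
    by_contra! hh; exact hμ (funext hh)
  obtain ⟨a, ha, hdv⟩ := ps_frob r _ _ ⟨s0, by
    apply branch_ne_zero hm hw hp _ (redMap_Wt _) hb
    apply not_dvd_of_degree hm _ (redMap_degree _ _ _)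
    intro h2
    rw [← map_zero (redMap k h.natDegree m)] at h2
    exact hs0 (redMap_injective _ _ h2)⟩ h0
  have hsum : ∑ s : Fin h.natDegree × Fin l, a s • (branch x0 η (C (X ^ (s.2 : ℕ))) *
      branch x0 η (X ^ (s.1 : ℕ))) = branch x0 η (redMap k h.natDegree l (fun j i => a (j, i))) := by
    rw [redMap_apply, map_sum, Fintype.sum_prod_type]
    simp [map_sum, map_smul, map_mul]
  rw [hsum] at hdv
  have := order_bound hm hw hp (g := redMap k h.natDegree l (fun j i => a (j, i))) (by
    apply not_dvd_of_degree hm _ (redMap_degree _ _ _)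
    intro h2
    rw [← map_zero (redMap k h.natDegree l)] at h2
    have := redMap_injective _ _ h2
    apply ha
    ext ⟨j, i⟩
    exact congrFun (congrFun this j) i) (redMap_Wt _) hb hdv
  omega

end
end ExcAPN

namespace ExcAPN
open Polynomial
section
variable {k : Type*} [Field k] {κ : ℕ}

/-- reduced span -/
def Red (k : Type*) [Field k] {R : Type*} [CommRing R] [Algebra k R] (κ n : ℕ) (x y z : R) (T : ℕ) :
    Submodule k R :=
  Submodule.span k {a | ∃ i j l, j < n ∧ l < n - 1 ∧ i + κ * (j + l) ≤ T ∧ a = x ^ i * y ^ j * z ^ l}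

variable {R : Type*} [CommRing R] [Algebra k R] {n : ℕ} {x y z : R}

lemma Red_mono {T T' : ℕ} (h : T ≤ T') {a : R} (ha : a ∈ Red k κ n x y z T) :
    a ∈ Red k κ n x y z T' := by
  refine Submodule.span_mono ?_ ha
  rintro a ⟨i, j, l, h1, h2, h3, rfl⟩
  exact ⟨i, j, l, h1, h2, h3.trans h, rfl⟩

lemma Red_finrank (T : ℕ) : Module.Finite k (Red k κ n x y z T) ∧
    Module.finrank k (Red k κ n x y z T) ≤ n * (n - 1) * (T + 1) := by
  classical
  let F : Fin n × Fin (n - 1) × Fin (T + 1) → R := fun s =>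
    x ^ (s.2.2 : ℕ) * y ^ (s.1 : ℕ) * z ^ (s.2.1 : ℕ)
  have hsub : Red k κ n x y z T ≤ Submodule.span k (Set.range F) := by
    apply Submodule.span_mono
    rintro a ⟨i, j, l, h1, h2, h3, rfl⟩
    exact ⟨(⟨j, h1⟩, ⟨l, h2⟩, ⟨i, by omega⟩), rfl⟩
  have hfin : Module.Finite k (Submodule.span k (Set.range F)) :=
    FiniteDimensional.span_of_finite k (Set.finite_range F)
  refine ⟨Submodule.finiteDimensional_of_le hsub, ?_⟩
  refine (Submodule.finrank_mono hsub).trans ?_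
  refine (finrank_range_le_card F).trans ?_
  simp [mul_assoc]

/-- multiply an element by a polynomial in `x`. -/
lemma Red_poly {T D e : ℕ} (p : k[X]) (hp : p.natDegree ≤ D) (b : R)
    (hb : ∀ i ≤ D, x ^ (e + i) * b ∈ Red k κ n x y z T) :
    x ^ e * aeval x p * b ∈ Red k κ n x y z T := by
  rw [aeval_eq_sum_range' (n := D + 1) (by omega), Finset.mul_sum, Finset.sum_mul]
  apply Submodule.sum_mem
  intro i hi
  have := hb i (by simp at hi; omega)
  have h2 : x ^ e * p.coeff i • x ^ i * b = p.coeff i • (x ^ (e + i) * b) := by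
    rw [pow_add, mul_smul_comm, smul_mul_assoc]
  rw [h2]
  exact Submodule.smul_mem _ _ this

lemma Red_all {h : k[X][X]} (hm : h.Monic) (hw : h ∈ Wt k κ (κ * h.natDegree))
    (hn : 1 ≤ h.natDegree)
    (h1 : ∑ j ∈ Finset.range (h.natDegree + 1), aeval x (h.coeff j) * y ^ j = 0)
    (h2 : ∑ j ∈ Finset.range (h.natDegree + 1), aeval x (h.coeff j) *
      ∑ r ∈ Finset.range j, z ^ r * y ^ (j - 1 - r) = 0) :
    ∀ (l j i : ℕ), x ^ i * y ^ j * z ^ l ∈ Red k κ h.natDegree x y z (i + κ * (j + l)) := by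
  set n := h.natDegree with hnd
  have hdeg : ∀ j ≤ n, (h.coeff j).natDegree ≤ κ * (n - j) := by
    intro j hj
    by_cases h0 : h.coeff j = 0
    · simp [h0]
    · have := hw (h.coeff j).natDegree j (by
        change (h.coeff j).leadingCoeff ≠ 0
        simpa using h0)
      rw [Nat.mul_sub]; omega
  have hlead : h.coeff n = 1 := hm
  intro l
  induction l using Nat.strong_induction_on with
  | _ l ihl =>
  by_cases hl : l < n - 1
  · intro j
    induction j using Nat.strong_induction_on with
    | _ j ihj =>
    intro i
    by_cases hj : j < n
    · exact Submodule.subset_span ⟨i, j, l, hj, hl, le_refl _, rfl⟩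
    · push Not at hj
      rw [Finset.sum_range_succ, hlead, map_one, one_mul] at h1
      have hyn : y ^ n = - ∑ r ∈ Finset.range n, aeval x (h.coeff r) * y ^ r := by
        rw [eq_neg_iff_add_eq_zero, add_comm]; exact h1
      have : x ^ i * y ^ j * z ^ l = - ∑ r ∈ Finset.range n,
          x ^ i * aeval x (h.coeff r) * (y ^ (r + (j - n)) * z ^ l) := by
        conv_lhs => rw [show j = n + (j - n) by omega, pow_add, hyn]
        rw [mul_assoc, mul_assoc, neg_mul, mul_neg, Finset.sum_mul, Finset.mul_sum]
        congr 1
        apply Finset.sum_congr rfl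
        intro r _
        rw [pow_add]; ring
      rw [this]
      apply Submodule.neg_mem
      apply Submodule.sum_mem
      intro r hr
      rw [Finset.mem_range] at hr
      apply Red_poly _ (hdeg r hr.le)
      intro i' hi'
      rw [← mul_assoc]
      refine Red_mono ?_ (ihj (r + (j - n)) (by omega) (i + i'))
      have e1 : κ * (j + l) = κ * (n - r) + κ * (r + (j - n) + l) := by
        rw [← mul_add]; congr 1; omega
      omega
  · push Not at hl
    intro j i
    have h3 : z ^ (n - 1) = - ∑ a ∈ Finset.range (n + 1), ∑ r ∈ (Finset.range a).filter (· < n - 1),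
        aeval x (h.coeff a) * (z ^ r * y ^ (a - 1 - r)) := by
      rw [eq_neg_iff_add_eq_zero, ← h2]
      rw [Finset.sum_range_succ, Finset.sum_range_succ, hlead, map_one, one_mul, ← add_assoc,
        add_comm (z ^ (n - 1)), add_assoc]
      congr 1
      · apply Finset.sum_congr rfl
        intro a ha
        rw [Finset.mem_range] at ha
        rw [Finset.mul_sum, Finset.filter_true_of_mem]
        intro r hr; rw [Finset.mem_range] at hr; omega
      · obtain ⟨n', hn'⟩ : ∃ n', n = n' + 1 := ⟨n - 1, by omega⟩
        have hf : (Finset.range n).filter (· < n - 1) = Finset.range (n - 1) := by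
          ext r; simp; omega
        rw [hf]
        rw [hn', Finset.sum_range_succ]
        simp [add_comm]
    have : x ^ i * y ^ j * z ^ l = - ∑ a ∈ Finset.range (n + 1),
        ∑ r ∈ (Finset.range a).filter (· < n - 1),
        x ^ i * aeval x (h.coeff a) * (y ^ (j + (a - 1 - r)) * z ^ (r + (l - (n - 1)))) := by
      conv_lhs => rw [show l = n - 1 + (l - (n - 1)) by omega, pow_add, h3]
      rw [neg_mul, mul_neg, Finset.sum_mul, Finset.mul_sum]
      congr 1
      apply Finset.sum_congr rfl
      intro a _
      rw [Finset.sum_mul, Finset.mul_sum]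
      apply Finset.sum_congr rfl
      intro r _
      rw [pow_add, pow_add]; ring
    rw [this]
    apply Submodule.neg_mem
    apply Submodule.sum_mem
    intro a ha
    apply Submodule.sum_mem
    intro r hr
    simp only [Finset.mem_range, Finset.mem_filter] at ha hr
    apply Red_poly _ (hdeg a (by omega))
    intro i' hi'
    rw [← mul_assoc]
    refine Red_mono ?_ (ihl (r + (l - (n - 1))) (by omega) (j + (a - 1 - r)) (i + i'))
    have e1 : κ * (j + l) = κ * (n - a) + κ * (j + (a - 1 - r) + (r + (l - (n - 1)))) := by
      rw [← mul_add]; congr 1; omega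
    omega

end
end ExcAPN

namespace ExcAPN
open Polynomial
section
variable {k : Type*} [Field k] {κ : ℕ}

lemma evalEval_eq_sum (p : k[X][X]) (x y : k) :
    p.evalEval x y = ∑ j ∈ Finset.range (p.natDegree + 1), (p.coeff j).eval x * y ^ j := by
  rw [evalEval, eval_eq_sum_range (p := p), eval_finsetSum]
  simp

lemma eval_frob [CharP k 2] (p : k[X]) (e : ℕ) (hp : ∀ i, (p.coeff i) ^ (2 ^ e) = p.coeff i) (x : k) :
    p.eval (x ^ (2 ^ e)) = (p.eval x) ^ (2 ^ e) := by
  rw [eval_eq_sum_range, eval_eq_sum_range, sum_pow_char_pow]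
  apply Finset.sum_congr rfl
  intro i _
  rw [mul_pow, hp, pow_right_comm]

lemma evalEval_frob [CharP k 2] (p : k[X][X]) (e : ℕ)
    (hp : ∀ i j, ((p.coeff j).coeff i) ^ (2 ^ e) = (p.coeff j).coeff i) (x y : k) :
    p.evalEval (x ^ (2 ^ e)) (y ^ (2 ^ e)) = (p.evalEval x y) ^ (2 ^ e) := by
  rw [evalEval_eq_sum, evalEval_eq_sum, sum_pow_char_pow]
  apply Finset.sum_congr rfl
  intro j _
  rw [mul_pow, eval_frob _ _ (fun i => hp i j), pow_right_comm]

lemma redMap_evalEval (n m : ℕ) (a : Fin n → Fin m → k) (x y : k) :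
    (redMap k n m a).evalEval x y = ∑ j : Fin n, ∑ i : Fin m, a j i * (x ^ (i : ℕ) * y ^ (j : ℕ)) := by
  rw [redMap_apply, evalEval_finsetSum]
  apply Finset.sum_congr rfl
  intro j _
  rw [evalEval_finsetSum]
  apply Finset.sum_congr rfl
  intro i _
  rw [evalEval_smul, evalEval_mul, evalEval_C, evalEval_pow, evalEval_X, eval_pow, eval_X, smul_eq_mul]

lemma B_bound [IsAlgClosed k] [CharP k 2] {h : k[X][X]} (hm : h.Monic)
    (hw : h ∈ Wt k κ (κ * h.natDegree)) (hn : 1 ≤ h.natDegree)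
    (hp : Prime h) {x0 : k} {η : PowerSeries k} (hb : branch x0 η h = 0) (l m r r' : ℕ)
    (hfix : ∀ i j, ((h.coeff j).coeff i) ^ (2 ^ (r + r')) = (h.coeff j).coeff i)
    (hr : h.natDegree * (l + κ * h.natDegree + κ * h.natDegree + 1) < 2 ^ r)
    (hdim : h.natDegree * (h.natDegree - 1) *
        (2 ^ r' * l + m + κ * h.natDegree * 2 ^ r' + κ * h.natDegree + 1)
        < h.natDegree * l * (h.natDegree * m))
    (S : Finset (k × k)) (hS : ∀ s ∈ S, h.evalEval s.1 s.2 = 0 ∧ s.1 ^ (2 ^ (r + r')) = s.1 ∧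
      s.2 ^ (2 ^ (r + r')) ≠ s.2) :
    S.card ≤ h.natDegree * (l + κ * h.natDegree + 2 ^ r * (m + κ * h.natDegree)
      + κ * h.natDegree + 1) := by
  classical
  set n := h.natDegree with hnd
  set Q := 2 ^ (r + r') with hQ
  let x : S → k := fun s => s.1.1
  let y : S → k := fun s => s.1.2
  let z : S → k := fun s => s.1.2 ^ Q
  have hae : ∀ (p : k[X]) (s : S), (aeval x p) s = p.eval (x s) := by
    intro p s
    have : (Pi.evalAlgHom k (fun _ : S => k) s) (aeval x p) = aeval (x s) p := by
      rw [← aeval_algHom_apply]; rfl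
    rw [← coe_aeval_eq_eval, ← this]; rfl
  have rel1 : ∑ j ∈ Finset.range (n + 1), aeval x (h.coeff j) * y ^ j = 0 := by
    ext s
    simp only [Finset.sum_apply, Pi.mul_apply, Pi.pow_apply, Pi.zero_apply, hae]
    rw [← (hS s.1 s.2).1, evalEval_eq_sum]
  have hz : ∀ s : S, h.evalEval (x s) (z s) = 0 := by
    intro s
    have := evalEval_frob h (r + r') hfix s.1.1 s.1.2
    rw [(hS s.1 s.2).1, ← hQ, (hS s.1 s.2).2.1, zero_pow (by positivity)] at this
    exact this
  have rel2 : ∑ j ∈ Finset.range (n + 1), aeval x (h.coeff j) *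
      ∑ a ∈ Finset.range j, z ^ a * y ^ (j - 1 - a) = 0 := by
    ext s
    simp only [Finset.sum_apply, Pi.mul_apply, Pi.pow_apply, Pi.zero_apply, hae]
    have hne : z s - y s ≠ 0 := sub_ne_zero.2 (hS s.1 s.2).2.2
    apply mul_right_cancel₀ hne
    rw [zero_mul, Finset.sum_mul]
    have e1 := hz s
    have e2 := (hS s.1 s.2).1
    rw [evalEval_eq_sum] at e1 e2
    have : ∀ j, eval (x s) (h.coeff j) * (∑ a ∈ Finset.range j, z s ^ a * y s ^ (j - 1 - a)) *
        (z s - y s) = eval (x s) (h.coeff j) * z s ^ j - eval (x s) (h.coeff j) * y s ^ j := by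
      intro j
      rw [mul_assoc, (Commute.all (z s) (y s)).geom_sum₂_mul]; ring
    simp only [this, Finset.sum_sub_distrib]
    rw [e1]; erw [e2]; simp
  have hred := Red_all (z := z) hm hw hn rel1 rel2
  set T := 2 ^ r' * l + m + κ * n * 2 ^ r' + κ * n with hT
  let I := (Fin n × Fin l) × (Fin n × Fin m)
  let mon : I → (S → k) := fun t =>
    x ^ ((t.1.2 : ℕ) * 2 ^ r' + t.2.2) * y ^ ((t.1.1 : ℕ) * 2 ^ r') * z ^ (t.2.1 : ℕ)
  have hmon : ∀ t, mon t ∈ Red k κ n x y z T := by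
    rintro ⟨⟨j, i⟩, ⟨j', i'⟩⟩
    refine Red_mono ?_ (hred _ _ _)
    dsimp only
    have a1 : (i : ℕ) * 2 ^ r' ≤ 2 ^ r' * l := by
      rw [mul_comm]; exact Nat.mul_le_mul_left _ i.2.le
    have a2 := i'.2
    have a3 : κ * ((j : ℕ) * 2 ^ r' + j') ≤ κ * n * 2 ^ r' + κ * n := by
      rw [mul_add, ← mul_assoc]
      exact Nat.add_le_add (Nat.mul_le_mul_right _ (Nat.mul_le_mul_left _ j.2.le))
        (Nat.mul_le_mul_left _ j'.2.le)
    omega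
  let Φ : (I → k) →ₗ[k] (Red k κ n x y z T) :=
    Fintype.linearCombination k (fun t => (⟨mon t, hmon t⟩ : Red k κ n x y z T))
  obtain ⟨hfd, hfr⟩ := Red_finrank (k := k) (κ := κ) (n := n) (x := x) (y := y) (z := z) T
  have hker : LinearMap.ker Φ ≠ ⊥ := by
    apply LinearMap.ker_ne_bot_of_finrank_lt
    rw [Module.finrank_pi]
    have : Fintype.card I = n * l * (n * m) := by simp [I]
    rw [this]
    omega
  obtain ⟨lam, hlam, hlam0⟩ := Submodule.exists_mem_ne_zero_of_ne_bot hker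
  have hroot : ∀ a : k, ∃ u : k, u ^ Q = a := fun a => IsAlgClosed.exists_pow_nat_eq a (by positivity)
  choose rt hrt using hroot
  let μ : Fin n × Fin l → Fin n → Fin m → k := fun s j i => rt (lam (s, (j, i)))
  have hμ : μ ≠ 0 := by
    intro h0
    apply hlam0
    ext ⟨s, j, i⟩
    have := congrFun (congrFun (congrFun h0 s) j) i
    simp only [μ, Pi.zero_apply] at this
    rw [← hrt (lam (s, j, i)), this, zero_pow (by positivity)]; rfl
  have hnd := aux_not_dvd hm hw hp hb l m r hr μ hμ
  refine zeros_bound hm hw hp hnd (aux_Wt _ _ _ _ _) S (fun s hs => (hS s hs).1) ?_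
  intro s hs
  have hmem : Φ lam = 0 := hlam
  have h3 := congrFun (congrArg (Subtype.val) hmem) ⟨s, hs⟩
  simp only [Φ, Fintype.linearCombination_apply] at h3
  rw [Submodule.coe_sum] at h3
  simp only [Submodule.coe_smul, Finset.sum_apply, Pi.smul_apply, smul_eq_mul, ZeroMemClass.coe_zero,
    Pi.zero_apply] at h3
  rw [← pow_eq_zero_iff (n := 2 ^ r') (by positivity), ← h3, aux, evalEval_finsetSum, sum_pow_char_pow,
    Fintype.sum_prod_type (f := fun t : I => _)]
  apply Finset.sum_congr rfl
  rintro ⟨j, i⟩ _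
  rw [evalEval_mul, evalEval_mul, evalEval_C, evalEval_pow, evalEval_pow, evalEval_X, eval_pow, eval_X,
    redMap_evalEval, mul_pow, ← pow_mul _ (2 ^ r), ← pow_add, sum_pow_char_pow]
  rw [Fintype.sum_prod_type, Finset.mul_sum]
  apply Finset.sum_congr rfl
  intro j' _
  rw [sum_pow_char_pow, Finset.mul_sum]
  apply Finset.sum_congr rfl
  intro i' _
  rw [← hQ, mul_pow (μ (j, i) j' i') _ Q, show μ (j, i) j' i' ^ Q = lam ((j, i), j', i') from hrt _, mul_pow _ _ Q]
  simp only [mon, Pi.mul_apply, Pi.pow_apply, x, y, z]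
  have hx := (hS s hs).2.1
  have e1 : (s.1 ^ (i' : ℕ)) ^ Q = s.1 ^ (i' : ℕ) := by rw [pow_right_comm, hx]
  have e2 : (s.2 ^ (j' : ℕ)) ^ Q = (s.2 ^ Q) ^ (j' : ℕ) := by rw [pow_right_comm]
  rw [e1, e2, pow_add, pow_mul, pow_mul]; ring

end
end ExcAPN

namespace ExcAPN
open Polynomial
section
variable {k : Type*} [Field k] {κ : ℕ}

lemma Wt_derivative {e : ℕ} {p : k[X][X]} (hp : p ∈ Wt k κ e) : derivative p ∈ Wt k κ e := by
  intro i j h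
  rw [coeff_derivative] at h
  have : (p.coeff (j + 1)).coeff i ≠ 0 := by
    intro h0
    apply h
    rw [show ((j : k[X]) + 1) = ((j + 1 : ℕ) : k[X]) by push_cast; rfl, ← C_eq_natCast, coeff_mul_C, h0,
      zero_mul]
  have := hp _ _ this
  rw [mul_add] at this; omega

lemma evalEval_eq_eval_map (p : k[X][X]) (x y : k) :
    p.evalEval x y = (p.map (evalRingHom x)).eval y := by
  rw [evalEval_eq_sum, eval_map, eval₂_eq_sum_range]; rfl

lemma not_dvd_derivative {h : k[X][X]} (hm : h.Monic) (hd : derivative h ≠ 0) : ¬ h ∣ derivative h := by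
  apply hm.not_dvd_of_degree_lt hd
  exact degree_derivative_lt hm.ne_zero

/-- the number of points with `x` in a finite set. -/
lemma count_lower [IsAlgClosed k] {h : k[X][X]} (hm : h.Monic)
    (hw : h ∈ Wt k κ (κ * h.natDegree)) (hp : Prime h) (hd : derivative h ≠ 0)
    (A : Finset k) (S : Finset (k × k))
    (hS : ∀ x y, x ∈ A → h.evalEval x y = 0 → (x, y) ∈ S) :
    h.natDegree * A.card ≤ S.card +
      h.natDegree * (h.natDegree * (κ * h.natDegree + κ * h.natDegree + 1)) := by
  classical
  set n := h.natDegree with hnd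
  set Z := n * (κ * n + κ * n + 1) with hZ
  let Bad := A.filter (fun x => ∃ y, h.evalEval x y = 0 ∧ (derivative h).evalEval x y = 0)
  let Good := A.filter (fun x => ¬ ∃ y, h.evalEval x y = 0 ∧ (derivative h).evalEval x y = 0)
  have hcard : Bad.card + Good.card = A.card := Finset.card_filter_add_card_filter_not _
  have hBad : Bad.card ≤ Z := by
    have : ∀ x ∈ Bad, ∃ y, h.evalEval x y = 0 ∧ (derivative h).evalEval x y = 0 := fun x hx =>
      (Finset.mem_filter.1 hx).2
    choose! yy hyy using this
    have h1 := zeros_bound hm hw hp (not_dvd_derivative hm hd) (Wt_derivative hw)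
      (Bad.image (fun x => (x, yy x))) (by
        intro s hs
        obtain ⟨x, hx, rfl⟩ := Finset.mem_image.1 hs
        exact (hyy x hx).1) (by
        intro s hs
        obtain ⟨x, hx, rfl⟩ := Finset.mem_image.1 hs
        exact (hyy x hx).2)
    rw [Finset.card_image_of_injective _ (by intro a b hab; exact (Prod.ext_iff.1 hab).1)] at h1
    exact h1
  have hGood : n * Good.card ≤ S.card := by
    have hmaps : ∀ x ∈ Good, n ≤ (S.filter (fun s => s.1 = x)).card := by
      intro x hx
      obtain ⟨hxA, hx⟩ := Finset.mem_filter.1 hx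
      push Not at hx
      let p := h.map (evalRingHom x)
      have hpm : p.Monic := hm.map _
      have hpn : p.natDegree = n := hm.natDegree_map _
      have hsep : p.roots.Nodup := by
        rw [Multiset.nodup_iff_count_le_one]
        intro y
        rw [count_roots]
        by_contra hc
        push Not at hc
        have hh := (one_lt_rootMultiplicity_iff_isRoot hpm.ne_zero).1 hc
        rw [IsRoot, IsRoot, derivative_map, ← evalEval_eq_eval_map, ← evalEval_eq_eval_map] at hh
        exact hx y hh.1 hh.2
      have hc : p.roots.card = n := by
        rw [← hpn]; exact IsAlgClosed.card_roots_eq_natDegree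
      have h2 : p.roots.toFinset.card = n := by
        rw [Multiset.toFinset_card_of_nodup hsep, hc]
      rw [← h2]
      apply Finset.card_le_card_of_injOn (fun y => (x, y))
      · intro y hy
        simp only [Finset.mem_coe, Multiset.mem_toFinset] at hy
        have := (mem_roots hpm.ne_zero).1 hy
        rw [IsRoot, ← evalEval_eq_eval_map] at this
        simp only [Finset.coe_filter, Set.mem_setOf_eq, and_true]
        exact hS x y hxA this
      · intro a _ b _ hab
        exact (Prod.ext_iff.1 hab).2
    have := Finset.sum_le_sum hmaps
    rw [Finset.sum_const, smul_eq_mul, mul_comm] at this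
    refine this.trans ?_
    rw [← Finset.card_biUnion]
    · apply Finset.card_le_card
      intro s hs
      obtain ⟨x, -, hs⟩ := Finset.mem_biUnion.1 hs
      exact (Finset.mem_filter.1 hs).1
    · intro a _ b _ hab
      rw [Function.onFun, Finset.disjoint_left]
      intro s h1 h2
      exact hab ((Finset.mem_filter.1 h1).2.symm.trans (Finset.mem_filter.1 h2).2)
  rw [← hcard, mul_add]
  have := Nat.mul_le_mul_left n hBad
  omega

lemma exists_branch [IsAlgClosed k] {h : k[X][X]} (hm : h.Monic)
    (hw : h ∈ Wt k κ (κ * h.natDegree)) (hp : Prime h) (hn : 1 ≤ h.natDegree) (hd : derivative h ≠ 0) :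
    ∃ (x0 : k) (η : PowerSeries k), branch x0 η h = 0 := by
  classical
  have hinf : Infinite k := IsAlgClosed.instInfinite
  by_contra! hno
  obtain ⟨A, hA⟩ := Infinite.exists_subset_card_eq k
    (h.natDegree * (κ * h.natDegree + κ * h.natDegree + 1) + 1)
  have hx : ∀ x, ∃ y, h.evalEval x y = 0 ∧ (derivative h).evalEval x y = 0 := by
    intro x
    obtain ⟨y, hy⟩ := IsAlgClosed.exists_root (h.map (evalRingHom x)) (by
      rw [hm.degree_map, degree_eq_natDegree hm.ne_zero]
      exact_mod_cast (by omega))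
    rw [IsRoot, ← evalEval_eq_eval_map] at hy
    refine ⟨y, hy, ?_⟩
    by_contra h1
    obtain ⟨η, hη⟩ := branch_exists hm hy h1
    exact hno x η hη
  choose yy hyy using hx
  have h1 := zeros_bound hm hw hp (not_dvd_derivative hm hd) (Wt_derivative hw)
      (A.image (fun x => (x, yy x))) (by
        intro s hs
        obtain ⟨x, hx, rfl⟩ := Finset.mem_image.1 hs
        exact (hyy x).1) (by
        intro s hs
        obtain ⟨x, hx, rfl⟩ := Finset.mem_image.1 hs
        exact (hyy x).2)
  rw [Finset.card_image_of_injective _ (by intro a b hab; exact (Prod.ext_iff.1 hab).1), hA] at h1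
  omega

end
end ExcAPN

namespace ExcAPN
open Polynomial
section

lemma step_arith (n M K Z b c : ℕ) (hn : 1 ≤ n) (hbc : b ≤ c)
    (hb : n * (2 * n * (M + 3) + 2 * (M + 2) + 5) + K + 2 * M + 2 + Z + 2 * n * (M + 2) ≤ b) :
    ∃ l m, n * (l + M + M + 1) < c ∧
      n * (n - 1) * (b * l + m + M * b + M + 1) < n * l * (n * m) ∧
      K + n * (l + M + c * (m + M) + M + 1) + n * Z < n * (c * b) := by
  obtain ⟨t, ht⟩ : ∃ t, t = c / n := ⟨_, rfl⟩
  have h1 : n * t ≤ c := by rw [ht]; exact Nat.mul_div_le c n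
  have h2 : c < n * (t + 1) := by
    rw [ht, mul_comm]; exact Nat.lt_mul_of_div_lt (by omega) (by omega)
  have ht2 : 2 * n * (M + 3) + 2 * (M + 2) + 4 ≤ t := by
    have : n * (2 * n * (M + 3) + 2 * (M + 2) + 5) < n * (t + 1) := by omega
    have := lt_of_mul_lt_mul_left this (Nat.zero_le n)
    omega
  obtain ⟨l, hl⟩ : ∃ l, t = l + 2 * M + 2 := ⟨t - (2 * M + 2), by omega⟩
  have h5 : M + 2 ≤ 2 * n * (M + 2) := by nlinarith
  obtain ⟨m, hm⟩ : ∃ m, b = m + (M + 2) := ⟨b - (M + 2), by omega⟩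
  have hl2 : 2 * n * (M + 3) ≤ l := by omega
  have hlt : n * (l + M + M + 1) < c := by
    have : n * (l + M + M + 1) < n * t := by
      apply Nat.mul_lt_mul_of_pos_left <;> omega
    omega
  refine ⟨l, m, hlt, ?_, ?_⟩
  · obtain ⟨n', rfl⟩ : ∃ n', n = n' + 1 := ⟨n - 1, by omega⟩
    rw [Nat.add_sub_cancel, mul_assoc, mul_assoc]
    apply Nat.mul_lt_mul_of_pos_left _ (by omega)
    have hbn : 2 * (n' + 1) * (M + 2) ≤ b := by omega
    rw [hm] at hbn ⊢
    -- goal: n' * ((m+(M+2)) * l + m + M * (m+(M+2)) + M + 1) < l * ((n'+1) * m)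
    zify at hbn hl2 hn ⊢
    have hm0 : (0 : ℤ) ≤ m := by positivity
    have hn0 : (0 : ℤ) ≤ n' := by positivity
    have hM0 : (0 : ℤ) ≤ M := by positivity
    have key : (l : ℤ) * (m - n' * (M + 2)) > n' * (m + M * (m + (M + 2)) + M + 1) := by
      have e1 : (m : ℤ) - n' * (M + 2) ≥ n' * (M + 2) + (M + 2) := by linarith
      have e2 : 2 * ((m : ℤ) - n' * (M + 2)) ≥ m + (M + 2) := by linarith
      have e3 : (l : ℤ) * (m - n' * (M + 2)) ≥ 2 * (n' + 1) * (M + 3) * (m - n' * (M + 2)) := by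
        apply mul_le_mul_of_nonneg_right hl2
        have : (0 : ℤ) ≤ n' * (M + 2) := by positivity
        linarith
      have e4 : 2 * ((n' : ℤ) + 1) * (M + 3) * (m - n' * (M + 2)) ≥ (n' + 1) * (M + 3) * (m + (M + 2)) := by
        have h0 : (0 : ℤ) ≤ (n' + 1) * (M + 3) := by positivity
        have := mul_le_mul_of_nonneg_left e2 h0
        linarith
      have e5 : ((n' : ℤ) + 1) * (M + 3) * (m + (M + 2)) > n' * (m + M * (m + (M + 2)) + M + 1) := by
        have h1 : (0:ℤ) ≤ n' * M := by positivity
        have h2 : (0:ℤ) ≤ n' * m := by positivity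
        have h3 : (0:ℤ) ≤ M * m := by positivity
        have h4 : (0:ℤ) ≤ n' * M * M := by positivity
        have h5 : (0:ℤ) ≤ n' * M * m := by positivity
        have h6 : (0:ℤ) ≤ M * M := by positivity
        linarith
      linarith
    linarith
  · have e1 : K + n * (l + M + M + 1) + n * Z + n * (c * (m + M)) < n * (c * b) := by
      rw [hm]
      have : K + Z + (l + M + M + 1) < 2 * c := by
        have : l + M + M + 1 ≤ n * (l + M + M + 1) := by nlinarith
        omega
      have h3 : n * (K + Z + (l + M + M + 1)) < n * (2 * c) :=
        Nat.mul_lt_mul_of_pos_left this (by omega)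
      have h4 : K ≤ n * K := by nlinarith
      have h6 : n * (c * (m + (M + 2))) = n * (c * (m + M)) + n * (2 * c) := by ring
      have h7 : n * (K + Z + (l + M + M + 1)) = n * K + n * Z + n * (l + M + M + 1) := by ring
      omega
    have h8 : n * (l + M + c * (m + M) + M + 1) = n * (l + M + M + 1) + n * (c * (m + M)) := by ring
    omega
end
section
variable {k : Type*} [Field k]

lemma card_frob_fixed [IsAlgClosed k] [CharP k 2] (e : ℕ) (he : e ≠ 0) :
    ∃ A : Finset k, A.card = 2 ^ e ∧ ∀ x, x ∈ A ↔ x ^ (2 ^ e) = x := by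
  classical
  have hsep : (X ^ (2 ^ e) - X : k[X]).Separable := galois_poly_separable 2 (2 ^ e) (dvd_pow_self 2 he)
  have h1 : 1 < 2 ^ e := Nat.one_lt_two_pow he
  have hne : (X ^ (2 ^ e) - X : k[X]) ≠ 0 := FiniteField.X_pow_card_sub_X_ne_zero k h1
  refine ⟨(X ^ (2 ^ e) - X : k[X]).roots.toFinset, ?_, ?_⟩
  · rw [Multiset.toFinset_card_of_nodup (nodup_roots hsep), IsAlgClosed.card_roots_eq_natDegree,
      FiniteField.X_pow_card_sub_X_natDegree_eq k h1]
  · intro x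
    rw [Multiset.mem_toFinset, mem_roots hne]
    simp [IsRoot, sub_eq_zero]

theorem stepanov_sep [IsAlgClosed k] [CharP k 2] (n κ K : ℕ) (hn : 1 ≤ n) :
    ∃ e0, ∀ e ≥ e0, ∀ h : k[X][X], h.Monic → h.natDegree = n → h ∈ Wt k κ (κ * n) →
      Prime h → derivative h ≠ 0 →
      (∀ i j, ((h.coeff j).coeff i) ^ (2 ^ e) = (h.coeff j).coeff i) →
      ∃ S : Finset (k × k), K < S.card ∧ ∀ s ∈ S, h.evalEval s.1 s.2 = 0 ∧
        s.1 ^ (2 ^ e) = s.1 ∧ s.2 ^ (2 ^ e) = s.2 := by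
  classical
  set Z := n * (κ * n + κ * n + 1) with hZ
  set N := n * (2 * n * (κ * n + 3) + 2 * (κ * n + 2) + 5) + K + 2 * (κ * n) + 2 + Z +
    2 * n * (κ * n + 2) with hN
  refine ⟨2 * N + 2, ?_⟩
  intro e he h hm hdn hw hp hd hfix
  obtain ⟨r, r', hrr, hr1, hr2⟩ : ∃ r r', r + r' = e ∧ r' ≤ r ∧ N ≤ r' :=
    ⟨e - e / 2, e / 2, by omega, by omega, by omega⟩
  have hb : N ≤ 2 ^ r' := hr2.trans (Nat.lt_two_pow_self).le
  obtain ⟨l, m, c1, c2, c3⟩ := step_arith n (κ * n) K Z (2 ^ r') (2 ^ r) hn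
    (Nat.pow_le_pow_right (by norm_num) hr1) hb
  subst hdn hrr
  obtain ⟨x0, η, hbr⟩ := exists_branch hm hw hp hn hd
  obtain ⟨A, hA, hAm⟩ := card_frob_fixed (k := k) (r + r') (by omega)
  let Sall : Finset (k × k) := A.biUnion (fun x =>
    ((h.map (evalRingHom x)).roots.toFinset).image (fun y => (x, y)))
  have hSall : ∀ x y, (x, y) ∈ Sall ↔ x ∈ A ∧ h.evalEval x y = 0 := by
    intro x y
    simp only [Sall, Finset.mem_biUnion, Finset.mem_image, Multiset.mem_toFinset, Prod.mk.injEq]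
    constructor
    · rintro ⟨a, ha, b, hb, rfl, rfl⟩
      refine ⟨ha, ?_⟩
      rw [evalEval_eq_eval_map]
      exact (mem_roots (hm.map _).ne_zero).1 hb
    · rintro ⟨ha, hb⟩
      refine ⟨x, ha, y, ?_, rfl, rfl⟩
      rw [mem_roots (hm.map _).ne_zero, IsRoot, ← evalEval_eq_eval_map]; exact hb
  have hlow := count_lower hm hw hp hd A Sall (fun x y hx hy => (hSall x y).2 ⟨hx, hy⟩)
  refine ⟨Sall.filter (fun s => s.2 ^ (2 ^ (r + r')) = s.2), ?_, ?_⟩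
  · have hB := B_bound hm hw hn hp hbr l m r r' hfix c1 c2
      (Sall.filter (fun s => ¬ s.2 ^ (2 ^ (r + r')) = s.2)) (by
        rintro ⟨x, y⟩ hs
        obtain ⟨hs, h2⟩ := Finset.mem_filter.1 hs
        obtain ⟨h3, h4⟩ := (hSall x y).1 hs
        exact ⟨h4, (hAm x).1 h3, h2⟩)
    have hsplit := Finset.card_filter_add_card_filter_not (s := Sall)
      (fun s => s.2 ^ (2 ^ (r + r')) = s.2)
    rw [hA, pow_add] at hlow
    have : h.natDegree * (h.natDegree * (κ * h.natDegree + κ * h.natDegree + 1)) = h.natDegree * Z := rfl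
    omega
  · rintro ⟨x, y⟩ hs
    obtain ⟨hs, h2⟩ := Finset.mem_filter.1 hs
    obtain ⟨h3, h4⟩ := (hSall x y).1 hs
    exact ⟨h4, (hAm x).1 h3, h2⟩

end
end ExcAPN

namespace ExcAPN
open Polynomial
section
variable {k : Type*} [Field k]

lemma exists_sep_contract [CharP k 2] : ∀ (n : ℕ) (h : k[X][X]), h.natDegree = n → 1 ≤ n →
    Irreducible h → ∃ (s : ℕ) (h1 : k[X][X]), h = expand k[X] (2 ^ s) h1 ∧ Irreducible h1 ∧
      derivative h1 ≠ 0 := by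
  intro n
  induction n using Nat.strong_induction_on with
  | _ n ih =>
  intro h hn h1n hirr
  by_cases hd : derivative h = 0
  · have hexp := expand_contract 2 hd (by norm_num)
    have hirr2 : Irreducible (contract 2 h) := by
      apply of_irreducible_expand (p := 2) (by norm_num)
      rwa [hexp]
    have hdeg : (contract 2 h).natDegree * 2 = n := by
      rw [← natDegree_expand, hexp, hn]
    obtain ⟨s, h1, e1, e2, e3⟩ := ih _ (by omega) (contract 2 h) rfl (by omega) hirr2
    refine ⟨s + 1, h1, ?_, e2, e3⟩
    rw [← hexp, e1, expand_expand, pow_succ, mul_comm]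
  · exact ⟨0, h, by simp, hirr, hd⟩

lemma expand_evalEval (s : ℕ) (p : k[X][X]) (x y : k) :
    (expand k[X] s p).evalEval x y = p.evalEval x (y ^ s) := by
  rw [evalEval, expand_eval, ← C_pow]

theorem stepanov [IsAlgClosed k] [CharP k 2] (n K : ℕ) (hn : 1 ≤ n) :
    ∃ e0, ∀ e ≥ e0, ∀ h : k[X][X], h.Monic → h.natDegree = n → h ∈ Wt k 1 n →
      Irreducible h →
      (∀ i j, ((h.coeff j).coeff i) ^ (2 ^ e) = (h.coeff j).coeff i) →
      ∃ S : Finset (k × k), K < S.card ∧ ∀ s ∈ S, h.evalEval s.1 s.2 = 0 ∧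
        s.1 ^ (2 ^ e) = s.1 ∧ s.2 ^ (2 ^ e) = s.2 := by
  classical
  have hex : ∀ n1 κ : ℕ, ∃ e0, 1 ≤ n1 → ∀ e ≥ e0, ∀ h : k[X][X], h.Monic → h.natDegree = n1 →
      h ∈ Wt k κ (κ * n1) → Prime h → derivative h ≠ 0 →
      (∀ i j, ((h.coeff j).coeff i) ^ (2 ^ e) = (h.coeff j).coeff i) →
      ∃ S : Finset (k × k), K < S.card ∧ ∀ s ∈ S, h.evalEval s.1 s.2 = 0 ∧
        s.1 ^ (2 ^ e) = s.1 ∧ s.2 ^ (2 ^ e) = s.2 := by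
    intro n1 κ
    by_cases h1 : 1 ≤ n1
    · obtain ⟨e0, he0⟩ := stepanov_sep (k := k) n1 κ K h1
      exact ⟨e0, fun _ => he0⟩
    · exact ⟨0, fun h2 => absurd h2 h1⟩
  choose E hE using hex
  refine ⟨((Finset.range (n + 1)) ×ˢ (Finset.range (n + 1))).sup (fun p => E p.1 p.2), ?_⟩
  intro e he h hm hdn hw hirr hfix
  obtain ⟨s, h1, e1, e2, e3⟩ := exists_sep_contract n h hdn hn hirr
  have hs0 : 0 < 2 ^ s := by positivity
  have hm1 : h1.Monic := by
    rw [e1] at hm; exact (monic_expand_iff hs0).1 hm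
  have hdeg : h1.natDegree * 2 ^ s = n := by rw [← natDegree_expand, ← e1, hdn]
  have hcoef : ∀ j, h1.coeff j = h.coeff (j * 2 ^ s) := by
    intro j; rw [e1, coeff_expand_mul hs0]
  have hn1 : 1 ≤ h1.natDegree := by
    by_contra hc
    have : h1.natDegree = 0 := by omega
    rw [this] at hdeg; omega
  obtain ⟨S, hS, hS2⟩ := hE h1.natDegree (2 ^ s) hn1 e (by
    refine le_trans ?_ he
    have hmem : (h1.natDegree, 2 ^ s) ∈ (Finset.range (n + 1)) ×ˢ (Finset.range (n + 1)) := by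
      simp only [Finset.mem_product, Finset.mem_range]
      constructor <;> nlinarith
    exact Finset.le_sup (f := fun p : ℕ × ℕ => E p.1 p.2) hmem) h1 hm1 rfl (by
    intro i j hij
    rw [hcoef] at hij
    have := hw _ _ hij
    rw [mul_comm (2 ^ s) h1.natDegree, hdeg]
    linarith) e2.prime e3 (by
    intro i j; rw [hcoef]; exact hfix _ _)
  have hroot : ∀ a : k, ∃ u : k, u ^ (2 ^ s) = a := fun a => IsAlgClosed.exists_pow_nat_eq a hs0
  choose rt hrt using hroot
  refine ⟨S.image (fun p => (p.1, rt p.2)), ?_, ?_⟩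
  · rw [Finset.card_image_of_injective]
    · exact hS
    · rintro ⟨a, b⟩ ⟨a', b'⟩ hab
      simp only [Prod.mk.injEq] at hab ⊢
      refine ⟨hab.1, ?_⟩
      rw [← hrt b, hab.2, hrt]
  · intro p hp
    obtain ⟨⟨a, b⟩, hab, rfl⟩ := Finset.mem_image.1 hp
    obtain ⟨h3, h4, h5⟩ := hS2 _ hab
    refine ⟨?_, h4, ?_⟩
    · dsimp only
      rw [e1, expand_evalEval, hrt]; exact h3
    · dsimp only at h5 ⊢
      apply iterateFrobenius_inj k 2 s
      rw [iterateFrobenius_def, iterateFrobenius_def, ← pow_mul, mul_comm, pow_mul, hrt, h5]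

end
end ExcAPN

namespace ExcAPN
open Polynomial
section
variable (A : Type*) [CommRing A]

/-- `x + y + 1` -/
noncomputable def ww : A[X][X] := C X + X + 1
/-- the product of the three trivial lines -/
noncomputable def TT : A[X][X] := (C X + X) * (C X + 1) * (X + 1)
/-- second elementary symmetric function -/
noncomputable def E2 : A[X][X] := C X * X + C X + C X * ww A + X + X * ww A + ww A
/-- third elementary symmetric function -/
noncomputable def E3 : A[X][X] := C X * X + C X * X * ww A + C X * ww A + X * ww A
/-- fourth elementary symmetric function -/
noncomputable def E4 : A[X][X] := C X * X * ww A

/-- The polynomials `(x^m + y^m + 1 + (x+y+1)^m) / ((x+y)(x+1)(y+1))`. -/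
noncomputable def PP : ℕ → A[X][X]
  | 0 => 0
  | 1 => 0
  | 2 => 0
  | 3 => 1
  | (m + 4) => E2 A * PP (m + 2) + E3 A * PP (m + 1) + E4 A * PP m

/-- second-degree trace -/
noncomputable def GG (c : ℕ → A) (d : ℕ) (μ : A) : A[X][X] :=
  ∑ j ∈ Finset.range (d + 1), C (C (c j * μ ^ (d - j))) * PP A j

variable {A}
lemma PP_map {B : Type*} [CommRing B] (f : A →+* B) : ∀ m, (PP A m).map (mapRingHom f) = PP B m
  | 0 => by simp [PP]
  | 1 => by simp [PP]
  | 2 => by simp [PP]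
  | 3 => by simp [PP]
  | (m + 4) => by
    rw [PP, PP, ← PP_map f (m + 2), ← PP_map f (m + 1), ← PP_map f m]
    simp [E2, E3, E4, ww]

lemma GG_map {B : Type*} [CommRing B] (f : A →+* B) (c : ℕ → A) (d : ℕ) (μ : A) :
    (GG A c d μ).map (mapRingHom f) = GG B (fun j => f (c j)) d (f μ) := by
  simp only [GG, Polynomial.map_sum, Polynomial.map_mul, PP_map]
  simp

lemma PP_mul (h2 : (2 : A) = 0) : ∀ m, PP A m * TT A = (C X) ^ m + X ^ m + 1 + (ww A) ^ m := by
  have h2' : (2 : A[X][X]) = 0 := by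
    have := congrArg (algebraMap A A[X][X]) h2
    rwa [map_ofNat, map_zero] at this
  intro m
  induction m using Nat.strong_induction_on with
  | _ m ih =>
  match m, ih with
  | 0, _ => simp only [PP, pow_zero, zero_mul]; linear_combination (-2) * h2'
  | 1, _ => simp only [PP, pow_one, zero_mul, ww]; linear_combination (-(C X) - X - 1) * h2'
  | 2, _ =>
    simp only [PP, zero_mul, ww]
    linear_combination (-((C X) ^ 2 + X ^ 2 + 1 + C X * X + C X + X)) * h2'
  | 3, _ =>
    simp only [PP, TT, one_mul, ww]
    linear_combination (-((C X) ^ 3 + X ^ 3 + 1 + ((C X) ^ 2 * X + C X * X ^ 2 + (C X) ^ 2 + C X + X ^ 2 + X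
      + 2 * (C X) * X))) * h2'
  | (m + 4), ih =>
    have a0 := ih m (by omega)
    have a1 := ih (m + 1) (by omega)
    have a2 := ih (m + 2) (by omega)
    rw [PP]
    have key : ∀ z : A[X][X], (z - C X) * (z - X) * (z - 1) * (z - ww A) = 0 →
        z ^ (m + 4) = E2 A * z ^ (m + 2) + E3 A * z ^ (m + 1) + E4 A * z ^ m := by
      intro z hz
      have : z ^ 4 = E2 A * z ^ 2 + E3 A * z + E4 A := by
        simp only [E2, E3, E4]
        rw [ww] at hz ⊢
        linear_combination hz + ((C X + X + 1) * z ^ 3 -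
          (C X * X + C X + C X * (C X + X + 1) + X + X * (C X + X + 1) + (C X + X + 1)) * z ^ 2
          - C X * X * (C X + X + 1)) * h2'
      linear_combination z ^ m * this
    have k1 := key (C X) (by ring)
    have k2 := key X (by ring)
    have k3 := key 1 (by ring)
    have k4 := key (ww A) (by ring)
    rw [k1, k2, k4]
    simp only [one_pow, mul_one] at k3
    linear_combination E2 A * a2 + E3 A * a1 + E4 A * a0 - k3

end
section
variable {k : Type*} [Field k]

lemma Wt_ww : ww k ∈ Wt k 1 1 := by
  unfold ww
  exact (Wt k 1 1).add_mem ((Wt k 1 1).add_mem Wt_CX Wt_X) Wt_one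

lemma PP_Wt : ∀ m, PP k m ∈ Wt k 1 (m - 3)
  | 0 => (Wt k 1 _).zero_mem
  | 1 => (Wt k 1 _).zero_mem
  | 2 => (Wt k 1 _).zero_mem
  | 3 => Wt_one
  | (m + 4) => by
    have hx : (C X : k[X][X]) ∈ Wt k 1 1 := Wt_CX
    have hy : (X : k[X][X]) ∈ Wt k 1 1 := Wt_X
    have hE2 : E2 k ∈ Wt k 1 2 := by
      unfold E2
      refine (Wt k 1 2).add_mem ((Wt k 1 2).add_mem ((Wt k 1 2).add_mem ((Wt k 1 2).add_mem
        ((Wt k 1 2).add_mem ?_ ?_) ?_) ?_) ?_) ?_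
      · exact Wt_mul hx hy
      · exact Wt_mono (by norm_num) hx
      · exact Wt_mul hx Wt_ww
      · exact Wt_mono (by norm_num) hy
      · exact Wt_mul hy Wt_ww
      · exact Wt_mono (by norm_num) Wt_ww
    have hE3 : E3 k ∈ Wt k 1 3 := by
      unfold E3
      refine (Wt k 1 3).add_mem ((Wt k 1 3).add_mem ((Wt k 1 3).add_mem ?_ ?_) ?_) ?_
      · exact Wt_mono (by norm_num) (Wt_mul hx hy)
      · exact Wt_mul (Wt_mul hx hy) Wt_ww
      · exact Wt_mono (by norm_num) (Wt_mul hx Wt_ww)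
      · exact Wt_mono (by norm_num) (Wt_mul hy Wt_ww)
    have hE4 : E4 k ∈ Wt k 1 3 := Wt_mul (Wt_mul hx hy) Wt_ww
    have i2 := PP_Wt (m + 2)
    have i1 := PP_Wt (m + 1)
    have i0 := PP_Wt m
    rw [PP]
    refine (Wt k 1 _).add_mem ((Wt k 1 _).add_mem ?_ ?_) ?_
    · rcases Nat.eq_zero_or_pos m with rfl | hm
      · simp [PP]
      · exact Wt_mono (by omega) (Wt_mul hE2 i2)
    · rcases Nat.lt_or_ge m 2 with hm | hm
      · interval_cases m <;> simp [PP]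
      · exact Wt_mono (by omega) (Wt_mul hE3 i1)
    · rcases Nat.lt_or_ge m 3 with hm | hm
      · interval_cases m <;> simp [PP]
      · exact Wt_mono (by omega) (Wt_mul hE4 i0)

lemma TT_Wt : TT k ∈ Wt k 1 3 := by
  have hx : (C X : k[X][X]) ∈ Wt k 1 1 := Wt_CX
  have hy : (X : k[X][X]) ∈ Wt k 1 1 := Wt_X
  unfold TT
  exact Wt_mul (Wt_mul ((Wt k 1 1).add_mem hx hy) ((Wt k 1 1).add_mem hx Wt_one))
    ((Wt k 1 1).add_mem hy Wt_one)

end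
end ExcAPN

namespace ExcAPN
open Polynomial
section
variable {k : Type*} [Field k]

lemma natDegree_le_of_Wt {κ e : ℕ} {p : k[X][X]} (hκ : 1 ≤ κ) (hp : p ∈ Wt k κ e) : p.natDegree ≤ e := by
  by_cases h0 : p = 0
  · simp [h0]
  · have := Wt_lead hp h0
    nlinarith

lemma monic_of_Wt {e : ℕ} {p : k[X][X]} (hp : p ∈ Wt k 1 e) (h0 : (p.coeff e).coeff 0 = 1) :
    p.Monic ∧ p.natDegree = e := by
  have h1 : p.coeff e = 1 := by
    ext i
    rcases Nat.eq_zero_or_pos i with rfl | hi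
    · simp [h0]
    · have : (p.coeff e).coeff i = 0 := by
        by_contra hne
        have := hp _ _ hne
        omega
      rw [this, coeff_one, if_neg (by omega)]
  have hle := natDegree_le_of_Wt (le_refl 1) hp
  have hd : p.natDegree = e := le_antisymm hle (le_natDegree_of_ne_zero (by rw [h1]; exact one_ne_zero))
  exact ⟨by rw [Monic, leadingCoeff, hd, h1], hd⟩

lemma PP_lead [CharP k 2] {m : ℕ} (hm : Odd m) (h3 : 3 ≤ m) : ((PP k m).coeff (m - 3)).coeff 0 = 1 := by
  have h2 : (2 : k) = 0 := CharTwo.two_eq_zero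
  have hid := congrArg (Polynomial.map (evalRingHom (0 : k))) (PP_mul h2 m)
  have hc : ∀ j, ((PP k m).map (evalRingHom 0)).coeff j = ((PP k m).coeff j).coeff 0 := by
    intro j; rw [coeff_map, coe_evalRingHom, coeff_zero_eq_eval_zero]
  rw [← hc]
  set p := (PP k m).map (evalRingHom 0) with hp
  simp only [Polynomial.map_mul, TT, ww, Polynomial.map_add, Polynomial.map_pow, map_C, map_X,
    Polynomial.map_one, coe_evalRingHom, eval_X, ← hp, C_0, zero_add, mul_one] at hid
  have hz : p.coeff (m - 2) = 0 := by
    rw [hc]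
    by_contra hne
    have := PP_Wt (k := k) m _ _ hne
    omega
  have h4 := congrArg (fun q => coeff q (m - 1)) hid
  obtain ⟨t, rfl⟩ : ∃ t, m = t + 3 := ⟨m - 3, by omega⟩
  have e1 : (p * (X * (X + 1))) = p * X ^ 2 + p * X := by ring
  simp only [e1, coeff_add] at h4
  rw [show t + 3 - 1 = t + 2 by omega, coeff_mul_X_pow, show t + 2 = t + 1 + 1 by omega, coeff_mul_X] at h4
  rw [show t + 3 - 2 = t + 1 by omega] at hz
  rw [hz, coeff_X_pow, if_neg (by omega), coeff_one, if_neg (by omega), coeff_X_add_one_pow] at h4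
  have : (t + 3).choose (t + 1 + 1) = t + 3 := by
    rw [show t + 3 = t + 2 + 1 by omega, Nat.choose_succ_self_right]
  rw [this] at h4
  have h5 : ((t + 3 : ℕ) : k) = 1 := by
    obtain ⟨s, hs⟩ := hm
    rw [hs]; push_cast; rw [h2]; simp
  rw [h5] at h4
  have e0 : (0 : k[X]) ^ (t + 3) = 0 := by simp
  rw [e0, coeff_zero] at h4
  simpa using h4

lemma GG_lead [CharP k 2] {d : ℕ} (hd : Odd d) (h3 : 3 ≤ d) (c : ℕ → k) (hc : c d = 1) (μ : k) :
    GG k c d μ ∈ Wt k 1 (d - 3) ∧ (GG k c d μ).Monic ∧ (GG k c d μ).natDegree = d - 3 := by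
  have h1 : GG k c d μ ∈ Wt k 1 (d - 3) := by
    apply Submodule.sum_mem
    intro j hj
    rw [Finset.mem_range] at hj
    have := Wt_mul (Wt_CC (κ := 1) (e := 0) (c j * μ ^ (d - j))) (PP_Wt j)
    exact Wt_mono (by omega) this
  refine ⟨h1, monic_of_Wt h1 ?_⟩
  rw [GG, finsetSum_coeff, finsetSum_coeff, Finset.sum_eq_single d]
  · rw [hc]; simp [PP_lead hd h3]
  · intro j hj hjd
    rw [Finset.mem_range] at hj
    rw [coeff_C_mul, coeff_C_mul]
    have : ((PP k j).coeff (d - 3)).coeff 0 = 0 := by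
      by_contra hne
      have hW := PP_Wt j _ _ hne
      have : d - 3 = 0 := by omega
      have hj3 : j < 3 := by omega
      apply hne
      interval_cases j <;> simp [PP]
    rw [this, mul_zero]
  · intro h; simp at h

/-- the rescaled univariate polynomial -/
def FF (c : ℕ → k) (d : ℕ) (μ z : k) : k := ∑ j ∈ Finset.range (d + 1), c j * μ ^ (d - j) * z ^ j

lemma GG_eval [CharP k 2] (c : ℕ → k) (d : ℕ) (μ x y : k) :
    (GG k c d μ).evalEval x y * ((x + y) * (x + 1) * (y + 1)) =
      FF c d μ x + FF c d μ y + FF c d μ 1 + FF c d μ (x + y + 1) := by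
  have h2 : (2 : k) = 0 := CharTwo.two_eq_zero
  simp only [GG, FF, evalEval_finsetSum, Finset.sum_mul]
  rw [← Finset.sum_add_distrib, ← Finset.sum_add_distrib, ← Finset.sum_add_distrib]
  apply Finset.sum_congr rfl
  intro j _
  have := congrArg (evalEval x y) (PP_mul h2 j)
  simp only [TT, ww, evalEval_mul, evalEval_add, evalEval_C, evalEval_X, evalEval_pow, eval_X,
    evalEval_one] at this
  rw [evalEval_mul, evalEval_C, eval_C, mul_assoc, this]
  ring

lemma FF_scale (f : k[X]) (hf : f ≠ 0) (μ z : k) (hμ : μ ≠ 0) :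
    FF (fun j => f.coeff j / f.leadingCoeff) f.natDegree μ z =
      μ ^ f.natDegree / f.leadingCoeff * f.eval (z / μ) := by
  have hl : f.leadingCoeff ≠ 0 := leadingCoeff_ne_zero.2 hf
  rw [FF, eval_eq_sum_range, Finset.mul_sum]
  apply Finset.sum_congr rfl
  intro j hj
  rw [Finset.mem_range] at hj
  have : μ ^ f.natDegree = μ ^ (f.natDegree - j) * μ ^ j := by rw [← pow_add]; congr 1; omega
  rw [this, div_pow]
  field_simp

/-- the APN condition transported to the Frobenius-fixed elements. -/
def APNat (f : k[X]) (e : ℕ) : Prop := ∀ x y z : k, x ^ (2 ^ e) = x → y ^ (2 ^ e) = y → z ^ (2 ^ e) = z →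
  x ≠ y → x ≠ z → y ≠ z → f.eval x + f.eval y + f.eval z + f.eval (x + y + z) ≠ 0

lemma apn_points [CharP k 2] (f : k[X]) (hf : f ≠ 0) (e : ℕ) (h : APNat f e) (μ x y : k) (hμ : μ ≠ 0)
    (hμe : μ ^ (2 ^ e) = μ) (hx : x ^ (2 ^ e) = x) (hy : y ^ (2 ^ e) = y)
    (h0 : (GG k (fun j => f.coeff j / f.leadingCoeff) f.natDegree μ).evalEval x y = 0) :
    x = y ∨ x = 1 ∨ y = 1 := by
  by_contra! hne
  obtain ⟨n1, n2, n3⟩ := hne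
  have hl : f.leadingCoeff ≠ 0 := leadingCoeff_ne_zero.2 hf
  have := GG_eval (fun j => f.coeff j / f.leadingCoeff) f.natDegree μ x y
  rw [h0, zero_mul] at this
  simp only [FF_scale f hf μ _ hμ] at this
  rw [← mul_add, ← mul_add, ← mul_add] at this
  have h5 := this.symm
  rw [mul_eq_zero] at h5
  rcases h5 with h5 | h5
  · exact (div_ne_zero (pow_ne_zero _ hμ) hl) h5
  · refine h (x / μ) (y / μ) (1 / μ) ?_ ?_ ?_ ?_ ?_ ?_ ?_
    · rw [div_pow, hx, hμe]
    · rw [div_pow, hy, hμe]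
    · rw [div_pow, one_pow, hμe]
    · intro h; exact n1 ((div_left_inj' hμ).1 h)
    · intro h; exact n2 ((div_left_inj' hμ).1 h)
    · intro h; exact n3 ((div_left_inj' hμ).1 h)
    · rw [← add_div, ← add_div]; exact h5

end
end ExcAPN

namespace ExcAPN
open Polynomial
section
variable {k : Type*} [Field k] {R : Type*} [CommRing R] [Algebra k R]

/-- evaluation of a bivariate polynomial in a `k`-algebra. -/
noncomputable def ev (a b : R) : k[X][X] →ₐ[k] R :=
  { eval₂RingHom (aeval a : k[X] →ₐ[k] R).toRingHom b with
    commutes' := by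
      intro r
      simp [Polynomial.algebraMap_apply] }

lemma ev_C (a b : R) (p : k[X]) : ev a b (C p : k[X][X]) = aeval a p := by
  simp [ev]

@[simp] lemma ev_CX (a b : R) : ev a b (C X : k[X][X]) = a := by
  simp [ev]

@[simp] lemma ev_X (a b : R) : ev a b (X : k[X][X]) = b := by
  simp [ev]

@[simp] lemma ev_CC (a b : R) (c : k) : ev a b (C (C c) : k[X][X]) = algebraMap k R c := by
  simp [ev]

lemma ev_ext {f g : k[X][X] →ₐ[k] R} (h1 : f (C X) = g (C X)) (h2 : f X = g X) : f = g := by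
  have : (f : k[X][X] →+* R) = g := by
    apply Polynomial.ringHom_ext'
    · apply Polynomial.ringHom_ext'
      · ext c
        have e1 := f.commutes c
        have e2 := g.commutes c
        rw [← e2] at e1
        exact e1
      · exact h1
    · exact h2
  exact AlgHom.ext fun p => congrArg (fun φ : k[X][X] →+* R => φ p) this

lemma ev_eq (a b : R) (p : k[X][X]) : ev a b p = ∑ j ∈ Finset.range (p.natDegree + 1),
    aeval a (p.coeff j) * b ^ j := by
  simp only [ev]
  change eval₂ _ b p = _
  rw [eval₂_eq_sum_range]; rfl

lemma ev_evalEval (x y : k) (p : k[X][X]) : ev x y p = p.evalEval x y := by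
  rw [ev_eq, evalEval_eq_sum]; simp [coe_aeval_eq_eval]

/-- weighted homogenization `x ↦ τ^w1`, `y ↦ τ^w2 Y`. -/
noncomputable def th (w1 w2 : ℕ) : k[X][X] →ₐ[k] k[X][X] := ev (X ^ w1) (C X * X ^ w2)

lemma th_coeff (w1 w2 : ℕ) (hw : 0 < w1) (p : k[X][X]) (r j : ℕ) :
    ((th w1 w2 p).coeff r).coeff j =
      if w2 * j ≤ r ∧ w1 ∣ r - w2 * j then (p.coeff j).coeff ((r - w2 * j) / w1) else 0 := by
  induction p using Polynomial.induction_on' with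
  | add p q hp hq => rw [map_add, coeff_add, coeff_add, hp, hq]; split_ifs <;> simp
  | monomial j0 a =>
    induction a using Polynomial.induction_on' with
    | add p q hp hq => rw [map_add, map_add, coeff_add, coeff_add, hp, hq]; split_ifs <;> simp
    | monomial i0 c =>
      have : th w1 w2 (monomial j0 (monomial i0 c)) = C (C c * X ^ j0) * X ^ (w1 * i0 + w2 * j0) := by
        have e1 : (monomial j0 (monomial i0 c) : k[X][X]) = C (C c) * (C X) ^ i0 * X ^ j0 := by
          rw [← C_mul_X_pow_eq_monomial, ← C_mul_X_pow_eq_monomial, C_mul, C_pow]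
        rw [e1, th, map_mul, map_mul, map_pow, map_pow, ev_CX, ev_X, ev_CC,
          show (algebraMap k k[X][X]) c = C (C c) from rfl]
        rw [C_mul, C_pow, mul_pow, ← pow_mul, ← pow_mul, pow_add]; ring
      rw [this, coeff_C_mul_X_pow]
      rw [coeff_monomial]
      by_cases hj : j0 = j
      · subst hj
        rw [if_pos rfl, coeff_monomial]
        by_cases hr : r = w1 * i0 + w2 * j0
        · subst hr
          rw [if_pos rfl, if_pos ⟨by omega, by simp⟩]
          rw [coeff_C_mul, coeff_X_pow, if_pos rfl, mul_one, if_pos]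
          rw [Nat.add_sub_cancel, Nat.mul_div_cancel_left _ hw]
        · rw [if_neg hr, coeff_zero]
          split_ifs with h1 h2
          · exfalso; apply hr
            rw [h2, Nat.mul_div_cancel' h1.2]; omega
          · rfl
          · rfl
      · rw [if_neg hj, coeff_zero]
        have hj' : j ≠ j0 := Ne.symm hj
        split_ifs <;> simp [coeff_X_pow, hj']

lemma th_coeff_ij (w1 w2 : ℕ) (hw : 0 < w1) (p : k[X][X]) (i j : ℕ) :
    ((th w1 w2 p).coeff (w1 * i + w2 * j)).coeff j = (p.coeff j).coeff i := by
  rw [th_coeff w1 w2 hw, if_pos ⟨by omega, by simp⟩, Nat.add_sub_cancel, Nat.mul_div_cancel_left _ hw]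

lemma th_coeff_ne {w1 w2 : ℕ} (hw : 0 < w1) {p : k[X][X]} {r j : ℕ}
    (h : ((th w1 w2 p).coeff r).coeff j ≠ 0) : ∃ i, r = w1 * i + w2 * j ∧ (p.coeff j).coeff i ≠ 0 := by
  rw [th_coeff w1 w2 hw] at h
  split_ifs at h with h1
  · refine ⟨(r - w2 * j) / w1, ?_, h⟩
    rw [Nat.mul_div_cancel' h1.2]; omega
  · exact absurd rfl h

lemma th_injective (w1 w2 : ℕ) (hw : 0 < w1) : Function.Injective (th (k := k) w1 w2) := by
  intro p q hpq
  ext j i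
  rw [← th_coeff_ij w1 w2 hw, hpq, th_coeff_ij w1 w2 hw]

lemma th_one_Wt {p : k[X][X]} {e : ℕ} : (th 1 1 p).natDegree ≤ e ↔ p ∈ Wt k 1 e := by
  rw [natDegree_le_iff_coeff_eq_zero]
  constructor
  · intro h i j hij
    by_contra hlt
    apply hij
    rw [← th_coeff_ij 1 1 one_pos, h _ (by omega), coeff_zero]
  · intro h r hr
    ext j
    by_contra hne
    obtain ⟨i, h1, h2⟩ := th_coeff_ne one_pos hne
    have := h _ _ h2
    omega

/-- monic factors of polynomials of the right shape have the right shape. -/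
lemma factor_Wt {U V : k[X][X]} (hU : U.Monic) (hV : V.Monic)
    (hW : U * V ∈ Wt k 1 (U.natDegree + V.natDegree)) :
    U ∈ Wt k 1 U.natDegree ∧ V ∈ Wt k 1 V.natDegree := by
  have hinj := th_injective (k := k) 1 1 one_pos
  have hU0 : th 1 1 U ≠ 0 := fun h => hU.ne_zero (hinj (by rw [h, map_zero]))
  have hV0 : th 1 1 V ≠ 0 := fun h => hV.ne_zero (hinj (by rw [h, map_zero]))
  have h1 := th_one_Wt.2 hW
  rw [map_mul, natDegree_mul hU0 hV0] at h1
  have h2 := Wt_lead (th_one_Wt.1 (le_refl (th 1 1 U).natDegree)) hU.ne_zero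
  have h3 := Wt_lead (th_one_Wt.1 (le_refl (th 1 1 V).natDegree)) hV.ne_zero
  exact ⟨th_one_Wt.1 (by omega), th_one_Wt.1 (by omega)⟩

end
end ExcAPN

namespace ExcAPN
open Polynomial
section
variable {k : Type*} [Field k]

/-- normalize a divisor of a monic bivariate polynomial. -/
lemma monic_factor {G p : k[X][X]} (hG : G.Monic) (hp : p ∣ G) :
    ∃ h : k[X][X], h.Monic ∧ Associated p h := by
  obtain ⟨q, rfl⟩ := hp
  have h1 : p.leadingCoeff * q.leadingCoeff = 1 := by
    rw [← leadingCoeff_mul]; exact hG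
  refine ⟨p * C q.leadingCoeff, ?_, ?_⟩
  · rw [Monic, leadingCoeff_mul, leadingCoeff_C, h1]
  · have hu : IsUnit (C q.leadingCoeff) := by
      apply IsUnit.map
      exact IsUnit.of_mul_eq_one _ (by rw [mul_comm]; exact h1)
    exact ⟨hu.unit, rfl⟩

lemma exists_monic_irr {G : k[X][X]} (hG : G.Monic) (h1 : 1 ≤ G.natDegree) :
    ∃ p q : k[X][X], p.Monic ∧ q.Monic ∧ Irreducible p ∧ G = p * q ∧ 1 ≤ p.natDegree ∧
      p.natDegree + q.natDegree = G.natDegree := by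
  obtain ⟨p0, hp0, hd⟩ := WfDvdMonoid.exists_irreducible_factor (a := G) (by
    intro hu
    have := hG.eq_one_of_isUnit hu
    rw [this] at h1; simp at h1) hG.ne_zero
  obtain ⟨p, hp, ha⟩ := monic_factor hG hd
  have hirr := ha.irreducible hp0
  obtain ⟨q, hq⟩ := ha.dvd_iff_dvd_left.1 hd
  have hqm : q.Monic := hp.of_mul_monic_left (by rw [← hq]; exact hG)
  refine ⟨p, q, hp, hqm, hirr, hq, ?_, ?_⟩
  · by_contra hc
    have : p = 1 := eq_one_of_monic_natDegree_zero hp (by omega)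
    rw [this] at hirr
    exact not_irreducible_one hirr
  · rw [hq, hp.natDegree_mul hqm]

lemma factor_split {G : k[X][X]} (hG : G.Monic)
    (hirr : ∀ p q : k[X][X], p.Monic → q.Monic → Irreducible p → G = p * q → 2 * p.natDegree ≤ G.natDegree) :
    ∃ U V : k[X][X], U.Monic ∧ V.Monic ∧ G = U * V ∧ 2 * U.natDegree ≤ G.natDegree ∧
      G.natDegree ≤ 3 * U.natDegree := by
  classical
  let Pr : ℕ → Prop := fun a => ∃ U V : k[X][X], U.Monic ∧ V.Monic ∧ G = U * V ∧ U.natDegree = a ∧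
    2 * a ≤ G.natDegree
  have h0 : Pr 0 := ⟨1, G, monic_one, hG, by simp, by simp, by simp⟩
  have hspec := Nat.findGreatest_spec (P := Pr) (Nat.zero_le G.natDegree) h0
  have hmax : ∀ a, Pr a → a ≤ Nat.findGreatest Pr G.natDegree := by
    intro a ha
    have h2 : a ≤ G.natDegree := by obtain ⟨_, _, _, _, _, _, h⟩ := ha; omega
    exact Nat.le_findGreatest h2 ha
  set a := Nat.findGreatest Pr G.natDegree
  obtain ⟨U, V, hU, hV, hUV, hUa, ha⟩ := hspec
  refine ⟨U, V, hU, hV, hUV, by omega, ?_⟩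
  by_contra hc
  push Not at hc
  have hdeg : U.natDegree + V.natDegree = G.natDegree := by rw [hUV, hU.natDegree_mul hV]
  obtain ⟨p, q, hp, hq, hpi, hV2, hp1, hpq⟩ := exists_monic_irr hV (by omega)
  have h2 := hirr p (U * q) hp (hU.mul hq) hpi (by rw [hUV, hV2]; ring)
  have h3 := hmax p.natDegree ⟨p, U * q, hp, hU.mul hq, by rw [hUV, hV2]; ring, rfl, h2⟩
  by_cases h4 : 2 * (U.natDegree + p.natDegree) ≤ G.natDegree
  · have := hmax (U.natDegree + p.natDegree) ⟨U * p, q, hU.mul hp, hq, by rw [hUV, hV2]; ring,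
      hU.natDegree_mul hp, h4⟩
    omega
  · have := hmax q.natDegree ⟨q, U * p, hq, hU.mul hp, by rw [hUV, hV2]; ring, rfl, by omega⟩
    omega

/-- Frobenius twist of a bivariate polynomial -/
noncomputable def frobMap (k : Type*) [Field k] [CharP k 2] (e : ℕ) : k[X][X] →+* k[X][X] :=
  mapRingHom (mapRingHom (iterateFrobenius k 2 e))

lemma frobMap_fix [CharP k 2] {e : ℕ} {p : k[X][X]} :
    frobMap k e p = p ↔ ∀ i j, ((p.coeff j).coeff i) ^ (2 ^ e) = (p.coeff j).coeff i := by
  constructor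
  · intro h i j
    conv_rhs => rw [← h]
    simp [frobMap, iterateFrobenius_def]
  · intro h
    ext j i
    rw [← h i j]
    simp [frobMap, iterateFrobenius_def]

lemma big_factor_fix [IsAlgClosed k] [CharP k 2] {e : ℕ} {G p q : k[X][X]} (hG : frobMap k e G = G)
    (hGm : G.Monic)
    (hp : p.Monic) (hq : q.Monic) (hirr : Irreducible p) (hpq : G = p * q) (hbig : G.natDegree < 2 * p.natDegree) :
    frobMap k e p = p := by
  have hsur : Function.Bijective (iterateFrobenius k 2 e) := by
    have := IsAlgClosed.perfectRing k 2
    exact bijective_iterateFrobenius k 2 e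
  let φ : k ≃+* k := RingEquiv.ofBijective _ hsur
  let Φ : k[X][X] ≃+* k[X][X] := mapEquiv (mapEquiv φ)
  have hΦ : ∀ r, Φ r = frobMap k e r := by
    intro r; ext j i; simp [Φ, frobMap, φ]
  have hpm : (frobMap k e p).Monic := hp.map _
  have hpd : (frobMap k e p).natDegree = p.natDegree := hp.natDegree_map _
  have hirr2 : Irreducible (frobMap k e p) := by
    rw [← hΦ]; exact (MulEquiv.irreducible_iff Φ.toMulEquiv).2 hirr
  by_contra hne
  have hdv : frobMap k e p ∣ p * q := by
    rw [← hpq, ← hG, hpq, map_mul]; exact Dvd.intro _ rfl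
  rcases hirr2.prime.dvd_or_dvd hdv with h | h
  · have := (hirr2.associated_of_dvd hirr h)
    exact hne (eq_of_monic_of_associated hpm hp this)
  · have := natDegree_le_of_dvd h hq.ne_zero
    have h3 : G.natDegree = p.natDegree + q.natDegree := by rw [hpq, hp.natDegree_mul hq]
    omega

lemma natDegree_eval_le {e : ℕ} {h : k[X][X]} (hw : h ∈ Wt k 1 e) (r : k[X]) (hr : r.natDegree ≤ 1) :
    (h.eval r).natDegree ≤ e := by
  rw [eval_eq_sum_range]
  apply natDegree_sum_le_of_forall_le
  intro j _
  by_cases h0 : h.coeff j = 0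
  · simp [h0]
  · have h1 := hw (h.coeff j).natDegree j (by
      change (h.coeff j).leadingCoeff ≠ 0
      simpa using h0)
    refine natDegree_mul_le.trans ?_
    have := natDegree_pow_le (p := r) (n := j)
    nlinarith

lemma line_ne {h : k[X][X]} (hirr : Irreducible h) (hd : 2 ≤ h.natDegree) (r : k[X]) : h.eval r ≠ 0 := by
  intro h0
  have hdv : (X - C r) ∣ h := dvd_iff_isRoot.2 h0
  have := (irreducible_X_sub_C r).associated_of_dvd hirr hdv
  have := natDegree_eq_of_degree_eq (degree_eq_degree_of_associated this)
  rw [natDegree_X_sub_C] at this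
  omega

lemma line_count {h : k[X][X]} (hm : h.Monic) (hw : h ∈ Wt k 1 h.natDegree) (hirr : Irreducible h)
    (hd : 2 ≤ h.natDegree)
    (S : Finset (k × k)) (hS : ∀ s ∈ S, h.evalEval s.1 s.2 = 0 ∧ (s.1 = s.2 ∨ s.1 = 1 ∨ s.2 = 1)) :
    S.card ≤ 3 * h.natDegree := by
  classical
  have hsub : S ⊆ ((h.eval X).roots.toFinset.image (fun x => (x, x))) ∪
      (((h.map (evalRingHom 1)).roots.toFinset.image (fun y => (1, y))) ∪
      ((h.eval 1).roots.toFinset.image (fun x => (x, 1)))) := by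
    rintro ⟨x, y⟩ hs
    obtain ⟨h0, h1⟩ := hS _ hs
    simp only [Finset.mem_union, Finset.mem_image, Multiset.mem_toFinset, Prod.mk.injEq]
    dsimp only at h0 h1
    rcases h1 with h1 | h1 | h1
    · subst h1; left
      refine ⟨x, ?_, rfl, rfl⟩
      rw [mem_roots (line_ne hirr hd _), IsRoot, ← h0, ← coe_evalRingHom, eval,
        hom_eval₂, evalEval_eq_eval_map, eval_map]; simp
    · subst h1; right; left
      refine ⟨y, ?_, rfl, rfl⟩
      rw [mem_roots (hm.map _).ne_zero, IsRoot, ← h0, evalEval_eq_eval_map]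
    · subst h1; right; right
      refine ⟨x, ?_, rfl, rfl⟩
      rw [mem_roots (line_ne hirr hd _), IsRoot, ← h0, evalEval, C_1]
  have hcard : ∀ (p : k[X]) (φ : k → k × k), p.natDegree ≤ h.natDegree →
      (p.roots.toFinset.image φ).card ≤ h.natDegree := by
    intro p φ hp
    exact Finset.card_image_le.trans ((Multiset.toFinset_card_le _).trans ((card_roots' p).trans hp))
  have c1 := hcard (h.eval X) (fun x => (x, x)) (natDegree_eval_le hw _ (by simp))
  have c2 := hcard (h.map (evalRingHom 1)) (fun y => (1, y)) (natDegree_map_le)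
  have c3 := hcard (h.eval 1) (fun x => (x, 1)) (natDegree_eval_le hw _ (by simp))
  have := Finset.card_le_card hsub
  have u1 := Finset.card_union_le ((h.eval X).roots.toFinset.image (fun x => (x, x)))
      (((h.map (evalRingHom 1)).roots.toFinset.image (fun y => ((1 : k), y))) ∪
      ((h.eval 1).roots.toFinset.image (fun x => (x, (1 : k)))))
  have u2 := Finset.card_union_le ((h.map (evalRingHom 1)).roots.toFinset.image (fun y => ((1 : k), y)))
      ((h.eval 1).roots.toFinset.image (fun x => (x, (1 : k))))
  omega

/-- For large `e`, the APN condition forces balanced factorizations. -/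
theorem apn_split [IsAlgClosed k] [CharP k 2] (f : k[X]) (hodd : Odd f.natDegree) (h5 : 6 ≤ f.natDegree) :
    ∃ e0, ∀ e ≥ e0, APNat f e → (∀ j, (f.coeff j) ^ (2 ^ e) = f.coeff j) →
      ∀ μ : k, μ ≠ 0 → μ ^ (2 ^ e) = μ →
      ∃ U V : k[X][X], U.Monic ∧ V.Monic ∧
        GG k (fun j => f.coeff j / f.leadingCoeff) f.natDegree μ = U * V ∧
        2 * U.natDegree ≤ f.natDegree - 3 ∧ f.natDegree - 3 ≤ 3 * U.natDegree := by
  classical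
  have hex : ∀ n, ∃ e0, 1 ≤ n → ∀ e ≥ e0, ∀ h : k[X][X], h.Monic → h.natDegree = n → h ∈ Wt k 1 n →
      Irreducible h → (∀ i j, ((h.coeff j).coeff i) ^ (2 ^ e) = (h.coeff j).coeff i) →
      ∃ S : Finset (k × k), 3 * n < S.card ∧ ∀ s ∈ S, h.evalEval s.1 s.2 = 0 ∧
        s.1 ^ (2 ^ e) = s.1 ∧ s.2 ^ (2 ^ e) = s.2 := by
    intro n
    by_cases h1 : 1 ≤ n
    · obtain ⟨e0, he0⟩ := stepanov (k := k) n (3 * n) h1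
      exact ⟨e0, fun _ => he0⟩
    · exact ⟨0, fun h2 => absurd h2 h1⟩
  choose E hE using hex
  refine ⟨(Finset.range (f.natDegree + 1)).sup E, ?_⟩
  intro e he hapn hfix μ hμ hμe
  have hf : f ≠ 0 := by rintro rfl; simp at h5
  set c : ℕ → k := fun j => f.coeff j / f.leadingCoeff with hc
  obtain ⟨hGW, hGm, hGd⟩ := GG_lead hodd (by omega) c (by
    simp only [hc]; exact div_self (leadingCoeff_ne_zero.2 hf)) μ
  set G := GG k c f.natDegree μ with hG
  rw [← hGd]
  apply factor_split hGm
  intro p q hp hq hirr hpq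
  by_contra hbig
  push Not at hbig
  have hGfix : frobMap k e G = G := by
    have h1 : frobMap k e G = GG k (fun j => iterateFrobenius k 2 e (c j)) f.natDegree
      (iterateFrobenius k 2 e μ) := GG_map _ _ _ _
    rw [h1, iterateFrobenius_def, hμe, hG]
    congr 1
    ext j
    rw [iterateFrobenius_def]
    simp only [hc]
    rw [div_pow, hfix, show f.leadingCoeff ^ (2 ^ e) = f.leadingCoeff from hfix _]
  have hpfix := frobMap_fix.1 (big_factor_fix hGfix hGm hp hq hirr hpq hbig)
  have hdeg : p.natDegree + q.natDegree = G.natDegree := by rw [hpq, hp.natDegree_mul hq]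
  have hpW := (factor_Wt hp hq (by rw [← hpq, hdeg, hGd]; exact hGW)).1
  obtain ⟨S, hS1, hS2⟩ := hE p.natDegree (by omega) e (le_trans (Finset.le_sup (f := E) (by
    rw [Finset.mem_range]; omega)) he) p hp rfl hpW hirr hpfix
  have := line_count hp hpW hirr (by omega) S (by
    intro s hs
    obtain ⟨h1, h2, h3⟩ := hS2 s hs
    refine ⟨h1, apn_points f hf e hapn μ s.1 s.2 hμ hμe h2 h3 ?_⟩
    rw [← hc, ← hG, hpq, evalEval_mul, h1, zero_mul])
  omega

end
end ExcAPN

namespace ExcAPN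
open Polynomial
section

/-- assemble a family of bivariate polynomials into one over the product ring -/
noncomputable def famPoly {k : Type*} [CommRing k] {Λ : Type*} (a : ℕ) (U : Λ → k[X][X]) : (Λ → k)[X][X] :=
  ∑ j ∈ Finset.range (a + 1), ∑ i ∈ Finset.range (a + 1),
    monomial j (monomial i (fun l => ((U l).coeff j).coeff i))

lemma famPoly_coeff {k : Type*} [CommRing k] {Λ : Type*} (a : ℕ) (U : Λ → k[X][X])
    (hU : ∀ l i j, ((U l).coeff j).coeff i ≠ 0 → i ≤ a ∧ j ≤ a) (i j : ℕ) (l : Λ) :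
    ((famPoly a U).coeff j).coeff i l = ((U l).coeff j).coeff i := by
  classical
  unfold famPoly
  simp only [finsetSum_coeff, coeff_monomial, Finset.sum_apply]
  by_cases h : ((U l).coeff j).coeff i = 0
  · rw [h]
    apply Finset.sum_eq_zero
    intro j' _
    apply Finset.sum_eq_zero
    intro i' _
    split_ifs with h1
    · rw [coeff_monomial]
      split_ifs with h2
      · subst h1 h2; exact h
      · rfl
    · simp
  · obtain ⟨h1, h2⟩ := hU l i j h
    rw [Finset.sum_eq_single j]
    · rw [Finset.sum_eq_single i]
      · simp
      · intro b _ hb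
        simp [coeff_monomial, hb]
      · intro h3; exact absurd (Finset.mem_range.2 (by omega)) h3
    · intro b _ hb
      simp [hb]
    · intro h3; exact absurd (Finset.mem_range.2 (by omega)) h3

lemma famPoly_map {k : Type*} [CommRing k] {Λ : Type*} (a : ℕ) (U : Λ → k[X][X])
    (hU : ∀ l i j, ((U l).coeff j).coeff i ≠ 0 → i ≤ a ∧ j ≤ a) (l : Λ) :
    (famPoly a U).map (mapRingHom (Pi.evalRingHom (fun _ => k) l)) = U l := by
  ext j i
  rw [coeff_map, coe_mapRingHom, coeff_map, Pi.evalRingHom_apply, famPoly_coeff a U hU]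

lemma pi_poly_ext {k : Type*} [CommRing k] {Λ : Type*} {p q : (Λ → k)[X][X]}
    (h : ∀ l, p.map (mapRingHom (Pi.evalRingHom (fun _ => k) l))
      = q.map (mapRingHom (Pi.evalRingHom (fun _ => k) l))) : p = q := by
  ext j i l
  have := congrArg (fun r => (r.coeff j).coeff i) (h l)
  simpa [coeff_map] using this

lemma famPoly_monic {k : Type*} [Field k] {Λ : Type*} (a : ℕ) (U : Λ → k[X][X])
    (hU : ∀ l, U l ∈ Wt k 1 a) (hm : ∀ l, (U l).Monic) (hd : ∀ l, (U l).natDegree = a) :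
    (famPoly a U).Monic := by
  have h0 : ∀ l i j, ((U l).coeff j).coeff i ≠ 0 → i ≤ a ∧ j ≤ a := by
    intro l i j h
    have := hU l i j h
    omega
  apply monic_of_natDegree_le_of_coeff_eq_one a
  · rw [natDegree_le_iff_coeff_eq_zero]
    intro j hj
    ext i l
    rw [famPoly_coeff a U h0]
    by_contra h
    have := h0 l i j (by simpa using h)
    omega
  · ext i l
    rw [famPoly_coeff a U h0]
    have : (U l).coeff a = 1 := by rw [← hd l]; exact hm l
    rw [this]
    simp only [coeff_one]
    split_ifs <;> rfl

universe u

/-- The ring `k[X]` acting on the product ring. -/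
theorem specialize {k : Type u} [Field k] [CharP k 2] {d : ℕ} (hd : Odd d) (h3 : 3 ≤ d) (c : ℕ → k)
    (hc : c d = 1) (Λ : Set k) (hΛ : Λ.Infinite) (a : ℕ)
    (h : ∀ μ ∈ Λ, ∃ U V : k[X][X], U.Monic ∧ V.Monic ∧ GG k c d μ = U * V ∧ U.natDegree = a) :
    ∃ (κ : Type u) (_ : Field κ) (_ : IsAlgClosed κ) (_ : CharP κ 2) (U V : κ[X][X]),
      U.Monic ∧ V.Monic ∧ PP κ d = U * V ∧ U.natDegree = a := by
  classical
  have h' : ∀ l : Λ, ∃ UV : k[X][X] × k[X][X], UV.1.Monic ∧ UV.2.Monic ∧ GG k c d l = UV.1 * UV.2 ∧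
      UV.1.natDegree = a := by
    rintro ⟨l, hl⟩
    obtain ⟨U, V, h⟩ := h l hl
    exact ⟨(U, V), h⟩
  choose UV hU hV hG hUd using h'
  have hVd : ∀ l, a + (UV l).2.natDegree = d - 3 := by
    intro l
    rw [← (GG_lead hd h3 c hc (l : k)).2.2, hG, (hU l).natDegree_mul (hV l), hUd]
  set b := d - 3 - a with hb
  have hVd' : ∀ l, (UV l).2.natDegree = b := fun l => by have := hVd l; omega
  have hW : ∀ l, (UV l).1 ∈ Wt k 1 a ∧ (UV l).2 ∈ Wt k 1 b := by
    intro l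
    have := factor_Wt (hU l) (hV l) (by
      rw [← hG, hUd, hVd]; exact (GG_lead hd h3 c hc (l : k)).1)
    rwa [hUd, hVd'] at this
  have bd : ∀ (e : ℕ) (W : Λ → k[X][X]), (∀ l, W l ∈ Wt k 1 e) →
      ∀ l i j, ((W l).coeff j).coeff i ≠ 0 → i ≤ e ∧ j ≤ e := by
    intro e W hW l i j h
    have := hW l i j h
    omega
  let R := Λ → k
  let ms : R := fun l => (l : k)
  let U : R[X][X] := famPoly a (fun l => (UV l).1)
  let V : R[X][X] := famPoly b (fun l => (UV l).2)
  have hUm : U.Monic := famPoly_monic a _ (fun l => (hW l).1) hU hUd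
  have hVm : V.Monic := famPoly_monic b _ (fun l => (hW l).2) hV hVd'
  letI : Algebra k[X] R := (aeval ms : k[X] →ₐ[k] R).toRingHom.toAlgebra
  have halg : ∀ p : k[X], algebraMap k[X] R p = (fun l : Λ => p.eval (l : k)) := by
    intro p
    ext l
    change (Pi.evalAlgHom k (fun _ : Λ => k) l) (aeval ms p) = _
    rw [← aeval_algHom_apply]
    change aeval (l : k) p = _
    rw [coe_aeval_eq_eval]
  have hinj : Function.Injective (algebraMap k[X] R) := by
    rw [injective_iff_map_eq_zero]
    intro p hp
    rw [halg] at hp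
    apply Polynomial.eq_zero_of_infinite_isRoot
    refine hΛ.mono ?_
    intro x hx
    exact congrFun hp ⟨x, hx⟩
  let G : k[X][X][X] := GG k[X] (fun j => C (c j)) d X
  letI : Algebra k[X][X] R[X] := (mapRingHom (algebraMap k[X] R)).toAlgebra
  have hGUV : G.map (mapRingHom (algebraMap k[X] R)) = U * V := by
    apply pi_poly_ext
    intro l
    rw [Polynomial.map_mul, famPoly_map _ _ (bd a _ (fun l => (hW l).1)),
      famPoly_map _ _ (bd b _ (fun l => (hW l).2)), ← hG, GG_map, GG_map]
    simp [halg]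
  have hGm : G.Monic := by
    have hi : Function.Injective (mapRingHom (algebraMap k[X] (FractionRing k[X]))) := by
      rw [coe_mapRingHom]
      exact map_injective _ (IsFractionRing.injective _ _)
    haveI : CharP (FractionRing k[X]) 2 := charP_of_injective_algebraMap
      (IsFractionRing.injective k[X] (FractionRing k[X])) 2
    apply monic_of_injective hi
    rw [GG_map]
    exact (GG_lead hd h3 _ (by simp [hc]) _).2.1
  have hGm2 : (G.map (mapRingHom (algebraMap k[X] R))).Monic := hGm.map _
  have hIntg : ∀ W : R[X][X], W.Monic → W ∣ U * V → ∀ i j, IsIntegral k[X] ((W.coeff j).coeff i) := by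
    intro W hW hdv i j
    have := isIntegral_coeff_of_dvd (R := k[X][X]) (S := R[X]) G W hGm hW (by
      rw [← hGUV] at hdv; exact hdv) j
    exact this.coeff i
  let R' := integralClosure k[X] R
  have hlift : ∀ W : R[X][X], W.Monic → W ∣ U * V → ∃ W' : R'[X][X], W'.Monic ∧
      W'.map (mapRingHom (algebraMap R' R)) = W := by
    intro W hW hdv
    have hl : W ∈ lifts (mapRingHom (algebraMap R' R)) := by
      rw [lifts_iff_coeff_lifts]
      intro j
      have : W.coeff j ∈ lifts (algebraMap R' R) := by
        rw [lifts_iff_coeff_lifts]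
        intro i
        exact ⟨⟨_, hIntg W hW hdv i j⟩, rfl⟩
      exact this
    obtain ⟨q, hq, _, hqm⟩ := lifts_and_natDegree_eq_and_monic hl hW
    exact ⟨q, hqm, hq⟩
  obtain ⟨U', hU'm, hU'⟩ := hlift U hUm (dvd_mul_right _ _)
  obtain ⟨V', hV'm, hV'⟩ := hlift V hVm ⟨U, mul_comm U V⟩
  have hinj' : Function.Injective (mapRingHom (mapRingHom (algebraMap R' R))) := by
    rw [coe_mapRingHom]
    apply map_injective
    rw [coe_mapRingHom]
    apply map_injective
    exact Subtype.val_injective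
  have hG' : G.map (mapRingHom (algebraMap k[X] R')) = U' * V' := by
    apply hinj'
    rw [map_mul, coe_mapRingHom, hU', hV', Polynomial.map_map, ← hGUV, mapRingHom_comp]
    rfl
  have hkx : (Ideal.span {(X : k[X])}).IsMaximal :=
    PrincipalIdealRing.isMaximal_of_irreducible irreducible_X
  obtain ⟨Q, hQm, hQ⟩ := Ideal.exists_ideal_over_maximal_of_isIntegral (R := k[X]) (S := R')
    (Ideal.span {(X : k[X])}) (by
      have : Function.Injective (algebraMap k[X] R') := by
        apply Function.Injective.of_comp (f := algebraMap R' R)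
        exact hinj
      rw [(RingHom.injective_iff_ker_eq_bot _).1 this]
      exact bot_le)
  letI : Field (R' ⧸ Q) := Ideal.Quotient.field Q
  let κ := AlgebraicClosure (R' ⧸ Q)
  let ψ : R' →+* κ := (algebraMap (R' ⧸ Q) κ).comp (Ideal.Quotient.mk Q)
  let χ : k[X] →+* κ := ψ.comp (algebraMap k[X] R')
  have hχX : χ X = 0 := by
    have : algebraMap k[X] R' X ∈ Q := by
      have : (X : k[X]) ∈ Q.comap (algebraMap k[X] R') := by
        rw [hQ]; exact Ideal.mem_span_singleton_self _
      exact this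
    change algebraMap (R' ⧸ Q) κ (Ideal.Quotient.mk Q _) = 0
    rw [Ideal.Quotient.eq_zero_iff_mem.2 this, map_zero]
  haveI : CharP κ 2 := charP_of_injective_ringHom (RingHom.injective (χ.comp (C : k →+* k[X]))) 2
  refine ⟨κ, inferInstance, inferInstance, inferInstance, U'.map (mapRingHom ψ), V'.map (mapRingHom ψ),
    hU'm.map _, hV'm.map _, ?_, ?_⟩
  · rw [← Polynomial.map_mul, ← hG', Polynomial.map_map, mapRingHom_comp, GG_map]
    change _ = GG κ (fun j => χ (C (c j))) d (χ X)
    rw [hχX, GG, Finset.sum_eq_single d]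
    · simp [hc]
    · intro j hj hjd
      have : d - j ≠ 0 := by rw [Finset.mem_range] at hj; omega
      simp [this]
    · intro h; exact absurd (Finset.mem_range.2 (by omega)) h
  · obtain ⟨l0, hl0⟩ := hΛ.nonempty
    rw [hU'm.natDegree_map, ← hUd ⟨l0, hl0⟩, ← famPoly_map a _ (bd a _ (fun l => (hW l).1)) ⟨l0, hl0⟩,
      hUm.natDegree_map]
    have : U'.natDegree = (U'.map (mapRingHom (algebraMap R' R))).natDegree :=
      by
        haveI : Nontrivial R := ⟨⟨0, 1, fun h => zero_ne_one (congrFun h ⟨l0, hl0⟩)⟩⟩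
        exact (hU'm.natDegree_map _).symm
    rw [this, hU']

end
end ExcAPN

namespace ExcAPN
open Polynomial
section
variable {k : Type*} [Field k]

section general
variable {A : Type*} [CommRing A] [Algebra k A]

variable (k) in
/-- the ideal has codimension at most `n` -/
def CoLE (I : Ideal A) (n : ℕ) : Prop :=
  ∃ s : Finset A, s.card ≤ n ∧ ∀ h, h ∈ I.restrictScalars k ⊔ Submodule.span k (s : Set A)

lemma CoLE.mono {I J : Ideal A} {n m : ℕ} (h : CoLE k I n) (hIJ : I ≤ J) (hnm : n ≤ m) : CoLE k J m := by
  obtain ⟨s, hs, h⟩ := h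
  refine ⟨s, hs.trans hnm, fun x => ?_⟩
  exact sup_le_sup_right (a := I.restrictScalars k) (b := J.restrictScalars k) (by exact hIJ) _ (h x)

lemma CoLE_top : CoLE k (⊤ : Ideal A) 0 := ⟨∅, by simp, fun h => Submodule.mem_sup_left (by simp)⟩

lemma CoLE_zero {I : Ideal A} (h : CoLE k I 0) : (1 : A) ∈ I := by
  obtain ⟨s, hs, h⟩ := h
  have : s = ∅ := by simpa using hs
  subst this
  simpa using h 1

/-- Chinese remainder type estimate. -/
lemma CoLE_crt {ι : Type*} (Z : Finset ι) (e : ι → A) (I : Ideal A) (J : ι → Ideal A) (n : ι → ℕ)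
    (h1 : 1 - ∑ P ∈ Z, e P ∈ I) (hJ : ∀ P ∈ Z, ∀ x ∈ J P, e P * x ∈ I)
    (hn : ∀ P ∈ Z, CoLE k (I ⊔ J P) (n P)) : CoLE k I (∑ P ∈ Z, n P) := by
  classical
  have hn' : ∀ P, ∃ s : Finset A, P ∈ Z → s.card ≤ n P ∧
      ∀ h, h ∈ (I ⊔ J P).restrictScalars k ⊔ Submodule.span k (s : Set A) := by
    intro P
    by_cases hP : P ∈ Z
    · obtain ⟨s, hs⟩ := hn P hP; exact ⟨s, fun _ => hs⟩
    · exact ⟨∅, fun h => absurd h hP⟩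
  choose s hs using hn'
  refine ⟨Z.biUnion fun P => (s P).image (fun v => e P * v), ?_, ?_⟩
  · refine Finset.card_biUnion_le.trans (Finset.sum_le_sum fun P hP => ?_)
    exact Finset.card_image_le.trans (hs P hP).1
  · intro h
    have e1 : h = (1 - ∑ P ∈ Z, e P) * h + ∑ P ∈ Z, e P * h := by
      rw [sub_mul, one_mul, Finset.sum_mul]; ring
    rw [e1]
    apply Submodule.add_mem
    · apply Submodule.mem_sup_left
      exact Ideal.mul_mem_right _ _ h1
    · apply Submodule.sum_mem
      intro P hP
      obtain ⟨x, hx, y, hy, hxy⟩ := Submodule.mem_sup.1 ((hs P hP).2 h)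
      rw [← hxy, mul_add]
      apply Submodule.add_mem
      · apply Submodule.mem_sup_left
        obtain ⟨x1, hx1, x2, hx2, hx12⟩ := Submodule.mem_sup.1 hx
        rw [← hx12, mul_add]
        change _ ∈ I
        exact I.add_mem (Ideal.mul_mem_left _ _ hx1) (hJ P hP _ hx2)
      · apply Submodule.mem_sup_right
        have : (LinearMap.mulLeft k (e P)) y ∈ Submodule.map (LinearMap.mulLeft k (e P))
            (Submodule.span k (s P : Set A)) := Submodule.mem_map_of_mem hy
        rw [Submodule.map_span] at this
        refine Submodule.span_mono ?_ this
        rintro _ ⟨v, hv, rfl⟩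
        simp only [Finset.coe_biUnion, Finset.coe_image, Set.mem_iUnion, LinearMap.mulLeft_apply]
        exact ⟨P, hP, v, hv, rfl⟩

lemma CoLE_finrank {I : Ideal A} {n : ℕ} (h : CoLE k I n) (M : Submodule k A) [Module.Finite k M] :
    Module.finrank k M ≤ n + Module.finrank k (M ⊓ I.restrictScalars k : Submodule k A) := by
  obtain ⟨s, hs, h⟩ := h
  let π : A →ₗ[k] (A ⧸ I.restrictScalars k) := (I.restrictScalars k).mkQ
  have htop : Submodule.span k ((fun x => π x) '' (s : Set A)) = ⊤ := by
    rw [eq_top_iff]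
    intro y _
    obtain ⟨x, rfl⟩ := Submodule.mkQ_surjective _ y
    obtain ⟨x1, hx1, x2, hx2, rfl⟩ := Submodule.mem_sup.1 (h x)
    have : π x1 = 0 := by
      rw [Submodule.mkQ_apply, Submodule.Quotient.mk_eq_zero]; exact hx1
    change π (x1 + x2) ∈ _
    rw [map_add, this, zero_add]
    have h3 : π x2 ∈ Submodule.map π (Submodule.span k (s : Set A)) := Submodule.mem_map_of_mem hx2
    rwa [Submodule.map_span] at h3
  classical
  rw [← Finset.coe_image] at htop
  haveI : Module.Finite k (A ⧸ I.restrictScalars k) := ⟨⟨_, htop⟩⟩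
  have hfr : Module.finrank k (A ⧸ I.restrictScalars k) ≤ n := by
    rw [← finrank_top, ← htop]
    exact (finrank_span_finset_le_card _).trans (Finset.card_image_le.trans hs)
  have h1 := LinearMap.finrank_range_add_finrank_ker (π.domRestrict M)
  have h2 := Submodule.finrank_le (LinearMap.range (π.domRestrict M))
  have h3 : Module.finrank k (LinearMap.ker (π.domRestrict M)) ≤
      Module.finrank k (M ⊓ I.restrictScalars k : Submodule k A) := by
    haveI : Module.Finite k (M ⊓ I.restrictScalars k : Submodule k A) :=
      Submodule.finiteDimensional_of_le (S₂ := M) inf_le_left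
    have e : (LinearMap.ker (π.domRestrict M)).map M.subtype ≤ M ⊓ I.restrictScalars k := by
      rintro _ ⟨x, hx, rfl⟩
      refine ⟨x.2, ?_⟩
      have hx' : π (x : A) = 0 := hx
      rwa [Submodule.mkQ_apply, Submodule.Quotient.mk_eq_zero] at hx'
    have := Submodule.finrank_mono e
    rwa [Submodule.finrank_map_subtype_eq] at this
  omega

end general

variable (k) in
/-- reduced polynomials of bounded degree -/
noncomputable def OM (a K : ℕ) : Submodule k k[X][X] :=
  Wt k 1 K ⊓ (degreeLT k[X] a).restrictScalars k

lemma mem_OM {a K : ℕ} {p : k[X][X]} : p ∈ OM k a K ↔ p ∈ Wt k 1 K ∧ p.degree < a := by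
  rw [OM, Submodule.mem_inf, Submodule.restrictScalars_mem, mem_degreeLT]

instance OM_finite (a K : ℕ) : Module.Finite k (OM k a K) := by
  apply Submodule.finiteDimensional_of_le (S₂ := LinearMap.range (redMap k a (K + 1)))
  intro p hp
  rw [mem_OM] at hp
  apply mem_range_redMap hp.2
  intro i j h
  have := hp.1 i j h
  omega

lemma OM_succ (a K : ℕ) (hK : a ≤ K) :
    Module.finrank k (OM k a K) + a ≤ Module.finrank k (OM k a (K + 1)) := by
  let φ : k[X][X] →ₗ[k] (Fin a → k) :=
    LinearMap.pi fun j => (lcoeff k (K + 1 - j)).comp ((lcoeff k[X] (j : ℕ)).restrictScalars k)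
  have hφ : ∀ p j, φ p j = (p.coeff j).coeff (K + 1 - j) := fun p j => rfl
  have h1 := LinearMap.finrank_range_add_finrank_ker (K := k) (V := OM k a (K + 1)) (V₂ := Fin a → k)
    (φ.domRestrict (OM k a (K + 1)))
  have h2 : LinearMap.range (φ.domRestrict (OM k a (K + 1))) = ⊤ := by
    rw [LinearMap.range_eq_top]
    intro g
    have hcoe : ∀ i j, ((∑ l : Fin a, (monomial (l : ℕ) (monomial (K + 1 - l) (g l)) : k[X][X])).coeff j).coeff i ≠ 0 →
        j < a ∧ i + j = K + 1 := by
      intro i j h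
      rw [finsetSum_coeff, finsetSum_coeff] at h
      obtain ⟨l, _, hl⟩ := Finset.exists_ne_zero_of_sum_ne_zero h
      rw [coeff_monomial] at hl
      split_ifs at hl with h3
      · rw [coeff_monomial] at hl
        split_ifs at hl with h4
        · have := l.2; omega
        · exact absurd rfl hl
      · simp at hl
    refine ⟨⟨∑ l : Fin a, monomial (l : ℕ) (monomial (K + 1 - l) (g l)), ?_⟩, ?_⟩
    · rw [mem_OM]
      constructor
      · intro i j h; have := hcoe i j h; omega
      · rw [degree_lt_iff_coeff_zero]
        intro j hj
        ext i
        by_contra h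
        have := (hcoe i j (by simpa using h)).1
        omega
    · ext j
      rw [LinearMap.domRestrict_apply, hφ, finsetSum_coeff, finsetSum_coeff, Finset.sum_eq_single j]
      · simp
      · intro b _ hb
        rw [coeff_monomial, if_neg (fun h => hb (Fin.ext h)), coeff_zero]
      · simp
  rw [h2, finrank_top, Module.finrank_fintype_fun_eq_card, Fintype.card_fin] at h1
  have h3 : OM k a K ≤ (LinearMap.ker (φ.domRestrict (OM k a (K + 1)))).map (OM k a (K + 1)).subtype := by
    intro p hp
    rw [mem_OM] at hp
    refine ⟨⟨p, mem_OM.2 ⟨Wt_mono (Nat.le_succ _) hp.1, hp.2⟩⟩, ?_, rfl⟩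
    change φ p = 0
    ext j
    rw [hφ]
    by_contra h
    have := hp.1 _ _ h
    have := j.2
    omega
  haveI : Module.Finite k ((LinearMap.ker (φ.domRestrict (OM k a (K + 1)))).map (OM k a (K + 1)).subtype) :=
    Submodule.finiteDimensional_of_le (S₂ := OM k a (K + 1)) (Submodule.map_subtype_le _ _)
  have h4 := Submodule.finrank_mono h3
  rw [Submodule.finrank_map_subtype_eq] at h4
  omega

lemma OM_add (a K b : ℕ) (hK : a ≤ K) :
    Module.finrank k (OM k a K) + a * b ≤ Module.finrank k (OM k a (K + b)) := by
  induction b with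
  | zero => simp
  | succ b ih =>
    have := OM_succ (k := k) a (K + b) (by omega)
    rw [← add_assoc, mul_add]
    omega

lemma th_ne {p : k[X][X]} (hp : p ≠ 0) : th 1 1 p ≠ 0 :=
  fun h => hp (th_injective 1 1 one_pos (by rw [h, map_zero]))

lemma th_lead_monic {U : k[X][X]} (hU : U.Monic) (hW : U ∈ Wt k 1 U.natDegree) :
    (th 1 1 U).natDegree = U.natDegree ∧ (th 1 1 U).leadingCoeff.natDegree = U.natDegree := by
  have h1 : ((th 1 1 U).coeff U.natDegree).coeff U.natDegree = 1 := by
    have := th_coeff_ij 1 1 one_pos U 0 U.natDegree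
    rw [mul_zero, zero_add, one_mul] at this
    rw [this, hU.coeff_natDegree, coeff_one_zero]
  have h2 : (th 1 1 U).natDegree = U.natDegree := by
    apply le_antisymm (th_one_Wt.2 hW)
    apply le_natDegree_of_ne_zero
    intro h
    rw [h, coeff_zero] at h1
    exact zero_ne_one h1
  refine ⟨h2, ?_⟩
  rw [leadingCoeff, h2]
  apply le_antisymm
  · rw [natDegree_le_iff_coeff_eq_zero]
    intro j hj
    by_contra h
    obtain ⟨i, h3, h4⟩ := th_coeff_ne one_pos h
    omega
  · apply le_natDegree_of_ne_zero
    rw [h1]; exact one_ne_zero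

lemma th_coeff_natDegree {p : k[X][X]} (n : ℕ) : ((th 1 1 p).coeff n).natDegree ≤ p.natDegree := by
  rw [natDegree_le_iff_coeff_eq_zero]
  intro j hj
  by_contra h
  obtain ⟨i, h3, h4⟩ := th_coeff_ne one_pos h
  rw [coeff_eq_zero_of_natDegree_lt hj, coeff_zero] at h4
  exact h4 rfl

/-- Bezout's theorem, lower bound, assuming no intersections at infinity. -/
theorem bezout_lower {U V : k[X][X]} (hU : U.Monic) (hV : V.Monic) (hWU : U ∈ Wt k 1 U.natDegree)
    (hWV : V ∈ Wt k 1 V.natDegree)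
    (hcop : IsCoprime (th 1 1 U).leadingCoeff (th 1 1 V).leadingCoeff) {n : ℕ}
    (hn : CoLE k (Ideal.span {U, V}) n) : U.natDegree * V.natDegree ≤ n := by
  set a := U.natDegree with ha
  set b := V.natDegree with hb
  have h1 := CoLE_finrank hn (OM k a (a + b))
  have h2 := OM_add (k := k) a a b le_rfl
  let ν : k[X][X] →ₗ[k] k[X][X] :=
    ((modByMonicHom U).restrictScalars k).comp (LinearMap.mulRight k V)
  have h3 : OM k a (a + b) ⊓ (Ideal.span {U, V}).restrictScalars k ≤ (OM k a a).map ν := by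
    rintro p ⟨hp, hpI⟩
    rw [SetLike.mem_coe, mem_OM] at hp
    obtain ⟨g0, h0, hgh⟩ := Ideal.mem_span_pair.1 hpI
    set h := h0 %ₘ U with hh
    set g := g0 + (h0 /ₘ U) * V with hg
    have hp' : p = g * U + h * V := by
      have := modByMonic_add_div h0 U
      rw [hg, ← hgh]
      linear_combination V * this.symm
    have hhd : h.degree < a := by
      rw [ha, ← degree_eq_natDegree hU.ne_zero]
      exact degree_modByMonic_lt _ hU
    refine ⟨h, ?_, ?_⟩
    · rw [SetLike.mem_coe, mem_OM]
      refine ⟨?_, hhd⟩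
      by_cases hz : h = 0
      · rw [hz]; exact Submodule.zero_mem _
      rw [← th_one_Wt]
      by_contra hlt
      push Not at hlt
      set e := (th 1 1 h).natDegree with he
      obtain ⟨u1, u2⟩ := th_lead_monic hU hWU
      obtain ⟨v1, v2⟩ := th_lead_monic hV hWV
      have e1 : (th 1 1 (h * V)).natDegree = e + b := by
        rw [map_mul, natDegree_mul (th_ne hz) (th_ne hV.ne_zero), v1]
      have e2 : (th 1 1 (h * V)).leadingCoeff = (th 1 1 h).leadingCoeff * (th 1 1 V).leadingCoeff := by
        rw [map_mul, leadingCoeff_mul]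
      have e3 : (th 1 1 p).natDegree < e + b := lt_of_le_of_lt (th_one_Wt.2 hp.1) (by omega)
      have e4 : th 1 1 (g * U) = th 1 1 p - th 1 1 (h * V) := by rw [← map_sub, hp']; congr 1; ring
      have e5 : (th 1 1 (g * U)).leadingCoeff = - (th 1 1 (h * V)).leadingCoeff := by
        rw [e4, leadingCoeff_sub_of_degree_lt']
        apply degree_lt_degree
        omega
      rw [map_mul, leadingCoeff_mul, e2] at e5
      have e6 : (th 1 1 U).leadingCoeff ∣ (th 1 1 h).leadingCoeff := by
        apply hcop.dvd_of_dvd_mul_right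
        exact ⟨-(th 1 1 g).leadingCoeff, by linear_combination e5⟩
      have e7 := natDegree_le_of_dvd e6 (leadingCoeff_ne_zero.2 (th_ne hz))
      have e8 : (th 1 1 h).leadingCoeff.natDegree ≤ h.natDegree := th_coeff_natDegree _
      have e9 : h.natDegree < a := (natDegree_lt_iff_degree_lt hz).2 hhd
      omega
    · change (h * V) %ₘ U = p
      have e1 : (U * g) %ₘ U = 0 := by rw [modByMonic_eq_zero_iff_dvd hU]; exact dvd_mul_right _ _
      have e2 : p %ₘ U = p := by
        rw [modByMonic_eq_self_iff hU, degree_eq_natDegree hU.ne_zero]; exact hp.2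
      rw [← e2]
      conv_rhs => rw [hp', add_modByMonic, mul_comm g U, e1, zero_add]
  have h4 := Submodule.finrank_mono h3
  have h5 := Submodule.finrank_map_le ν (OM k a a)
  omega

end
end ExcAPN

namespace ExcAPN
open Polynomial
section
variable {k : Type*} [Field k] [CharP k 2]

/-- exchange of the variables -/
noncomputable def sw : k[X][X] →ₐ[k] k[X][X] := ev X (C X)


lemma sw_sw (p : k[X][X]) : sw (sw p) = p := by
  have : (sw.comp sw : k[X][X] →ₐ[k] k[X][X]) = AlgHom.id k _ := by
    apply ev_ext <;> simp [sw]
  exact congrArg (fun φ : k[X][X] →ₐ[k] k[X][X] => φ p) this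

lemma two_A : (2 : k[X][X]) = 0 := by
  have h2 : (2 : k) = 0 := by simpa using CharP.cast_eq_zero k 2
  have := congrArg (algebraMap k k[X][X]) h2
  rwa [map_ofNat, map_zero] at this

lemma memI_y {N : ℕ} (hN : Even N) {U V : k[X][X]}
    (h : U * V * TT k = (C X) ^ (N + 1) + X ^ (N + 1) + 1 + (ww k) ^ (N + 1)) :
    X ^ N + (ww k) ^ N ∈ Ideal.span {U, V} := by
  have h1 := congrArg derivative h
  have h2 : derivative (ww k) = 1 := by simp [ww]
  have h3 : ((N + 1 : ℕ) : k[X][X]) = 1 := by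
    obtain ⟨r, rfl⟩ := hN
    push_cast
    linear_combination (r : k[X][X]) * two_A (k := k)
  have h4 : derivative ((C X : k[X][X]) ^ (N + 1)) = 0 := by
    rw [← C_pow, derivative_C]
  rw [derivative_add, derivative_add, derivative_add, h4, derivative_one, derivative_X_pow,
    derivative_pow, h2, Nat.add_sub_cancel, C_eq_natCast, h3, derivative_mul, derivative_mul] at h1
  rw [Ideal.mem_span_pair]
  refine ⟨derivative V * TT k + V * derivative (TT k), derivative U * TT k, ?_⟩
  linear_combination h1

lemma memI {N : ℕ} (hN : Even N) {U V : k[X][X]}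
    (h : U * V * TT k = (C X) ^ (N + 1) + X ^ (N + 1) + 1 + (ww k) ^ (N + 1)) :
    (C X) ^ N + 1 ∈ Ideal.span {U, V} ∧ X ^ N + 1 ∈ Ideal.span {U, V} ∧
    (ww k) ^ N + 1 ∈ Ideal.span {U, V} := by
  have hy := memI_y hN h
  have hx : (C X) ^ N + (ww k) ^ N ∈ Ideal.span {U, V} := by
    have h1 := congrArg sw h
    have hw : sw (ww k) = ww k := by simp [sw, ww]; ring
    have hT : sw (TT k) = TT k := by simp [sw, TT]; ring
    have e1 : sw (C X : k[X][X]) = X := by simp [sw]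
    have e2 : sw (X : k[X][X]) = C X := by simp [sw]
    simp only [map_mul, map_add, map_pow, hw, hT, e1, e2, map_one] at h1
    have h2 := memI_y hN (U := sw U) (V := sw V) (by rw [h1]; ring)
    rw [Ideal.mem_span_pair] at h2 ⊢
    obtain ⟨a, b, hab⟩ := h2
    refine ⟨sw a, sw b, ?_⟩
    have := congrArg sw hab
    simpa only [map_mul, map_add, map_pow, hw, sw_sw, e2] using this
  have hf : U * V * TT k ∈ Ideal.span {U, V} := by
    rw [mul_assoc]
    exact Ideal.mul_mem_right _ _ (Ideal.subset_span (by simp))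
  have hw : (ww k) ^ N + 1 ∈ Ideal.span {U, V} := by
    have e : (ww k) ^ N + 1 = U * V * TT k - (C X) * ((C X) ^ N + (ww k) ^ N)
        - X * (X ^ N + (ww k) ^ N) := by
      rw [h, pow_succ (ww k)]
      have hw' : C X + X + 1 = ww k := rfl
      linear_combination (ww k) ^ N * hw'
    rw [e]
    exact Ideal.sub_mem _ (Ideal.sub_mem _ hf (Ideal.mul_mem_left _ _ hx)) (Ideal.mul_mem_left _ _ hy)
  refine ⟨?_, ?_, hw⟩
  · have : (C X) ^ N + 1 = ((C X) ^ N + (ww k) ^ N) - ((ww k) ^ N + 1) + 2 * 1 := by ring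
    rw [this, two_A, zero_mul, add_zero]
    exact Ideal.sub_mem _ hx hw
  · have : (X : k[X][X]) ^ N + 1 = (X ^ N + (ww k) ^ N) - ((ww k) ^ N + 1) + 2 * 1 := by ring
    rw [this, two_A, zero_mul, add_zero]
    exact Ideal.sub_mem _ hy hw

lemma deg_drop {U : k[X][X]} (hU : U.Monic) (hW : U ∈ Wt k 1 U.natDegree) {ρ : k}
    (h : aeval ρ (th 1 1 U).leadingCoeff = 0) :
    ((th 1 1 U).map (evalRingHom ρ)).degree < U.natDegree := by
  rw [degree_lt_iff_coeff_zero]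
  intro m hm
  rw [coeff_map]
  rcases hm.lt_or_eq with h1 | h1
  · rw [coeff_eq_zero_of_natDegree_lt ((th_one_Wt.2 hW).trans_lt h1), map_zero]
  · rw [← h1, ← (th_lead_monic hU hW).1]
    simpa [coe_aeval_eq_eval] using h

lemma cop_inf [IsAlgClosed k] {N : ℕ} (hN : Even N) {U V : k[X][X]} (hU : U.Monic) (hV : V.Monic)
    (hWU : U ∈ Wt k 1 U.natDegree) (hWV : V ∈ Wt k 1 V.natDegree) (hd : U.natDegree + V.natDegree + 2 = N)
    (h : U * V * TT k = (C X) ^ (N + 1) + X ^ (N + 1) + 1 + (ww k) ^ (N + 1)) :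
    IsCoprime (th 1 1 U).leadingCoeff (th 1 1 V).leadingCoeff := by
  have h2k : (2 : k) = 0 := by simpa using CharP.cast_eq_zero k 2
  rw [isCoprime_iff_aeval_ne_zero_of_isAlgClosed k k]
  intro ρ
  by_contra hcon
  push Not at hcon
  obtain ⟨hu, hv⟩ := hcon
  have du := deg_drop hU hWU hu
  have dv := deg_drop hV hWV hv
  have hth := congrArg (th 1 1) h
  simp only [map_mul, map_add, map_pow, TT, ww, map_one] at hth
  have e1 : th 1 1 (C X : k[X][X]) = X := by simp [th]
  have e2 : th 1 1 (X : k[X][X]) = C X * X := by simp [th]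
  rw [e1, e2] at hth
  have dT : ((X + C X * X) * (X + 1) * (C X * X + 1) : k[X][X]).natDegree ≤ 3 := by
    compute_degree
  have hNk : ((N + 1 : ℕ) : k) = 1 := by
    obtain ⟨r, rfl⟩ := hN
    push_cast
    linear_combination (r : k) * h2k
  have hρ : ρ = 1 := by
    have h1 := congrArg (fun p => (p.map (evalRingHom ρ)).coeff N) hth
    simp only [Polynomial.map_mul, Polynomial.map_add, Polynomial.map_pow, Polynomial.map_one,
      Polynomial.map_X, Polynomial.map_C, coe_evalRingHom, eval_X] at h1
    have l1 : (((th 1 1 U).map (evalRingHom ρ)) * ((th 1 1 V).map (evalRingHom ρ)) *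
        ((X + C ρ * X) * (X + 1) * (C ρ * X + 1))).coeff N = 0 := by
      by_cases z1 : (th 1 1 U).map (evalRingHom ρ) = 0
      · simp [z1]
      by_cases z2 : (th 1 1 V).map (evalRingHom ρ) = 0
      · simp [z2]
      rw [← natDegree_lt_iff_degree_lt z1] at du
      rw [← natDegree_lt_iff_degree_lt z2] at dv
      apply coeff_eq_zero_of_natDegree_lt
      have dT : ((X + C ρ * X) * (X + 1) * (C ρ * X + 1) : k[X]).natDegree ≤ 3 := by
        compute_degree
      refine (natDegree_mul_le).trans_lt ?_
      have := natDegree_mul_le (p := (th 1 1 U).map (evalRingHom ρ)) (q := (th 1 1 V).map (evalRingHom ρ))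
      omega
    rw [l1] at h1
    have l2 : (X + C ρ * X + 1 : k[X]) ^ (N + 1) = ((X + 1) ^ (N + 1)).comp (C (1 + ρ) * X) := by
      simp; ring
    have hN0 : N ≠ 0 := by omega
    rw [l2, mul_pow, ← C_pow, coeff_add, coeff_add, coeff_add, comp_C_mul_X_coeff, coeff_X_add_one_pow, coeff_C_mul,
      coeff_X_pow, coeff_one, if_neg (by omega), if_neg hN0, Nat.choose_succ_self_right, hNk] at h1
    have h5 : (1 + ρ) ^ N = 0 := by linear_combination -h1
    have h6 := pow_eq_zero_iff hN0 |>.1 h5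
    linear_combination h6 - h2k
  have h1 := congrArg (fun p => p.coeff (N + 1)) hth
  beta_reduce at h1
  rw [show N + 1 = (U.natDegree + V.natDegree) + 3 by omega,
    coeff_mul_add_eq_of_natDegree_le (natDegree_mul_le_of_le (th_one_Wt.2 hWU) (th_one_Wt.2 hWV)) dT,
    coeff_mul_add_eq_of_natDegree_le (th_one_Wt.2 hWU) (th_one_Wt.2 hWV)] at h1
  rw [leadingCoeff, (th_lead_monic hU hWU).1] at hu
  rw [leadingCoeff, (th_lead_monic hV hWV).1] at hv
  rw [← (by omega : N + 1 = (U.natDegree + V.natDegree) + 3)] at h1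
  have l2 : (X + C X * X + 1 : k[X][X]) ^ (N + 1) = ((X + 1) ^ (N + 1)).comp (C (1 + X) * X) := by
      simp; ring
  rw [l2, mul_pow, ← C_pow, coeff_add, coeff_add, coeff_add, comp_C_mul_X_coeff, coeff_X_add_one_pow, coeff_C_mul,
      coeff_X_pow, coeff_one, if_pos rfl, if_neg (by omega), Nat.choose_self] at h1
  have h3 := congrArg (fun p => eval ρ (derivative p)) h1
  have hu' : eval ρ ((th 1 1 U).coeff U.natDegree) = 0 := by simpa [coe_aeval_eq_eval] using hu
  have hv' : eval ρ ((th 1 1 V).coeff V.natDegree) = 0 := by simpa [coe_aeval_eq_eval] using hv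
  simp only [derivative_mul, eval_add, eval_mul, hu', hv', zero_mul, mul_zero, add_zero] at h3
  simp only [derivative_add, derivative_one, mul_one, add_zero, derivative_X_pow, derivative_pow,
    derivative_X, Nat.cast_one, zero_add, Nat.add_sub_cancel, eval_add, eval_mul, eval_pow, eval_X, eval_C, eval_one, hNk, hρ, one_pow, one_mul] at h3
  rw [show (1 : k) + 1 = 0 by linear_combination h2k, zero_pow (by omega)] at h3
  simp at h3

end
end ExcAPN

namespace ExcAPN
open Polynomial
section
variable {k : Type*} [Field k] [CharP k 2]

lemma neg_A (p : k[X][X]) : -p = p := by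
  linear_combination (-p) * two_A (k := k)

/-- translation -/
noncomputable def tr (α β : k) : k[X][X] →ₐ[k] k[X][X] := ev (C X + C (C α)) (X + C (C β))

lemma CCtwo (a : k) : (C (C a) + C (C a) : k[X][X]) = 0 := by
  linear_combination (C (C a)) * two_A (k := k)

lemma tr_CX (α β : k) : tr α β (C X) = C X + C (C α) := by simp [tr]
lemma tr_X (α β : k) : tr α β X = X + C (C β) := by simp [tr]
lemma ev_CC' {R : Type*} [CommRing R] [Algebra k R] (φ : k[X][X] →ₐ[k] R) (c : k) : φ (C (C c)) = algebraMap k R c := φ.commutes c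
lemma alg_A (c : k) : algebraMap k k[X][X] c = C (C c) := rfl

lemma tr_tr (α β : k) (p : k[X][X]) : tr α β (tr α β p) = p := by
  have : ((tr α β).comp (tr α β) : k[X][X] →ₐ[k] k[X][X]) = AlgHom.id k _ := by
    apply ev_ext
    · simp only [AlgHom.comp_apply, tr_CX, map_add, ev_CC', alg_A, AlgHom.id_apply, add_assoc, CCtwo, add_zero]
    · simp only [AlgHom.comp_apply, tr_X, map_add, ev_CC', alg_A, AlgHom.id_apply, add_assoc, CCtwo, add_zero]
  exact congrArg (fun φ : k[X][X] →ₐ[k] k[X][X] => φ p) this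

lemma CoLE_equiv {A : Type*} [CommRing A] [Algebra k A] (φ : A →ₐ[k] A) (hφ : ∀ x, φ (φ x) = x) {I J : Ideal A} {n : ℕ}
    (h : CoLE k J n) (hJ : ∀ x ∈ J, φ x ∈ I) : CoLE k I n := by
  classical
  obtain ⟨s, hs, h⟩ := h
  refine ⟨s.image φ, Finset.card_image_le.trans hs, fun x => ?_⟩
  obtain ⟨y, hy, z, hz, hyz⟩ := Submodule.mem_sup.1 (h (φ x))
  rw [← hφ x, ← hyz, map_add]
  refine Submodule.add_mem_sup (hJ y hy) ?_
  have := Submodule.mem_map_of_mem (f := φ.toLinearMap) hz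
  rw [Submodule.map_span] at this
  rw [Finset.coe_image]
  exact this

lemma lag [DecidableEq k] (μ : Finset k) (α : k) (hα : α ∈ μ) :
    ∃ c : k, (X - C α) * Lagrange.basis μ id α = C c * ∏ a ∈ μ, (X - C a) := by
  refine ⟨∏ j ∈ μ.erase α, (α - j)⁻¹, ?_⟩
  rw [← Finset.mul_prod_erase μ _ hα, Lagrange.basis]
  simp only [Lagrange.basisDivisor, id, Finset.prod_mul_distrib, map_prod]
  ring

theorem bezout_sum [IsAlgClosed k] {i ℓ : ℕ} (hi : 1 ≤ i) (hℓ : Odd ℓ) {U V : k[X][X]} (hU : U.Monic) (hV : V.Monic)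
    (hWU : U ∈ Wt k 1 U.natDegree) (hWV : V ∈ Wt k 1 V.natDegree)
    (hd : U.natDegree + V.natDegree + 2 = 2 ^ i * ℓ)
    (h : U * V * TT k = (C X) ^ (2 ^ i * ℓ + 1) + X ^ (2 ^ i * ℓ + 1) + 1 + (ww k) ^ (2 ^ i * ℓ + 1))
    (n : k × k → ℕ)
    (hn : ∀ P ∈ nthRootsFinset ℓ (1 : k) ×ˢ nthRootsFinset ℓ (1 : k),
      CoLE k (Ideal.span {tr P.1 P.2 U, tr P.1 P.2 V, (C X) ^ 2 ^ i, X ^ 2 ^ i}) (n P)) :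
    U.natDegree * V.natDegree ≤ ∑ P ∈ nthRootsFinset ℓ (1 : k) ×ˢ nthRootsFinset ℓ (1 : k), n P := by
  classical
  have : Fact (Nat.Prime 2) := ⟨Nat.prime_two⟩
  have : ExpChar k[X][X] 2 := ExpChar.prime Nat.prime_two
  have hN : Even (2 ^ i * ℓ) := (Nat.even_pow.2 ⟨even_two, by omega⟩).mul_right _
  obtain ⟨hx, hy, hw⟩ := memI hN h
  apply bezout_lower hU hV hWU hWV (cop_inf hN hU hV hWU hWV hd h)
  set μ := nthRootsFinset ℓ (1 : k) with hμ
  have h2k : (2 : k) = 0 := by simpa using CharP.cast_eq_zero k 2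
  have hℓk : (ℓ : k) = 1 := by
    obtain ⟨r, rfl⟩ := hℓ
    push_cast
    linear_combination (r : k) * h2k
  have : NeZero (ℓ : k) := ⟨by rw [hℓk]; exact one_ne_zero⟩
  have hℓ0 : 0 < ℓ := hℓ.pos
  have : NeZero ℓ := ⟨hℓ0.ne'⟩
  obtain ⟨ζ, hζ⟩ := HasEnoughRootsOfUnity.exists_primitiveRoot k ℓ
  have hprod := X_pow_sub_one_eq_prod hℓ0 hζ
  rw [← hμ] at hprod
  have h1μ : (1 : k) ∈ μ := by rw [hμ, mem_nthRootsFinset hℓ0]; simp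
  have hsum : ∑ α ∈ μ, Lagrange.basis μ id α = 1 := Lagrange.sum_basis (Function.injective_id.injOn) ⟨1, h1μ⟩
  let e : k × k → k[X][X] := fun P => C (Lagrange.basis μ id P.1) ^ 2 ^ i * ((Lagrange.basis μ id P.2).map C) ^ 2 ^ i
  let J : k × k → Ideal k[X][X] := fun P => Ideal.span {(C X + C (C P.1)) ^ 2 ^ i, (X + C (C P.2)) ^ 2 ^ i}
  refine CoLE_crt (μ ×ˢ μ) e _ J n ?_ ?_ ?_
  · have : ∑ P ∈ μ ×ˢ μ, e P = 1 := by
      rw [Finset.sum_product]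
      simp only [e]
      rw [← Finset.sum_mul_sum, ← sum_pow_char_pow, ← sum_pow_char_pow, ← map_sum, ← Polynomial.map_sum, hsum]
      simp
    rw [this, sub_self]
    exact Ideal.zero_mem _
  · intro P hP
    rw [Finset.mem_product] at hP
    suffices J P ≤ Submodule.comap (LinearMap.mulLeft k[X][X] (e P)) (Ideal.span {U, V}) from fun x hx => this hx
    refine Submodule.span_le.2 ?_
    rintro x (rfl | rfl)
    · obtain ⟨c, hc⟩ := lag μ P.1 hP.1
      have e1 := congrArg (fun p : k[X] => (C p : k[X][X]) ^ 2 ^ i) hc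
      simp only [← hprod] at e1
      change _ * _ ∈ Ideal.span {U, V}
      have e2 : e P * (C X + C (C P.1)) ^ 2 ^ i =
        (C (Lagrange.basis μ id P.1) * (C X - C (C P.1))) ^ 2 ^ i * ((Lagrange.basis μ id P.2).map C) ^ 2 ^ i := by
        simp only [e]; rw [mul_pow, sub_eq_add_neg, neg_A]; ring
      rw [e2]
      apply Ideal.mul_mem_right
      rw [mul_comm, ← C_sub, ← C_mul, e1, C_mul, mul_pow]
      apply Ideal.mul_mem_left
      rw [C_sub, sub_pow_char_pow, sub_eq_add_neg, neg_A, C_pow, ← pow_mul, mul_comm ℓ]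
      simpa using hx
    · obtain ⟨c, hc⟩ := lag μ P.2 hP.2
      have e1 := congrArg (fun p : k[X] => (p.map C : k[X][X]) ^ 2 ^ i) hc
      simp only [← hprod] at e1
      change _ * _ ∈ Ideal.span {U, V}
      have e2 : e P * (X + C (C P.2)) ^ 2 ^ i =
        C (Lagrange.basis μ id P.1) ^ 2 ^ i * ((X - C P.2) * (Lagrange.basis μ id P.2)).map C ^ 2 ^ i := by
        simp only [e]; rw [Polynomial.map_mul, mul_pow, Polynomial.map_sub, sub_eq_add_neg, neg_A]; simp; ring
      rw [e2]
      apply Ideal.mul_mem_left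
      rw [e1, Polynomial.map_mul, mul_pow]
      apply Ideal.mul_mem_left
      rw [Polynomial.map_sub, sub_pow_char_pow, sub_eq_add_neg, neg_A]
      simp only [Polynomial.map_pow, map_X, Polynomial.map_one, one_pow]
      rw [← pow_mul, mul_comm ℓ]
      exact hy
  · intro P hP
    refine CoLE_equiv (tr P.1 P.2) (tr_tr _ _) (hn P hP) ?_
    suffices Ideal.span {tr P.1 P.2 U, tr P.1 P.2 V, (C X) ^ 2 ^ i, X ^ 2 ^ i} ≤ (Ideal.span {U, V} ⊔ J P).comap (tr P.1 P.2).toRingHom from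
      fun x hx => this hx
    rw [Ideal.span_le]
    rintro x (rfl | rfl | rfl | rfl)
    · change tr P.1 P.2 (tr P.1 P.2 U) ∈ Ideal.span {U, V} ⊔ J P
      rw [tr_tr]
      exact Ideal.mem_sup_left (Ideal.subset_span (by simp))
    · change tr P.1 P.2 (tr P.1 P.2 V) ∈ Ideal.span {U, V} ⊔ J P
      rw [tr_tr]
      exact Ideal.mem_sup_left (Ideal.subset_span (by simp))
    · change tr P.1 P.2 _ ∈ Ideal.span {U, V} ⊔ J P
      rw [map_pow, tr_CX]
      exact Ideal.mem_sup_right (Ideal.subset_span (by simp))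
    · change tr P.1 P.2 _ ∈ Ideal.span {U, V} ⊔ J P
      rw [map_pow, tr_X]
      exact Ideal.mem_sup_right (Ideal.subset_span (by simp))

/-- points where the third coordinate is not a root of unity do not contribute -/
lemma point_w {i ℓ : ℕ} (hi : 1 ≤ i) {U V : k[X][X]}
    (h : U * V * TT k = (C X) ^ (2 ^ i * ℓ + 1) + X ^ (2 ^ i * ℓ + 1) + 1 + (ww k) ^ (2 ^ i * ℓ + 1))
    (α β : k) (hδ : (α + β + 1) ^ ℓ ≠ 1) :
      CoLE k (Ideal.span {tr α β U, tr α β V, (C X) ^ 2 ^ i, X ^ 2 ^ i}) 0 := by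
  have : Fact (Nat.Prime 2) := ⟨Nat.prime_two⟩
  have : ExpChar k[X][X] 2 := ExpChar.prime Nat.prime_two
  have : ExpChar k 2 := ExpChar.prime Nat.prime_two
  have hN : Even (2 ^ i * ℓ) := (Nat.even_pow.2 ⟨even_two, by omega⟩).mul_right _
  obtain ⟨hx, hy, hw⟩ := memI hN h
  set K := Ideal.span {tr α β U, tr α β V, (C X) ^ 2 ^ i, X ^ 2 ^ i} with hK
  have h2k : (2 : k) = 0 := by simpa using CharP.cast_eq_zero k 2
  suffices (1 : k[X][X]) ∈ K by rw [Ideal.eq_top_iff_one K |>.2 this]; exact CoLE_top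
  obtain ⟨g1, g2, hg⟩ := Ideal.mem_span_pair.1 hw
  have h1 := congrArg (tr α β) hg
  have h2 : tr α β (ww k ^ (2 ^ i * ℓ) + 1) ∈ K := by
    rw [← h1, map_add, map_mul, map_mul]
    exact Ideal.add_mem _ (Ideal.mul_mem_left _ _ (Ideal.subset_span (by simp))) (Ideal.mul_mem_left _ _ (Ideal.subset_span (by simp)))
  have h3 : tr α β (ww k ^ (2 ^ i * ℓ) + 1) = (((C X) ^ 2 ^ i + X ^ 2 ^ i) + C (C ((α + β + 1) ^ 2 ^ i))) ^ ℓ + 1 := by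
    rw [map_add, map_pow, map_one, ww, map_add, map_add, map_one, tr_CX, tr_X, pow_mul,
      show (C X + C (C α) + (X + C (C β)) + 1 : k[X][X]) = (C X + X) + C (C (α + β + 1)) by simp; ring,
      add_pow_char_pow, add_pow_char_pow]
    simp
  rw [h3] at h2
  have h4 : (((C X) ^ 2 ^ i + X ^ 2 ^ i) + C (C ((α + β + 1) ^ 2 ^ i)) : k[X][X]) ^ ℓ - (C (C ((α + β + 1) ^ 2 ^ i))) ^ ℓ ∈ K := by
    refine Ideal.mem_of_dvd _ (sub_dvd_pow_sub_pow _ _ ℓ) ?_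
    rw [add_sub_cancel_right]
    exact Ideal.add_mem _ (Ideal.subset_span (by simp)) (Ideal.subset_span (by simp))
  have h5 := Ideal.sub_mem _ h2 h4
  have h6 : C (C (((α + β + 1) ^ ℓ - 1) ^ 2 ^ i)) ∈ K := by
    rw [sub_pow_char_pow]
    convert h5 using 1
    simp only [C_sub, C_pow, C_add, C_1, one_pow]
    linear_combination (-1) * two_A (k := k)
  have h7 := Ideal.mul_mem_left _ (C (C (((α + β + 1) ^ ℓ - 1) ^ 2 ^ i)⁻¹)) h6
  rw [← C_mul, ← C_mul, inv_mul_cancel₀ (pow_ne_zero _ (sub_ne_zero.2 hδ))] at h7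
  simpa using h7

end
end ExcAPN

namespace ExcAPN
open Polynomial
section
variable {k : Type*} [Field k] [CharP k 2]

/-- `p` has order at least `r` at the origin, with `r`-th form (dehomogenized) `g`. -/
def Tr (r : ℕ) (g : k[X]) (p : k[X][X]) : Prop := ∃ h, th 1 1 p = X ^ r * h ∧ h.coeff 0 = g

lemma Tr.mul {r r' : ℕ} {g g' : k[X]} {p p' : k[X][X]} (h : Tr r g p) (h' : Tr r' g' p') :
    Tr (r + r') (g * g') (p * p') := by
  obtain ⟨a, ha, rfl⟩ := h
  obtain ⟨b, hb, rfl⟩ := h'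
  exact ⟨a * b, by rw [map_mul, ha, hb]; ring, by rw [mul_coeff_zero]⟩

lemma Tr.add {r : ℕ} {g g' : k[X]} {p p' : k[X][X]} (h : Tr r g p) (h' : Tr r g' p') :
    Tr r (g + g') (p + p') := by
  obtain ⟨a, ha, rfl⟩ := h
  obtain ⟨b, hb, rfl⟩ := h'
  exact ⟨a + b, by rw [map_add, ha, hb]; ring, by rw [coeff_add]⟩

lemma Tr.zero {r : ℕ} : Tr r 0 (0 : k[X][X]) := ⟨0, by simp, by simp⟩

lemma Tr.smul {r : ℕ} {g : k[X]} {p : k[X][X]} (c : k) (h : Tr r g p) :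
    Tr r (c • g) (c • p) := by
  obtain ⟨a, ha, rfl⟩ := h
  exact ⟨c • a, by rw [map_smul, ha, mul_smul_comm], by rw [coeff_smul]⟩

lemma Tr.of_dvd {r : ℕ} {p : k[X][X]} (h : X ^ r ∣ th 1 1 p) : Tr r ((th 1 1 p).coeff r) p := by
  obtain ⟨a, ha⟩ := h
  refine ⟨a, ha, ?_⟩
  rw [ha]
  simpa using (coeff_X_pow_mul a r 0).symm

lemma Tr.dvd {r : ℕ} {g : k[X]} {p : k[X][X]} (h : Tr r g p) : X ^ r ∣ th 1 1 p := by
  obtain ⟨a, ha, _⟩ := h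
  exact ⟨a, ha⟩

lemma Tr.coeff {r : ℕ} {g : k[X]} {p : k[X][X]} (h : Tr r g p) : (th 1 1 p).coeff r = g := by
  obtain ⟨a, ha, rfl⟩ := h
  rw [ha]
  simpa using (coeff_X_pow_mul a r 0)

lemma Tr.dvd_succ {r : ℕ} {p : k[X][X]} (h : Tr r 0 p) : X ^ (r + 1) ∣ th 1 1 p := by
  obtain ⟨a, ha, h0⟩ := h
  obtain ⟨b, rfl⟩ := X_dvd_iff.2 h0
  exact ⟨b, by rw [ha]; ring⟩

lemma Tr.natDegree {r : ℕ} {g : k[X]} {p : k[X][X]} (h : Tr r g p) : g.natDegree ≤ r := by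
  rw [← h.coeff, natDegree_le_iff_coeff_eq_zero]
  intro j hj
  by_contra h
  obtain ⟨i, h3, h4⟩ := th_coeff_ne one_pos h
  omega

/-- homogenization -/
noncomputable def hom (r : ℕ) (g : k[X]) : k[X][X] :=
  ∑ j ∈ Finset.range (r + 1), C (C (g.coeff j)) * C X ^ (r - j) * X ^ j

lemma Tr.hom {r : ℕ} {g : k[X]} (hg : g.natDegree ≤ r) : Tr r g (hom r g) := by
  refine ⟨C g, ?_, by simp⟩
  conv_rhs => rw [g.as_sum_range_C_mul_X_pow' (n := r + 1) (by omega)]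
  rw [ExcAPN.hom, map_sum, map_sum, Finset.mul_sum]
  refine Finset.sum_congr rfl fun j hj => ?_
  rw [map_mul, map_mul, map_pow, map_pow, ev_CC']
  simp only [th, ev_CX, ev_X, pow_one, alg_A, C_mul, C_pow]
  rw [mul_pow, show r = (r - j) + j by have := Finset.mem_range.1 hj; omega, pow_add]
  simp only [Nat.add_sub_cancel]
  ring

lemma exists_roots [IsAlgClosed k] (m : ℕ) : ∀ p : k[X], p ≠ 0 → p.natDegree = m →
    ∃ ρ : ℕ → k, p = C p.leadingCoeff * ∏ a ∈ Finset.range m, (X - C (ρ a)) := by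
  induction m with
  | zero =>
    intro p _ h
    refine ⟨fun _ => 0, ?_⟩
    rw [eq_C_of_natDegree_eq_zero h]; simp
  | succ m ih =>
    intro p hp h
    obtain ⟨r, hr⟩ := IsAlgClosed.exists_root p (by rw [degree_eq_natDegree hp, h]; exact_mod_cast (Nat.succ_ne_zero m))
    obtain ⟨p', rfl⟩ := dvd_iff_isRoot.2 hr
    have hp' : p' ≠ 0 := right_ne_zero_of_mul hp
    rw [natDegree_mul (X_sub_C_ne_zero r) hp', natDegree_X_sub_C] at h
    obtain ⟨ρ, hρ⟩ := ih p' hp' (by omega)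
    refine ⟨fun a => if a = m then r else ρ a, ?_⟩
    rw [Finset.prod_range_succ, leadingCoeff_mul, leadingCoeff_X_sub_C, one_mul]
    have : ∏ a ∈ Finset.range m, (X - C (if a = m then r else ρ a)) = ∏ a ∈ Finset.range m, (X - C (ρ a)) := by
      refine Finset.prod_congr rfl fun a ha => ?_
      rw [if_neg (Finset.mem_range.1 ha).ne]
    simp only [this, if_true]
    conv_lhs => rw [hρ]
    ring

lemma div_root (g : k[X]) (ρ : k) : ∃ g' : k[X], g = C (g.eval ρ) + (X - C ρ) * g' ∧
    (g' ≠ 0 → g'.natDegree + 1 ≤ g.natDegree) := by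
  obtain ⟨g', h⟩ := X_sub_C_dvd_sub_C_eval (a := ρ) (p := g)
  refine ⟨g', by rw [← h]; ring, fun h0 => ?_⟩
  have := congrArg Polynomial.natDegree h
  rw [natDegree_sub_C, natDegree_mul (X_sub_C_ne_zero ρ) h0, natDegree_X_sub_C] at this
  omega

/-- local intersection bound -/
theorem local_bound [IsAlgClosed k] {u v : k[X][X]} {m m' : ℕ} {u0 v0 : k[X]} (hu : Tr m u0 u) (hv : Tr m' v0 v)
    (hu0 : u0 ≠ 0) (hm : u0.natDegree = m) (hcop : ∀ ρ, u0.eval ρ = 0 → v0.eval ρ ≠ 0) {K : Ideal k[X][X]} (huK : u ∈ K) (hvK : v ∈ K)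
    {M : ℕ} (hM : ∀ p, X ^ M ∣ th 1 1 p → p ∈ K) : CoLE k K (m * m') := by
  classical
  obtain ⟨ρ, hρ⟩ := exists_roots m u0 hu0 hm
  have hlc : u0.leadingCoeff ≠ 0 := leadingCoeff_ne_zero.2 hu0
  let Nw : ℕ → k[X] := fun i => ∏ a ∈ Finset.range i, (X - C (ρ a))
  have hNs : ∀ i, Nw (i + 1) = Nw i * (X - C (ρ i)) := fun i => Finset.prod_range_succ _ _
  have hNd : ∀ i, (Nw i).natDegree = i := fun i => by
    simp only [Nw]; rw [natDegree_prod_of_monic _ _ (fun a _ => monic_X_sub_C _)]; simp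
  have hNm : ∀ i, (Nw i) ≠ 0 := fun i => by
    simp only [Nw]; exact (monic_prod_of_monic _ _ (fun a _ => monic_X_sub_C _)).ne_zero
  have hroot : ∀ i, i < m → v0.eval (ρ i) ≠ 0 := fun i hi => by
    apply hcop
    rw [hρ, eval_mul, eval_prod, Finset.prod_eq_zero (Finset.mem_range.2 hi), mul_zero]
    simp
  let s : Finset k[X][X] := ((Finset.range m) ×ˢ (Finset.range m')).image (fun P => hom (P.1 + P.2) (Nw P.1))
  refine ⟨s, Finset.card_image_le.trans (by simp), ?_⟩
  set W := K.restrictScalars k ⊔ Submodule.span k (s : Set k[X][X]) with hW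
  have hKW : ∀ p ∈ K, p ∈ W := fun p hp => Submodule.mem_sup_left hp
  -- the forms realized
  have key : ∀ r, ∀ g : k[X], g.natDegree ≤ r → ∃ z ∈ W, Tr r g z := by
    intro r
    let G : Submodule k k[X] :=
      { carrier := {g | ∃ z ∈ W, Tr r g z}
        add_mem' := by
          rintro a b ⟨z, hz, h1⟩ ⟨z', hz', h2⟩
          exact ⟨z + z', Submodule.add_mem _ hz hz', h1.add h2⟩
        zero_mem' := ⟨0, Submodule.zero_mem _, Tr.zero⟩
        smul_mem' := by
          rintro c a ⟨z, hz, h1⟩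
          exact ⟨c • z, Submodule.smul_mem _ _ hz, h1.smul c⟩ }
    have hv' : ∀ g : k[X], m' + g.natDegree ≤ r → v0 * g ∈ G := by
      intro g hg
      refine ⟨v * hom (r - m') g, hKW _ (Ideal.mul_mem_right _ _ hvK), ?_⟩
      have := hv.mul (Tr.hom (r := r - m') (g := g) (by omega))
      rwa [Nat.add_sub_of_le (by omega)] at this
    have hu' : ∀ g : k[X], m + g.natDegree ≤ r → u0 * g ∈ G := by
      intro g hg
      refine ⟨u * hom (r - m) g, hKW _ (Ideal.mul_mem_right _ _ huK), ?_⟩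
      have := hu.mul (Tr.hom (r := r - m) (g := g) (by omega))
      rwa [Nat.add_sub_of_le (by omega)] at this
    have ind : ∀ j, j ≤ m → ∀ g : k[X], (g ≠ 0 → (m - j) + g.natDegree ≤ r) → Nw (m - j) * g ∈ G := by
      intro j
      induction j with
      | zero =>
        intro _ g hg
        by_cases hg0 : g = 0
        · rw [hg0, mul_zero]; exact G.zero_mem
        have h1 := G.smul_mem u0.leadingCoeff⁻¹ (hu' g (hg hg0))
        convert h1 using 1
        rw [Nat.sub_zero]
        conv_rhs => rw [hρ]
        rw [smul_eq_C_mul, ← mul_assoc, ← mul_assoc]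
        simp only [leadingCoeff_mul, leadingCoeff_C]
        rw [← C_mul]
        have : (∏ a ∈ Finset.range m, (X - C (ρ a))).leadingCoeff = 1 := monic_prod_of_monic _ _ (fun a _ => monic_X_sub_C _)
        rw [this, mul_one, inv_mul_cancel₀ hlc, C_1, one_mul]
      | succ j ih =>
        intro hj g hg
        by_cases hg0 : g = 0
        · rw [hg0, mul_zero]; exact G.zero_mem
        specialize hg hg0
        obtain ⟨i, hi⟩ : ∃ i, m - (j + 1) = i := ⟨_, rfl⟩
        have hi' : m - j = i + 1 := by omega
        rw [hi] at hg ⊢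
        rw [hi'] at ih
        have hN : Nw i ∈ G := by
          by_cases hc : r - i < m'
          · refine ⟨hom r (Nw i), Submodule.mem_sup_right (Submodule.subset_span ?_), Tr.hom (by rw [hNd]; omega)⟩
            simp only [s, Finset.coe_image, Set.mem_image]
            refine ⟨(i, r - i), by simp; omega, ?_⟩
            simp only
            rw [Nat.add_sub_of_le (by omega)]
          · obtain ⟨g', h1, h2⟩ := div_root v0 (ρ i)
            have h3 := hv' (Nw i) (by rw [hNd]; omega)
            have h4 := ih (by omega) g' (fun h0 => by have := h2 h0; have := hv.natDegree; omega)
            have h5 := G.smul_mem (v0.eval (ρ i))⁻¹ (G.sub_mem h3 h4)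
            convert h5 using 1
            have hne := hroot i (by omega)
            have : v0 * Nw i - Nw (i + 1) * g' = C (v0.eval (ρ i)) * Nw i := by
              rw [hNs]
              linear_combination (Nw i) * h1
            rw [this, smul_eq_C_mul, ← mul_assoc, ← C_mul, inv_mul_cancel₀ hne, C_1, one_mul]
        obtain ⟨g', h1, h2⟩ := div_root g (ρ i)
        have h4 := ih (by omega) g' (fun h0 => by have := h2 h0; omega)
        have h5 := G.add_mem (G.smul_mem (g.eval (ρ i)) hN) h4
        convert h5 using 1
        rw [hNs, smul_eq_C_mul]
        linear_combination (Nw i) * h1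
    intro g hg
    have := ind m le_rfl g (fun _ => by omega)
    rw [Nat.sub_self] at this
    have h1 : g ∈ G := by simpa [Nw] using this
    exact h1
  have main : ∀ j, j ≤ M → ∀ p, X ^ (M - j) ∣ th 1 1 p → p ∈ W := by
    intro j
    induction j with
    | zero => exact fun _ p hp => hKW _ (hM p hp)
    | succ j ih =>
      intro hj p hp
      have h1 := Tr.of_dvd hp
      obtain ⟨z, hz, h2⟩ := key _ _ h1.natDegree
      have h3 := (h1.add (h2.smul (-1)))
      rw [neg_one_smul, add_neg_cancel] at h3
      have h4 := ih (by omega) _ (by have := h3.dvd_succ; rwa [show M - (j + 1) + 1 = M - j by omega] at this)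
      have := W.add_mem h4 hz
      simpa using this
  intro h
  exact main M le_rfl h (by simp)

end
end ExcAPN

namespace ExcAPN
open Polynomial
section
variable {k : Type*} [Field k] [CharP k 2]

/-- value at the origin -/
noncomputable def pz : k[X][X] →ₐ[k] k := ev 0 0

lemma pz_decomp (p : k[X][X]) : ∃ g h : k[X][X], p = C (C (pz p)) + C X * g + X * h := by
  refine ⟨C (divX (p.coeff 0)), divX p, ?_⟩
  conv_lhs => rw [← divX_mul_X_add p, ← divX_mul_X_add (p.coeff 0)]
  have : pz p = (p.coeff 0).coeff 0 := by
    rw [pz, ev_evalEval, evalEval, ← coeff_zero_eq_eval_zero, C_0, ← coeff_zero_eq_eval_zero]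
  rw [this]
  simp only [C_add, C_mul]
  ring

lemma one_mem_of_pz {K : Ideal k[X][X]} {i : ℕ} (hx : (C X) ^ 2 ^ i ∈ K) (hy : X ^ 2 ^ i ∈ K) {p : k[X][X]}
    (hp : p ∈ K) (h0 : pz p ≠ 0) : (1 : k[X][X]) ∈ K := by
  have : Fact (Nat.Prime 2) := ⟨Nat.prime_two⟩
  have : ExpChar k[X][X] 2 := ExpChar.prime Nat.prime_two
  obtain ⟨g, h, hgh⟩ := pz_decomp p
  have h1 : p ^ 2 ^ i ∈ K := Ideal.pow_mem_of_mem K hp _ (by positivity)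
  have h2 := congrArg (· ^ 2 ^ i) hgh
  simp only [add_pow_char_pow, mul_pow] at h2
  have h3 : C (C (pz p)) ^ 2 ^ i ∈ K := by
    have : C (C (pz p)) ^ 2 ^ i = p ^ 2 ^ i - C X ^ 2 ^ i * g ^ 2 ^ i - X ^ 2 ^ i * h ^ 2 ^ i := by rw [h2]; ring
    rw [this]
    exact Ideal.sub_mem _ (Ideal.sub_mem _ h1 (Ideal.mul_mem_right _ _ hx)) (Ideal.mul_mem_right _ _ hy)
  have h4 := Ideal.mul_mem_left _ (C (C ((pz p)⁻¹)) ^ 2 ^ i) h3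
  rw [← mul_pow, ← C_mul, ← C_mul, inv_mul_cancel₀ h0] at h4
  simpa using h4

lemma CoLE_pz {K : Ideal k[X][X]} {i : ℕ} (hx : (C X) ^ 2 ^ i ∈ K) (hy : X ^ 2 ^ i ∈ K) {p : k[X][X]}
    (hp : p ∈ K) (h0 : pz p ≠ 0) (n : ℕ) : CoLE k K n := by
  rw [(Ideal.eq_top_iff_one K).2 (one_mem_of_pz hx hy hp h0)]
  exact CoLE_top.mono le_rfl (Nat.zero_le _)

lemma ord_dvd {R : Type*} [CommRing R] [Algebra k R] {r : ℕ} {p : k[X][X]} (h : X ^ r ∣ th 1 1 p) {a b z : R}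
    (ha : z ∣ a) (hb : z ∣ b) : z ^ r ∣ ev a b p := by
  rw [ev_eq]
  refine Finset.dvd_sum fun j _ => ?_
  rw [aeval_eq_sum_range, Finset.sum_mul]
  refine Finset.dvd_sum fun i _ => ?_
  by_cases hc : (p.coeff j).coeff i = 0
  · rw [hc]; simp
  have h1 : r ≤ i + j := by
    by_contra hlt
    push Not at hlt
    obtain ⟨g, hg⟩ := h
    have h2 := th_coeff_ij 1 1 one_pos p i j
    rw [one_mul, one_mul, hg, coeff_X_pow_mul', if_neg (by omega), coeff_zero] at h2
    exact hc h2.symm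
  rw [smul_mul_assoc]
  apply dvd_smul_of_dvd
  exact (pow_dvd_pow z h1).trans (by rw [pow_add]; exact mul_dvd_mul (pow_dvd_pow_of_dvd ha i) (pow_dvd_pow_of_dvd hb j))

lemma mem_of_order {K : Ideal k[X][X]} {q : ℕ} (hx : (C X) ^ q ∈ K) (hy : X ^ q ∈ K) {p : k[X][X]}
    (h : X ^ (2 * q) ∣ th 1 1 p) : p ∈ K := by
  have h0 : p = ∑ j ∈ Finset.range (p.natDegree + 1), C (p.coeff j) * X ^ j := p.as_sum_range_C_mul_X_pow
  rw [h0]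
  refine Ideal.sum_mem _ fun j _ => ?_
  rw [(p.coeff j).as_sum_range_C_mul_X_pow, map_sum, Finset.sum_mul]
  refine Ideal.sum_mem _ fun i _ => ?_
  by_cases hc : (p.coeff j).coeff i = 0
  · rw [hc]; simp
  have h1 : 2 * q ≤ i + j := by
    by_contra hlt
    push Not at hlt
    obtain ⟨g, hg⟩ := h
    have h2 := th_coeff_ij 1 1 one_pos p i j
    rw [one_mul, one_mul, hg, coeff_X_pow_mul', if_neg (by omega), coeff_zero] at h2
    exact hc h2.symm
  rw [C_mul, C_pow]
  rcases le_or_gt q i with h2 | h2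
  · apply Ideal.mul_mem_right
    apply Ideal.mul_mem_left
    exact Ideal.mem_of_dvd _ (pow_dvd_pow _ h2) hx
  · apply Ideal.mul_mem_left
    exact Ideal.mem_of_dvd _ (pow_dvd_pow _ (by omega : q ≤ j)) hy

lemma mul3_trailing {D : Type*} [CommRing D] [IsDomain D] {p1 p2 p3 G : D[X]} {r : ℕ}
    (h : p1 * p2 * p3 = X ^ r * G) (hG : G.coeff 0 ≠ 0) : p1 ≠ 0 ∧ p2 ≠ 0 ∧ p3 ≠ 0 ∧
    p1.natTrailingDegree + p2.natTrailingDegree + p3.natTrailingDegree = r ∧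
    p1.trailingCoeff * p2.trailingCoeff * p3.trailingCoeff = G.coeff 0 := by
  have hG0 : G ≠ 0 := by rintro rfl; simp at hG
  have hne : p1 * p2 * p3 ≠ 0 := by rw [h]; exact mul_ne_zero (pow_ne_zero _ X_ne_zero) hG0
  have h3 := right_ne_zero_of_mul hne
  have h12 := left_ne_zero_of_mul hne
  have h1 := left_ne_zero_of_mul h12
  have h2 := right_ne_zero_of_mul h12
  have hGt : G.natTrailingDegree = 0 := by
    by_contra hc
    exact hG (coeff_eq_zero_of_lt_natTrailingDegree (Nat.pos_of_ne_zero hc))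
  refine ⟨h1, h2, h3, ?_, ?_⟩
  · have := congrArg natTrailingDegree h
    rw [natTrailingDegree_mul h12 h3, natTrailingDegree_mul h1 h2, mul_comm (X ^ r), natTrailingDegree_mul_X_pow hG0, hGt] at this
    omega
  · have := congrArg trailingCoeff h
    rw [trailingCoeff_mul, trailingCoeff_mul, trailingCoeff_mul] at this
    rw [this]
    have e : (X ^ r : D[X]).trailingCoeff = 1 := by
      rw [trailingCoeff, natTrailingDegree_X_pow, coeff_X_pow_self]
    rw [e, one_mul, trailingCoeff, hGt]

/-- linear substitution -/
noncomputable def lin (A B u v : k) : k[X][X] →ₐ[k] k[X][X] :=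
  ev (C (C B) * C X + C (C u) * X) (C (C A) * C X + C (C v) * X)

/-- the standard local expansion -/
def Loc (q : ℕ) (A B ca cb ce : k) (f : k[X][X]) : Prop :=
  ∃ R1 R2 R3 : k[X][X], f = (C (C A) * C X + C (C B) * X) ^ q +
    (C (C ca) * C X ^ (q + 1) + C (C cb) * X ^ (q + 1) + C (C ce) * (C X + X) ^ (q + 1)) +
    C X ^ (2 * q) * R1 + X ^ (2 * q) * R2 + (C X + X) ^ (2 * q) * R3

lemma th_CX (w1 w2 : ℕ) : th w1 w2 (C X : k[X][X]) = X ^ w1 := by simp [th]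
lemma th_X (w1 w2 : ℕ) : th w1 w2 (X : k[X][X]) = C X * X ^ w2 := by simp [th]

lemma psi_f {i : ℕ} {A B ca cb ce : k} {f : k[X][X]} (h : Loc (2 ^ i) A B ca cb ce f) {u v : k}
    (huv : A * u + B * v = 1) (w : ℕ) : ∃ S S' : k[X][X], th w (w + 1) (lin A B u v f) =
      C X ^ 2 ^ i * X ^ ((w + 1) * 2 ^ i) + X ^ (w * (2 ^ i + 1)) * (
      C (C (ca * B ^ (2 ^ i + 1) + cb * A ^ (2 ^ i + 1) + ce * (A + B) ^ (2 ^ i + 1))) +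
      C (C (ca * B ^ 2 ^ i * u + cb * A ^ 2 ^ i * v + ce * (A + B) ^ 2 ^ i * (u + v))) * (C X * X) + X ^ 2 ^ i * S)
      + X ^ (w * (2 * 2 ^ i)) * S' := by
  have : Fact (Nat.Prime 2) := ⟨Nat.prime_two⟩
  have : ExpChar k[X][X] 2 := ExpChar.prime Nat.prime_two
  obtain ⟨R1, R2, R3, rfl⟩ := h
  set q := 2 ^ i with hq
  set x1 : k[X][X] := C (C B) + C (C u) * (C X * X) with hx1
  set y1 : k[X][X] := C (C A) + C (C v) * (C X * X) with hy1
  have ex : th w (w + 1) (lin A B u v (C X)) = X ^ w * x1 := by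
    simp only [lin, ev_CX, map_add, map_mul, ev_CC', alg_A, th_CX, th_X, hx1]; ring
  have ey : th w (w + 1) (lin A B u v X) = X ^ w * y1 := by
    simp only [lin, ev_X, map_add, map_mul, ev_CC', alg_A, th_CX, th_X, hy1]; ring
  simp only [map_add, map_mul, map_pow, ev_CC', alg_A, ex, ey]
  have huv' : (C (C A) * C (C u) + C (C B) * C (C v) : k[X][X]) = 1 := by
    rw [← C_mul, ← C_mul, ← C_mul, ← C_mul, ← C_add, ← C_add, huv]; simp
  have e0 : C (C A) * (X ^ w * x1) + C (C B) * (X ^ w * y1) = X ^ w * (C X * X) := by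
    rw [hx1, hy1]
    linear_combination X ^ w * (C X * X) * huv' + X ^ w * (C (C A) * C (C B)) * two_A (k := k)
  rw [e0]
  have e1 : ∀ a b : k, (C (C a) + C (C b) * (C X * X) : k[X][X]) ^ (q + 1) =
      (C (C a) ^ q + C (C b) ^ q * (C X * X) ^ q) * (C (C a) + C (C b) * (C X * X)) := by
    intro a b; rw [pow_succ, hq, add_pow_char_pow, mul_pow]
  have e2 : X ^ w * x1 + X ^ w * y1 = X ^ w * (C (C (B + A)) + C (C (u + v)) * (C X * X)) := by
    rw [hx1, hy1]; simp; ring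
  rw [e2, mul_pow (X ^ w) x1, mul_pow (X ^ w) y1, mul_pow (X ^ w) (C (C (B + A)) + _), hx1, hy1, e1, e1, e1, ← hx1, ← hy1]
  refine ⟨C X ^ q * (C (C ca) * C (C u) ^ q * x1 + C (C cb) * C (C v) ^ q * y1 + C (C ce) * C (C (u + v)) ^ q * (C (C (B + A)) + C (C (u + v)) * (C X * X))),
    x1 ^ (2 * q) * th w (w + 1) (lin A B u v R1) + y1 ^ (2 * q) * th w (w + 1) (lin A B u v R2) +
     (C (C (B + A)) + C (C (u + v)) * (C X * X)) ^ (2 * q) * th w (w + 1) (lin A B u v R3), ?_⟩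
  rw [mul_pow (X ^ w) x1, mul_pow (X ^ w) y1, mul_pow (X ^ w) (C (C (B + A)) + _), hx1, hy1]
  simp only [C_add, C_mul, C_pow]
  ring

end
end ExcAPN

namespace ExcAPN
open Polynomial
section
variable {k : Type*} [Field k] [CharP k 2]

lemma psi_pz (A B u v : k) (w : ℕ) (hw : 0 < w) (p : k[X][X]) :
    (th w (w + 1) (lin A B u v p)).coeff 0 = C (pz p) := by
  rw [coeff_zero_eq_eval_zero]
  obtain ⟨g, h, hgh⟩ := pz_decomp p
  conv_lhs => rw [hgh]
  have ex : eval 0 (th w (w + 1) (lin A B u v (C X))) = 0 := by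
    simp [lin, ev_CX, map_add, map_mul, ev_CC', alg_A, th_CX, th_X, hw.ne']
  have ey : eval 0 (th w (w + 1) (lin A B u v X)) = 0 := by
    simp [lin, ev_X, map_add, map_mul, ev_CC', alg_A, th_CX, th_X, hw.ne']
  rw [map_add, map_add, map_mul, map_mul, map_add, map_add, map_mul, map_mul, eval_add, eval_add, eval_mul, eval_mul, ex, ey]
  simp [ev_CC', alg_A]

/-- data of a factor in weighted coordinates -/
lemma factor_data (A B u v : k) {w : ℕ} (hw : 0 < w) {p : k[X][X]} (h0 : th w (w + 1) (lin A B u v p) ≠ 0) :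
    ((th w (w + 1) (lin A B u v p)).natTrailingDegree = 0 → pz p ≠ 0) ∧
    (∀ j, (th w (w + 1) (lin A B u v p)).trailingCoeff.coeff j ≠ 0 →
      ∃ i, (th w (w + 1) (lin A B u v p)).natTrailingDegree = w * i + (w + 1) * j) ∧
    (th w (w + 1) (lin A B u v p)).trailingCoeff ≠ 0 := by
  refine ⟨?_, ?_, trailingCoeff_nonzero_iff_nonzero.2 h0⟩
  · intro h hz
    have := psi_pz A B u v w hw p
    rw [hz, C_0] at this
    have h1 := trailingCoeff_nonzero_iff_nonzero.2 h0
    rw [trailingCoeff, h, this] at h1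
    exact h1 rfl
  · intro j hj
    obtain ⟨i, h1, _⟩ := th_coeff_ne hw hj
    exact ⟨i, h1⟩

lemma typeI_good {i : ℕ} (hi : 1 ≤ i) {A B ca cb ce : k} {p1 p2 p3 : k[X][X]} (h : Loc (2 ^ i) A B ca cb ce (p1 * p2 * p3))
    (hAB : A ≠ 0 ∨ B ≠ 0) (hc : ca * B ^ (2 ^ i + 1) + cb * A ^ (2 ^ i + 1) + ce * (A + B) ^ (2 ^ i + 1) ≠ 0) :
    pz p1 ≠ 0 ∨ pz p2 ≠ 0 := by
  obtain ⟨u, v, huv⟩ : ∃ u v, A * u + B * v = 1 := by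
    rcases hAB with h | h
    · exact ⟨A⁻¹, 0, by rw [mul_inv_cancel₀ h]; ring⟩
    · exact ⟨0, B⁻¹, by rw [mul_inv_cancel₀ h]; ring⟩
  set q := 2 ^ i with hq
  have hq2 : 2 ≤ q := by rw [hq]; calc 2 = 2 ^ 1 := rfl
                                  _ ≤ 2 ^ i := Nat.pow_le_pow_right (by norm_num) hi
  obtain ⟨S, S', hS⟩ := psi_f h huv q
  rw [← hq] at hS
  set c := ca * B ^ (q + 1) + cb * A ^ (q + 1) + ce * (A + B) ^ (q + 1) with hcdef
  set c' := ca * B ^ q * u + cb * A ^ q * v + ce * (A + B) ^ q * (u + v)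
  have e : q * (2 * q) = (q + 1) * q + (q * q - q - 1) + 1 := by
    have : 2 * q ≤ q * q := Nat.mul_le_mul_right q hq2
    have e1 : q * (2 * q) = 2 * (q * q) := by ring
    have e2 : (q + 1) * q = q * q + q := by ring
    omega
  have hS2 : th q (q + 1) (lin A B u v p1) * th q (q + 1) (lin A B u v p2) * th q (q + 1) (lin A B u v p3) =
      X ^ ((q + 1) * q) * (C X ^ q + (C (C c) + C (C c') * (C X * X) + X ^ q * S) + X * X ^ (q * q - q - 1) * S') := by
    rw [← map_mul, ← map_mul, ← map_mul, ← map_mul, hS, e]; ring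
  have hG : (C X ^ q + (C (C c) + C (C c') * (C X * X) + X ^ q * S) + X * X ^ (q * q - q - 1) * S' : k[X][X]).coeff 0 = X ^ q + C c := by
    rw [coeff_zero_eq_eval_zero]
    simp [show q ≠ 0 by omega]
  have hXc : (X ^ q + C c : k[X]) ≠ 0 := (monic_X_pow_add_C c (by omega)).ne_zero
  obtain ⟨n1, n2, n3, hr, ht⟩ := mul3_trailing hS2 (by rw [hG]; exact hXc)
  rw [hG] at ht
  obtain ⟨a1, b1, c1⟩ := factor_data A B u v (by omega) n1
  obtain ⟨a2, b2, c2⟩ := factor_data A B u v (by omega) n2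
  obtain ⟨a3, b3, c3⟩ := factor_data A B u v (by omega) n3
  set t1 := (th q (q + 1) (lin A B u v p1)).trailingCoeff
  set t2 := (th q (q + 1) (lin A B u v p2)).trailingCoeff
  set t3 := (th q (q + 1) (lin A B u v p3)).trailingCoeff
  set r1 := (th q (q + 1) (lin A B u v p1)).natTrailingDegree
  set r2 := (th q (q + 1) (lin A B u v p2)).natTrailingDegree
  set r3 := (th q (q + 1) (lin A B u v p3)).natTrailingDegree
  have hd := congrArg natDegree ht
  rw [natDegree_mul (mul_ne_zero c1 c2) c3, natDegree_mul c1 c2, natDegree_X_pow_add_C] at hd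
  have h0 : t1.coeff 0 * t2.coeff 0 * t3.coeff 0 ≠ 0 := by
    rw [← mul_coeff_zero, ← mul_coeff_zero, ht]; simpa [show ¬ 0 = q by omega, coeff_X_pow] using hc
  have z3 := right_ne_zero_of_mul h0
  have z2 := right_ne_zero_of_mul (left_ne_zero_of_mul h0)
  have z1 := left_ne_zero_of_mul (left_ne_zero_of_mul h0)
  have key : ∀ (t : k[X]) (r : ℕ), t ≠ 0 → t.coeff 0 ≠ 0 → (∀ j, t.coeff j ≠ 0 → ∃ i, r = q * i + (q + 1) * j) →
      t.natDegree = 0 ∨ (q + 1) * q ≤ r := by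
    intro t r ht0 ht1 hh
    obtain ⟨i0, hi0⟩ := hh 0 ht1
    obtain ⟨i1, hi1⟩ := hh t.natDegree (by rw [coeff_natDegree]; exact leadingCoeff_ne_zero.2 ht0)
    have hdvd : q ∣ t.natDegree := by
      have : q ∣ q * i1 + q * t.natDegree + t.natDegree := ⟨i0, by linarith⟩
      rwa [Nat.dvd_add_right ⟨i1 + t.natDegree, by ring⟩] at this
    rcases Nat.eq_zero_or_pos t.natDegree with h | h
    · exact Or.inl h
    · right
      have := Nat.le_of_dvd h hdvd
      have h2 := Nat.mul_le_mul_left (q + 1) this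
      omega
  have hqq : 0 < (q + 1) * q := by positivity
  rcases key t1 r1 c1 z1 b1 with k1 | k1
  · rcases key t2 r2 c2 z2 b2 with k2 | k2
    · rcases key t3 r3 c3 z3 b3 with k3 | k3
      · omega
      · left; apply a1; omega
    · left; apply a1; omega
  · right; apply a2; omega

lemma typeI_bad {i : ℕ} (hi : 2 ≤ i) {A B ca cb ce : k} {p1 p2 p3 : k[X][X]} (h : Loc (2 ^ i) A B ca cb ce (p1 * p2 * p3))
    {u v : k} (huv : A * u + B * v = 1) (hc : ca * B ^ (2 ^ i + 1) + cb * A ^ (2 ^ i + 1) + ce * (A + B) ^ (2 ^ i + 1) = 0)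
    (hc' : ca * B ^ 2 ^ i * u + cb * A ^ 2 ^ i * v + ce * (A + B) ^ 2 ^ i * (u + v) ≠ 0) :
    pz p1 ≠ 0 ∨ pz p2 ≠ 0 ∨ (pz p3 ≠ 0 ∧ (¬ X ^ 2 ∣ th 1 1 p1 ∨ ¬ X ^ 2 ∣ th 1 1 p2)) := by
  obtain ⟨w, hw⟩ : ∃ w, 2 ^ i = w + 1 := ⟨2 ^ i - 1, by have := Nat.one_le_two_pow (n := i); omega⟩
  have hw3 : 3 ≤ w := by
    have : 2 ^ 2 ≤ 2 ^ i := Nat.pow_le_pow_right (by norm_num) hi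
    omega
  obtain ⟨S, S', hS⟩ := psi_f h huv w
  rw [hc] at hS
  rw [hw] at hS hc'
  set c' := ca * B ^ (w + 1) * u + cb * A ^ (w + 1) * v + ce * (A + B) ^ (w + 1) * (u + v)
  have e : w * (2 * (w + 1)) = (w + 1) * (w + 1) + (w * w - 2) + 1 := by
    have : 3 * 3 ≤ w * w := Nat.mul_le_mul hw3 hw3
    have e1 : w * (2 * (w + 1)) = 2 * (w * w) + 2 * w := by ring
    have e2 : (w + 1) * (w + 1) = w * w + 2 * w + 1 := by ring
    omega
  have hS2 : th w (w + 1) (lin A B u v p1) * th w (w + 1) (lin A B u v p2) * th w (w + 1) (lin A B u v p3) =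
      X ^ ((w + 1) * (w + 1)) * (C X ^ (w + 1) + (C (C c') * C X + X ^ w * S) + X * X ^ (w * w - 2) * S') := by
    rw [← map_mul, ← map_mul, ← map_mul, ← map_mul, hS, e]; simp only [C_0]; ring
  have hG : (C X ^ (w + 1) + (C (C c') * C X + X ^ w * S) + X * X ^ (w * w - 2) * S' : k[X][X]).coeff 0 = X * (X ^ w + C c') := by
    rw [coeff_zero_eq_eval_zero]
    simp [show w ≠ 0 by omega]
    ring
  have hXc : (X ^ w + C c' : k[X]) ≠ 0 := (monic_X_pow_add_C c' (by omega)).ne_zero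
  obtain ⟨n1, n2, n3, hr, ht⟩ := mul3_trailing hS2 (by rw [hG]; exact mul_ne_zero X_ne_zero hXc)
  rw [hG] at ht
  obtain ⟨a1, b1, c1⟩ := factor_data A B u v (by omega) n1
  obtain ⟨a2, b2, c2⟩ := factor_data A B u v (by omega) n2
  obtain ⟨a3, b3, c3⟩ := factor_data A B u v (by omega) n3
  have o : ∀ p, th w (w + 1) (lin A B u v p) ≠ 0 → X ^ 2 ∣ th 1 1 p → 2 * w ≤ (th w (w + 1) (lin A B u v p)).natTrailingDegree := by
    intro p hp hX
    have hcomp : th w (w + 1) (lin A B u v p) = ev (th w (w + 1) (lin A B u v (C X))) (th w (w + 1) (lin A B u v X)) p := by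
      have : (th w (w + 1)).comp (lin A B u v) = ev (th w (w + 1) (lin A B u v (C X))) (th w (w + 1) (lin A B u v X)) := by
        apply ev_ext <;> simp
      exact congrArg (fun φ : k[X][X] →ₐ[k] k[X][X] => φ p) this
    have hd := ord_dvd hX (a := th w (w + 1) (lin A B u v (C X))) (b := th w (w + 1) (lin A B u v X)) (z := X ^ w)
      ⟨C (C B) + C (C u) * (C X * X), by
        simp only [lin, ev_CX, map_add, map_mul, ev_CC', alg_A, th_CX, th_X]; ring⟩
      ⟨C (C A) + C (C v) * (C X * X), by
        simp only [lin, ev_X, map_add, map_mul, ev_CC', alg_A, th_CX, th_X]; ring⟩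
    rw [← hcomp, ← pow_mul] at hd
    by_contra hlt
    push Not at hlt
    obtain ⟨g, hg⟩ := hd
    have h1 := trailingCoeff_nonzero_iff_nonzero.2 hp
    rw [trailingCoeff] at h1
    apply h1
    generalize (th w (w + 1) (lin A B u v p)).natTrailingDegree = r at *
    rw [hg, coeff_X_pow_mul', if_neg (by omega)]
  have o1 := o p1 n1
  have o2 := o p2 n2
  set t1 := (th w (w + 1) (lin A B u v p1)).trailingCoeff
  set t2 := (th w (w + 1) (lin A B u v p2)).trailingCoeff
  set t3 := (th w (w + 1) (lin A B u v p3)).trailingCoeff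
  set r1 := (th w (w + 1) (lin A B u v p1)).natTrailingDegree
  set r2 := (th w (w + 1) (lin A B u v p2)).natTrailingDegree
  set r3 := (th w (w + 1) (lin A B u v p3)).natTrailingDegree
  have hd := congrArg natDegree ht
  rw [natDegree_mul (mul_ne_zero c1 c2) c3, natDegree_mul c1 c2, natDegree_mul X_ne_zero hXc, natDegree_X, natDegree_X_pow_add_C] at hd
  have hd2 := congrArg natTrailingDegree ht
  rw [natTrailingDegree_mul (mul_ne_zero c1 c2) c3, natTrailingDegree_mul c1 c2, natTrailingDegree_mul X_ne_zero hXc, natTrailingDegree_X] at hd2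
  have hz : (X ^ w + C c' : k[X]).natTrailingDegree = 0 := by
    by_contra hcon
    have := coeff_eq_zero_of_lt_natTrailingDegree (Nat.pos_of_ne_zero hcon)
    simp [coeff_X_pow, show ¬ 0 = w by omega] at this
    exact hc' this
  rw [hz] at hd2
  have key : ∀ (t : k[X]) (r : ℕ), t ≠ 0 → (∀ j, t.coeff j ≠ 0 → ∃ i, r = w * i + (w + 1) * j) →
      (t.natDegree = t.natTrailingDegree ∨ (w + 1) * w ≤ r) ∧ (r = 0 ∨ w ≤ r) := by
    intro t r ht0 hh
    obtain ⟨i0, hi0⟩ := hh t.natTrailingDegree (trailingCoeff_nonzero_iff_nonzero.2 ht0)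
    obtain ⟨i1, hi1⟩ := hh t.natDegree (by rw [coeff_natDegree]; exact leadingCoeff_ne_zero.2 ht0)
    constructor
    · obtain ⟨δ, hδ⟩ := Nat.exists_eq_add_of_le t.natTrailingDegree_le_natDegree
      have hdvd : w ∣ δ := by
        have : w ∣ w * (i1 + δ) + δ := ⟨i0, by rw [hδ] at hi1; nlinarith⟩
        rwa [Nat.dvd_add_right ⟨i1 + δ, by ring⟩] at this
      rcases Nat.eq_zero_or_pos δ with h | h
      · left; omega
      · right
        have := Nat.le_of_dvd h hdvd
        have h2 := Nat.mul_le_mul_left (w + 1) (show w ≤ t.natDegree by omega)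
        omega
    · rcases Nat.eq_zero_or_pos i0 with h | h
      · rcases Nat.eq_zero_or_pos t.natTrailingDegree with h' | h'
        · left; rw [hi0, h, h']; ring
        · right
          have := Nat.mul_le_mul_left (w + 1) h'
          omega
      · right
        have := Nat.mul_le_mul_left w h
        omega
  obtain ⟨k1, l1⟩ := key t1 r1 c1 b1
  obtain ⟨k2, l2⟩ := key t2 r2 c2 b2
  obtain ⟨k3, l3⟩ := key t3 r3 c3 b3
  have eqq : (w + 1) * (w + 1) = (w + 1) * w + w + 1 := by ring
  by_cases y1 : r1 = 0
  · left; exact a1 y1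
  by_cases y2 : r2 = 0
  · right; left; exact a2 y2
  right; right
  have y3 : r3 = 0 := by omega
  refine ⟨a3 y3, ?_⟩
  by_contra hcon
  push Not at hcon
  have q1 := o1 hcon.1
  have q2 := o2 hcon.2
  omega

end
end ExcAPN

namespace ExcAPN
open Polynomial
section
variable {k : Type*} [Field k] [CharP k 2]

/-- order at the origin -/
noncomputable def od (p : k[X][X]) : ℕ := (th 1 1 p).natTrailingDegree

lemma Tr_od (p : k[X][X]) : Tr (od p) (th 1 1 p).trailingCoeff p := by
  apply Tr.of_dvd
  rw [X_pow_dvd_iff]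
  intro d hd
  exact coeff_eq_zero_of_lt_natTrailingDegree hd

lemma order_one [IsAlgClosed k] {K : Ideal k[X][X]} {i : ℕ} (hx : (C X) ^ 2 ^ i ∈ K) (hy : X ^ 2 ^ i ∈ K) {p : k[X][X]}
    (hp : p ∈ K) (h : ¬ X ^ 2 ∣ th 1 1 p) : CoLE k K (2 ^ i) := by
  by_cases h0 : pz p = 0
  swap
  · exact CoLE_pz hx hy hp h0 _
  have h1 : X ^ 1 ∣ th 1 1 p := by
    obtain ⟨g, h, hgh⟩ := pz_decomp p
    rw [hgh, h0]
    simp only [map_add, map_mul, th_CX, th_X, C_0, map_zero, zero_add, pow_one]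
    exact ⟨th 1 1 g + C X * th 1 1 h, by ring⟩
  have h2 := Tr.of_dvd h1
  set v0 := (th 1 1 p).coeff 1
  have hv0 : v0 ≠ 0 := by
    intro hz
    rw [hz] at h2
    exact h h2.dvd_succ
  have hd := h2.natDegree
  have hM : ∀ p, X ^ (2 * 2 ^ i) ∣ th 1 1 p → p ∈ K := fun p hp => mem_of_order hx hy hp
  have tx : Tr (2 ^ i) (1 : k[X]) ((C X : k[X][X]) ^ 2 ^ i) := ⟨1, by simp [th_CX], by simp⟩
  have ty : Tr (2 ^ i) (X ^ 2 ^ i : k[X]) ((X : k[X][X]) ^ 2 ^ i) := ⟨C X ^ 2 ^ i, by rw [map_pow, th_X, pow_one, mul_pow, mul_comm], by rw [← C_pow, coeff_C_zero]⟩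
  rcases Nat.lt_or_ge v0.natDegree 1 with h3 | h3
  · have := local_bound ty h2 (pow_ne_zero _ X_ne_zero) (natDegree_X_pow _) (fun ρ _ => by
      rw [eq_C_of_natDegree_eq_zero (by omega : v0.natDegree = 0)] at hv0 ⊢
      simpa using hv0) hy hp hM
    rwa [mul_one] at this
  · have := local_bound h2 tx hv0 (by omega) (fun ρ _ => by simp) hp hx hM
    rwa [one_mul] at this

lemma Loc_Tr {q : ℕ} (hq : 2 ≤ q) {ca cb ce : k} {f : k[X][X]} (h : Loc q 0 0 ca cb ce f) :
    Tr (q + 1) (C ca + C cb * X ^ (q + 1) + C ce * (1 + X) ^ (q + 1)) f := by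
  obtain ⟨R1, R2, R3, rfl⟩ := h
  obtain ⟨s, rfl⟩ := Nat.exists_eq_add_of_le hq
  refine ⟨C (C ca + C cb * X ^ (2 + s + 1) + C ce * (1 + X) ^ (2 + s + 1)) + X * X ^ s * (th 1 1 R1 + C X ^ (2 * (2 + s)) * th 1 1 R2 +
    (1 + C X) ^ (2 * (2 + s)) * th 1 1 R3), ?_, ?_⟩
  · simp only [map_add, map_mul, map_pow, ev_CC', alg_A, th_CX, th_X, pow_one, C_0, zero_mul, add_zero, map_zero, map_one]
    rw [show (X + C X * X : k[X][X]) = X * (1 + C X) by ring, mul_pow X (1 + C X), mul_pow X (1 + C X), zero_pow (by omega)]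
    ring
  · simp only [coeff_add, mul_assoc, coeff_X_mul_zero, coeff_C_zero, add_zero]

lemma typeII [IsAlgClosed k] {i : ℕ} (hi : 1 ≤ i) {ca cb ce : k} {p1 p2 p3 : k[X][X]} (h : Loc (2 ^ i) 0 0 ca cb ce (p1 * p2 * p3))
    {φ : k[X]} (hφ : φ = C ca + C cb * X ^ (2 ^ i + 1) + C ce * (1 + X) ^ (2 ^ i + 1)) (hd : 2 ^ i ≤ φ.natDegree)
    (hs : ∀ ρ, φ.eval ρ = 0 → (derivative φ).eval ρ ≠ 0) {K : Ideal k[X][X]} (h1 : p1 ∈ K) (h2 : p2 ∈ K)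
    (hx : (C X) ^ 2 ^ i ∈ K) (hy : X ^ 2 ^ i ∈ K) :
    od p1 + od p2 + od p3 = 2 ^ i + 1 ∧ CoLE k K (od p1 * od p2) := by
  have hq2 : 2 ≤ 2 ^ i := by calc 2 = 2 ^ 1 := rfl
                                  _ ≤ 2 ^ i := Nat.pow_le_pow_right (by norm_num) hi
  have hφ0 : φ ≠ 0 := by
    rintro rfl
    simp at hd
  obtain ⟨G, hG, hG0⟩ := Loc_Tr hq2 h
  rw [← hφ] at hG0
  rw [map_mul, map_mul] at hG
  obtain ⟨n1, n2, n3, hr, ht⟩ := mul3_trailing hG (by rw [hG0]; exact hφ0)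
  rw [hG0] at ht
  refine ⟨hr, ?_⟩
  have t1 := Tr_od p1
  have t2 := Tr_od p2
  have t3 := Tr_od p3
  set a1 := (th 1 1 p1).trailingCoeff
  set a2 := (th 1 1 p2).trailingCoeff
  set a3 := (th 1 1 p3).trailingCoeff
  have hne : a1 * a2 * a3 ≠ 0 := by rw [ht]; exact hφ0
  have z3 := right_ne_zero_of_mul hne
  have z2 := right_ne_zero_of_mul (left_ne_zero_of_mul hne)
  have z1 := left_ne_zero_of_mul (left_ne_zero_of_mul hne)
  have hdd := congrArg natDegree ht
  rw [natDegree_mul (mul_ne_zero z1 z2) z3, natDegree_mul z1 z2] at hdd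
  have d1 := t1.natDegree
  have d2 := t2.natDegree
  have d3 := t3.natDegree
  have hM : ∀ p, X ^ (2 * 2 ^ i) ∣ th 1 1 p → p ∈ K := fun p hp => mem_of_order hx hy hp
  have hcop : ∀ ρ, a1.eval ρ = 0 → a2.eval ρ ≠ 0 := by
    intro ρ e1 e2
    apply hs ρ
    · rw [← ht]; simp [e1]
    · rw [← ht]; simp [e1, e2, derivative_mul]
  have hr' : od p1 + od p2 + od p3 = 2 ^ i + 1 := hr
  rcases Nat.lt_or_ge a1.natDegree (od p1) with h3 | h3
  · have := local_bound t2 t1 z2 (by omega) (fun ρ e2 e1 => hcop ρ e1 e2) h2 h1 hM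
    rwa [mul_comm] at this
  · exact local_bound t1 t2 z1 (by omega) hcop h1 h2 hM

/-- expansion of powers -/
lemma pow_exp {i ℓ : ℕ} (hℓ : Odd ℓ) {a : k} (ha : a ^ ℓ = 1) (z : k[X][X]) : ∃ R,
    (z + C (C (a ^ 2 ^ i))) ^ (2 ^ i * ℓ + 1) = z + C (C (a ^ 2 ^ i)) + C (C (a * a⁻¹ ^ 2 ^ i)) ^ 2 ^ i * z ^ 2 ^ i
      + C (C ((a⁻¹ ^ 2 ^ i) ^ 2 ^ i)) * z ^ (2 ^ i + 1) + z ^ (2 * 2 ^ i) * R := by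
  have : Fact (Nat.Prime 2) := ⟨Nat.prime_two⟩
  have : ExpChar k[X][X] 2 := ExpChar.prime Nat.prime_two
  have ha0 : a ≠ 0 := by
    rintro rfl
    rw [zero_pow hℓ.pos.ne'] at ha
    exact zero_ne_one ha
  set q := 2 ^ i with hq
  obtain ⟨R, hR⟩ := Polynomial.powAddExpansion ((C (C (a ^ q)) : k[X][X]) ^ q) (z ^ q) ℓ
  have hc : ((C (C (a ^ q)) : k[X][X]) ^ q) ^ ℓ = 1 := by
    rw [← C_pow, ← C_pow, ← C_pow, ← C_pow, ← pow_mul, ← pow_mul, show q * (q * ℓ) = ℓ * (q * q) by ring, pow_mul, ha, one_pow]; simp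
  have hc1 : ((C (C (a ^ q)) : k[X][X]) ^ q) ^ (ℓ - 1) = C (C ((a⁻¹ ^ q) ^ q)) := by
    have e1 : ((C (C (a ^ q)) : k[X][X]) ^ q) * C (C ((a⁻¹ ^ q) ^ q)) = 1 := by
      rw [← C_pow, ← C_pow, ← C_mul, ← C_mul, ← mul_pow, ← mul_pow, mul_inv_cancel₀ ha0]; simp
    have e2 : ((C (C (a ^ q)) : k[X][X]) ^ q) ^ (ℓ - 1) * ((C (C (a ^ q)) : k[X][X]) ^ q) = 1 := by
      rw [← pow_succ, Nat.sub_add_cancel hℓ.pos, hc]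
    calc _ = ((C (C (a ^ q)) : k[X][X]) ^ q) ^ (ℓ - 1) * (((C (C (a ^ q)) : k[X][X]) ^ q) * C (C ((a⁻¹ ^ q) ^ q))) := by rw [e1, mul_one]
      _ = _ := by rw [← mul_assoc, e2, one_mul]
  have hℓA : (ℓ : k[X][X]) = 1 := by
    obtain ⟨r, rfl⟩ := hℓ
    push_cast
    linear_combination (r : k[X][X]) * two_A (k := k)
  refine ⟨R * (z + C (C (a ^ q))), ?_⟩
  have e3 : (C (C (a * a⁻¹ ^ q)) : k[X][X]) ^ q = C (C (a ^ q)) * C (C ((a⁻¹ ^ q) ^ q)) := by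
    rw [← C_pow, ← C_pow, mul_pow, C_mul, C_mul]
  rw [pow_succ, pow_mul, hq, add_pow_char_pow, ← hq, add_comm (z ^ q), hR, hc, hc1, hℓA, e3]
  ring

lemma Loc_tr {i ℓ : ℕ} (hℓ : Odd ℓ) {U V : k[X][X]}
    (h : U * V * TT k = (C X) ^ (2 ^ i * ℓ + 1) + X ^ (2 ^ i * ℓ + 1) + 1 + (ww k) ^ (2 ^ i * ℓ + 1))
    {a b e : k} (ha : a ^ ℓ = 1) (hb : b ^ ℓ = 1) (he : e ^ ℓ = 1) (hab : a + b + 1 = e) :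
    Loc (2 ^ i) (a * a⁻¹ ^ 2 ^ i + e * e⁻¹ ^ 2 ^ i) (b * b⁻¹ ^ 2 ^ i + e * e⁻¹ ^ 2 ^ i)
      ((a⁻¹ ^ 2 ^ i) ^ 2 ^ i) ((b⁻¹ ^ 2 ^ i) ^ 2 ^ i) ((e⁻¹ ^ 2 ^ i) ^ 2 ^ i)
      (tr (a ^ 2 ^ i) (b ^ 2 ^ i) U * tr (a ^ 2 ^ i) (b ^ 2 ^ i) V * tr (a ^ 2 ^ i) (b ^ 2 ^ i) (TT k)) := by
  have : Fact (Nat.Prime 2) := ⟨Nat.prime_two⟩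
  have : ExpChar k[X][X] 2 := ExpChar.prime Nat.prime_two
  have : ExpChar k 2 := ExpChar.prime Nat.prime_two
  have h0 : ∀ α β : k, tr α β U * tr α β V * tr α β (TT k) = (C X + C (C α)) ^ (2 ^ i * ℓ + 1) + (X + C (C β)) ^ (2 ^ i * ℓ + 1)
      + 1 + (C X + C (C α) + (X + C (C β)) + 1) ^ (2 ^ i * ℓ + 1) := by
    intro α β
    have h1 := congrArg (tr α β) h
    simpa only [map_mul, map_add, map_pow, map_one, tr_CX, tr_X, ww] using h1
  have h1 := h0 (a ^ 2 ^ i) (b ^ 2 ^ i)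
  have heq : e ^ 2 ^ i = a ^ 2 ^ i + b ^ 2 ^ i + 1 := by
    rw [← hab, add_pow_char_pow, add_pow_char_pow, one_pow]
  obtain ⟨R1, e1⟩ := pow_exp (i := i) hℓ ha (C X)
  obtain ⟨R2, e2⟩ := pow_exp (i := i) hℓ hb X
  obtain ⟨R3, e3⟩ := pow_exp (i := i) hℓ he (C X + X)
  refine ⟨R1, R2, R3, ?_⟩
  rw [h1, show (C X + C (C (a ^ 2 ^ i)) + (X + C (C (b ^ 2 ^ i))) + 1 : k[X][X]) = C X + X + C (C (e ^ 2 ^ i)) by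
    rw [heq]; simp; ring, e1, e2, e3, heq]
  rw [show (C (C (a * a⁻¹ ^ 2 ^ i + e * e⁻¹ ^ 2 ^ i)) * C X + C (C (b * b⁻¹ ^ 2 ^ i + e * e⁻¹ ^ 2 ^ i)) * X : k[X][X]) =
    C (C (a * a⁻¹ ^ 2 ^ i)) * C X + C (C (b * b⁻¹ ^ 2 ^ i)) * X + C (C (e * e⁻¹ ^ 2 ^ i)) * (C X + X) by
      simp only [C_add]; ring, add_pow_char_pow, add_pow_char_pow, add_pow_char_pow, mul_pow (C (C (a * a⁻¹ ^ 2 ^ i))), mul_pow (C (C (b * b⁻¹ ^ 2 ^ i))),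
      mul_pow (C (C (e * e⁻¹ ^ 2 ^ i)))]
  have h2 := two_A (k := k)
  have e4 : C (C (a ^ 2 ^ i + b ^ 2 ^ i + 1)) = (C (C (a ^ 2 ^ i)) + C (C (b ^ 2 ^ i)) + 1 : k[X][X]) := by simp
  rw [e4]
  have hXX : (C X + X : k[X][X]) ^ 2 ^ i = C X ^ 2 ^ i + X ^ 2 ^ i := add_pow_char_pow _ _ _ _
  linear_combination (-C (C (e * e⁻¹ ^ 2 ^ i)) ^ 2 ^ i) * hXX + (C X + X + C (C (a ^ 2 ^ i)) + C (C (b ^ 2 ^ i)) + 1) * h2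

end
end ExcAPN

namespace ExcAPN
open Polynomial
section
variable {k : Type*} [Field k] [CharP k 2]

lemma two_k : (2 : k) = 0 := by simpa using CharP.cast_eq_zero k 2

lemma frob_add (i : ℕ) (a b : k) : (a + b) ^ 2 ^ i = a ^ 2 ^ i + b ^ 2 ^ i := by
  have : Fact (Nat.Prime 2) := ⟨Nat.prime_two⟩
  have : ExpChar k 2 := ExpChar.prime Nat.prime_two
  exact add_pow_char_pow _ _ _ _

lemma frob_inj {i : ℕ} {a b : k} (h : a ^ 2 ^ i = b ^ 2 ^ i) : a = b := by
  have h2 := two_k (k := k)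
  have : (a + b) ^ 2 ^ i = 0 := by rw [frob_add, h]; linear_combination b ^ 2 ^ i * h2
  have := pow_eq_zero_iff (by positivity) |>.1 this
  linear_combination this - b * h2

/-- bracket -/
def br {k : Type*} [Field k] (q : ℕ) (x y : k) : k := x * y ^ q + y * x ^ q

/-- the badness form -/
def Fb {k : Type*} [Field k] (q : ℕ) (a b e : k) : k := a ^ q * br q b e ^ (q + 1) + b ^ q * br q a e ^ (q + 1) + e ^ q * br q a b ^ (q + 1)

lemma br_eq (q : ℕ) {a e : k} (ha : a ≠ 0) (he : e ≠ 0) :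
    (a * a⁻¹ ^ q + e * e⁻¹ ^ q) * (a * e) ^ q = br q a e := by
  have e1 : a⁻¹ ^ q * a ^ q = 1 := by rw [← mul_pow, inv_mul_cancel₀ ha, one_pow]
  have e2 : e⁻¹ ^ q * e ^ q = 1 := by rw [← mul_pow, inv_mul_cancel₀ he, one_pow]
  rw [br, mul_pow]
  linear_combination a * e ^ q * e1 + e * a ^ q * e2

lemma term_eq (q : ℕ) {a b e : k} (ha : a ≠ 0) {B : k} {y : k} (h : B * (b * e) ^ q = y) :
    (a⁻¹ ^ q) ^ q * B ^ (q + 1) * (a * b * e) ^ (q * q + q) = a ^ q * y ^ (q + 1) := by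
  have e1 : (a⁻¹ ^ q) ^ q * a ^ (q * q) = 1 := by
    rw [← pow_mul, ← mul_pow, inv_mul_cancel₀ ha, one_pow]
  rw [← h, mul_pow B, ← pow_mul (b * e), mul_assoc a, mul_pow a, pow_add a]
  rw [show q * (q + 1) = q * q + q by ring]
  linear_combination B ^ (q + 1) * a ^ q * (b * e) ^ (q * q + q) * e1

lemma scal_F (q : ℕ) {a b e : k} (ha : a ≠ 0) (hb : b ≠ 0) (he : e ≠ 0) :
    ((a⁻¹ ^ q) ^ q * (b * b⁻¹ ^ q + e * e⁻¹ ^ q) ^ (q + 1) + (b⁻¹ ^ q) ^ q * (a * a⁻¹ ^ q + e * e⁻¹ ^ q) ^ (q + 1)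
      + (e⁻¹ ^ q) ^ q * (a * a⁻¹ ^ q + e * e⁻¹ ^ q + (b * b⁻¹ ^ q + e * e⁻¹ ^ q)) ^ (q + 1)) * (a * b * e) ^ (q * q + q)
      = Fb q a b e := by
  have h2 := two_k (k := k)
  have t1 := term_eq q ha (br_eq q hb he)
  have t2 := term_eq q hb (br_eq q ha he)
  have t3 := term_eq q he (br_eq q ha hb)
  rw [show a * a⁻¹ ^ q + e * e⁻¹ ^ q + (b * b⁻¹ ^ q + e * e⁻¹ ^ q) = a * a⁻¹ ^ q + b * b⁻¹ ^ q by
    linear_combination e * e⁻¹ ^ q * h2, Fb, ← t1, ← t2, ← t3]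
  ring

lemma AB_zero {i : ℕ} {a b e : k} (ha : a ≠ 0) (hb : b ≠ 0) (he : e ≠ 0) (hab : a + b + 1 = e)
    (hA : a * a⁻¹ ^ 2 ^ i + e * e⁻¹ ^ 2 ^ i = 0) (hB : b * b⁻¹ ^ 2 ^ i + e * e⁻¹ ^ 2 ^ i = 0) :
    a ^ 2 ^ i = a ∧ b ^ 2 ^ i = b ∧ e ^ 2 ^ i = e := by
  have h2 := two_k (k := k)
  have h1 := br_eq (2 ^ i) ha he
  have h3 := br_eq (2 ^ i) hb he
  rw [hA, zero_mul, br] at h1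
  rw [hB, zero_mul, br] at h3
  have hq : e ^ 2 ^ i = a ^ 2 ^ i + b ^ 2 ^ i + 1 := by rw [← hab, frob_add, frob_add, one_pow]
  have h4 : e ^ 2 ^ i = e := by
    linear_combination h1 + h3 + e ^ 2 ^ i * hab - e * hq + (e * e ^ 2 ^ i - e) * h2
  rw [h4] at h1 h3
  refine ⟨mul_left_cancel₀ he ?_, mul_left_cancel₀ he ?_, h4⟩
  · linear_combination -h1 - a * e * h2
  · linear_combination -h3 - b * e * h2

lemma AB_zero' {q : ℕ} {a e : k} (ha : a ≠ 0) (he : e ≠ 0) (h1 : a ^ q = a) (h3 : e ^ q = e) :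
    a * a⁻¹ ^ q + e * e⁻¹ ^ q = 0 := by
  have h2 := two_k (k := k)
  rw [inv_pow, inv_pow, h1, h3, mul_inv_cancel₀ ha, mul_inv_cancel₀ he]
  linear_combination h2

lemma c'_ne {i : ℕ} {a b e A B u v : k} (ha : a ≠ 0) (hb : b ≠ 0) (he : e ≠ 0) (hab : a + b + 1 = e)
    (huv : A * u + B * v = 1)
    (hc : (a⁻¹ ^ 2 ^ i) ^ 2 ^ i * B ^ (2 ^ i + 1) + (b⁻¹ ^ 2 ^ i) ^ 2 ^ i * A ^ (2 ^ i + 1) + (e⁻¹ ^ 2 ^ i) ^ 2 ^ i * (A + B) ^ (2 ^ i + 1) = 0) :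
    (a⁻¹ ^ 2 ^ i) ^ 2 ^ i * B ^ 2 ^ i * u + (b⁻¹ ^ 2 ^ i) ^ 2 ^ i * A ^ 2 ^ i * v + (e⁻¹ ^ 2 ^ i) ^ 2 ^ i * (A + B) ^ 2 ^ i * (u + v) ≠ 0 := by
  intro hc'
  have h2 := two_k (k := k)
  set q := 2 ^ i with hq
  set ca := (a⁻¹ ^ q) ^ q with hca
  set cb := (b⁻¹ ^ q) ^ q with hcb
  set ce := (e⁻¹ ^ q) ^ q with hce
  have key : ∀ {s t S T : k}, s ≠ 0 → t ≠ 0 → (s⁻¹ ^ q) ^ q * S ^ q = (t⁻¹ ^ q) ^ q * T ^ q → t ^ q * S = s ^ q * T := by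
    intro s t S T hs ht h
    rw [← mul_pow, ← mul_pow] at h
    have h' := frob_inj h
    have e1 : s⁻¹ ^ q * s ^ q = 1 := by rw [← mul_pow, inv_mul_cancel₀ hs, one_pow]
    have e3 : t⁻¹ ^ q * t ^ q = 1 := by rw [← mul_pow, inv_mul_cancel₀ ht, one_pow]
    linear_combination s ^ q * t ^ q * h' - t ^ q * S * e1 + s ^ q * T * e3
  rw [pow_succ, pow_succ, pow_succ] at hc
  have e1 : ca * B ^ q = ce * (A + B) ^ q := by
    linear_combination -(ca * B ^ q + ce * (A + B) ^ q) * huv + v * hc + A * hc' - ((cb * A ^ q + ce * (A + B) ^ q) * A * v + ce * (A + B) ^ q) * h2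
  have e2 : cb * A ^ q = ce * (A + B) ^ q := by
    linear_combination -(cb * A ^ q + ce * (A + B) ^ q) * huv + u * hc + B * hc' - ((ca * B ^ q + ce * (A + B) ^ q) * B * u + ce * (A + B) ^ q) * h2
  have f1 := key ha he e1
  have f2 := key hb he e2
  have hq' : e ^ q = a ^ q + b ^ q + 1 := by rw [← hab, frob_add, frob_add, one_pow]
  have hs : A + B = 0 := by
    linear_combination -(A + B) * hq' + f1 + f2
  have hA : A = 0 := by
    rw [hs, mul_zero] at f2
    exact (mul_eq_zero.1 f2).resolve_left (pow_ne_zero _ he)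
  have hB : B = 0 := by rwa [hA, zero_add] at hs
  rw [hA, hB] at huv
  simp at huv

end
end ExcAPN

namespace ExcAPN
open Polynomial
section
variable {k : Type*} [Field k] [CharP k 2]

lemma pz_tr_TT (α β : k) : pz (tr α β (TT k)) = (α + β) * (α + 1) * (β + 1) := by
  have h : ∀ p, pz (tr α β p) = ev α β p := by
    intro p
    have : ((pz (k := k)).comp (tr α β) : k[X][X] →ₐ[k] k) = ev α β := by
      apply ev_ext <;> simp [pz, tr]
    exact DFunLike.congr_fun this p
  rw [h, TT]
  simp

lemma TT_ne : (TT k : k[X][X]) ≠ 0 := by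
  rw [TT]
  refine mul_ne_zero (mul_ne_zero ?_ ?_) ?_
  · rw [add_comm]; exact X_add_C_ne_zero _
  · rw [show (C X + 1 : k[X][X]) = C (X + C 1) by simp]; exact C_ne_zero.2 (X_add_C_ne_zero _)
  · exact X_add_C_ne_zero (1 : k[X])

lemma tr_ne {α β : k} {p : k[X][X]} (hp : p ≠ 0) : tr α β p ≠ 0 := by
  intro h
  apply hp
  rw [← tr_tr α β p, h, map_zero]

lemma od_pos {p : k[X][X]} (hp : p ≠ 0) (h : pz p = 0) : 1 ≤ od p := by
  rw [od, Nat.one_le_iff_ne_zero]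
  intro h0
  have h1 : X ∣ th 1 1 p := by
    obtain ⟨g, h', hgh⟩ := pz_decomp p
    rw [hgh, h]
    simp only [map_add, map_mul, th_CX, th_X, map_zero, zero_add, pow_one]
    exact dvd_add (Dvd.intro _ rfl) ⟨C X * th 1 1 h', by ring⟩
  have h2 : th 1 1 p ≠ 0 := fun h => hp (th_injective 1 1 one_pos (by rw [h, map_zero]))
  rcases natTrailingDegree_eq_zero.1 h0 with h3 | h3
  · exact h2 h3
  · exact h3 (X_dvd_iff.1 h1)

lemma Loc_Tr' {q : ℕ} (hq : 2 ≤ q) {A B ca cb ce : k} {f : k[X][X]} (h : Loc q A B ca cb ce f) :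
    Tr q ((C A + C B * X) ^ q) f := by
  obtain ⟨R1, R2, R3, rfl⟩ := h
  obtain ⟨s, rfl⟩ := Nat.exists_eq_add_of_le hq
  refine ⟨C ((C A + C B * X) ^ (2 + s)) + X * (C (C ca) + C (C cb) * C X ^ (2 + s + 1) + C (C ce) * (1 + C X) ^ (2 + s + 1))
    + X ^ 2 * X ^ s * (th 1 1 R1 + C X ^ (2 * (2 + s)) * th 1 1 R2 +
    (1 + C X) ^ (2 * (2 + s)) * th 1 1 R3), ?_, ?_⟩
  · simp only [map_add, map_mul, map_pow, ev_CC', alg_A, th_CX, th_X, pow_one]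
    rw [show (X + C X * X : k[X][X]) = X * (1 + C X) by ring, mul_pow X (1 + C X), mul_pow X (1 + C X),
      show (C (C A) * X + C (C B) * (C X * X) : k[X][X]) = X * (C (C A) + C (C B) * C X) by ring, mul_pow X (C (C A) + C (C B) * C X)]
    ring
  · rw [coeff_add, coeff_add, coeff_C_zero]
    simp [mul_coeff_zero]

lemma type_one {q : ℕ} (hq : q = 2) {A B ca cb ce : k} {p1 p2 p3 : k[X][X]} (h : Loc q A B ca cb ce (p1 * p2 * p3))
    (hAB : A ≠ 0 ∨ B ≠ 0) (h3 : pz p3 = 0) : pz p1 ≠ 0 ∨ pz p2 ≠ 0 := by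
  obtain ⟨G, hG, hG0⟩ := Loc_Tr' (by omega) h
  rw [map_mul, map_mul] at hG
  have hne : (C A + C B * X : k[X]) ≠ 0 := by
    intro h0
    have c0 := congrArg (fun p => coeff p 0) h0
    have c1 := congrArg (fun p => coeff p 1) h0
    simp at c0 c1
    rcases hAB with h | h
    · exact h c0
    · exact h c1
  obtain ⟨n1, n2, n3, hr, ht⟩ := mul3_trailing hG (by rw [hG0]; exact pow_ne_zero _ hne)
  have hz : ∀ p : k[X][X], th 1 1 p ≠ 0 → p ≠ 0 := by
    rintro p hp rfl
    exact hp (map_zero _)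
  by_contra hcon
  push Not at hcon
  have := od_pos (hz _ n1) hcon.1
  have := od_pos (hz _ n2) hcon.2
  have := od_pos (hz _ n3) h3
  simp only [od] at *
  omega

lemma ne_of_pow {ℓ : ℕ} (hℓ : Odd ℓ) {a : k} (ha : a ^ ℓ = 1) : a ≠ 0 := by
  rintro rfl
  rw [zero_pow hℓ.pos.ne'] at ha
  exact zero_ne_one ha

lemma pzT {i : ℕ} {a b : k} : pz (tr (a ^ 2 ^ i) (b ^ 2 ^ i) (TT k)) ≠ 0 ↔ a ≠ b ∧ a ≠ 1 ∧ b ≠ 1 := by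
  have h2 := two_k (k := k)
  have key : ∀ x y : k, x + y = 0 ↔ x = y := fun x y =>
    ⟨fun h => by linear_combination h - y * h2, fun h => by linear_combination h + y * h2⟩
  have hf : ∀ x y : k, x ^ 2 ^ i = y ^ 2 ^ i ↔ x = y := fun x y => ⟨frob_inj, fun h => by rw [h]⟩
  have hf1 : ∀ x : k, x ^ 2 ^ i = 1 ↔ x = 1 := fun x => by rw [← hf x 1, one_pow]
  rw [pz_tr_TT, Ne, mul_eq_zero, mul_eq_zero, key, key, key, hf, hf1, hf1]
  tauto

variable [IsAlgClosed k] {i ℓ : ℕ} {U V : k[X][X]} {a b e : k}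

lemma bound_I_good (hi : 2 ≤ i) (hℓ : Odd ℓ)
    (h : U * V * TT k = (C X) ^ (2 ^ i * ℓ + 1) + X ^ (2 ^ i * ℓ + 1) + 1 + (ww k) ^ (2 ^ i * ℓ + 1))
    (ha : a ^ ℓ = 1) (hb : b ^ ℓ = 1) (he : e ^ ℓ = 1) (hab : a + b + 1 = e)
    (hII : ¬ (a ^ 2 ^ i = a ∧ b ^ 2 ^ i = b)) :
    CoLE k (Ideal.span {tr (a ^ 2 ^ i) (b ^ 2 ^ i) U, tr (a ^ 2 ^ i) (b ^ 2 ^ i) V, (C X) ^ 2 ^ i, X ^ 2 ^ i}) (2 ^ i) ∧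
    (¬ (a ≠ b ∧ a ≠ 1 ∧ b ≠ 1 ∧ Fb (2 ^ i) a b e = 0) →
    CoLE k (Ideal.span {tr (a ^ 2 ^ i) (b ^ 2 ^ i) U, tr (a ^ 2 ^ i) (b ^ 2 ^ i) V, (C X) ^ 2 ^ i, X ^ 2 ^ i}) 0) := by
  have ha0 := ne_of_pow hℓ ha
  have hb0 := ne_of_pow hℓ hb
  have he0 := ne_of_pow hℓ he
  have hL := Loc_tr hℓ h ha hb he hab
  have hF := scal_F (2 ^ i) ha0 hb0 he0
  have hAB : (a * a⁻¹ ^ 2 ^ i + e * e⁻¹ ^ 2 ^ i) ≠ 0 ∨ (b * b⁻¹ ^ 2 ^ i + e * e⁻¹ ^ 2 ^ i) ≠ 0 := by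
    by_contra hcon
    push Not at hcon
    have := AB_zero ha0 hb0 he0 hab hcon.1 hcon.2
    exact hII ⟨this.1, this.2.1⟩
  have hc'0 := fun u v huv => c'_ne (i := i) (A := a * a⁻¹ ^ 2 ^ i + e * e⁻¹ ^ 2 ^ i) (B := b * b⁻¹ ^ 2 ^ i + e * e⁻¹ ^ 2 ^ i)
    (u := u) (v := v) ha0 hb0 he0 hab huv
  have hT := pzT (i := i) (a := a) (b := b)
  set A := a * a⁻¹ ^ 2 ^ i + e * e⁻¹ ^ 2 ^ i
  set B := b * b⁻¹ ^ 2 ^ i + e * e⁻¹ ^ 2 ^ i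
  obtain ⟨u, v, huv⟩ : ∃ u v, A * u + B * v = 1 := by
    rcases hAB with h | h
    · exact ⟨A⁻¹, 0, by rw [mul_inv_cancel₀ h]; ring⟩
    · exact ⟨0, B⁻¹, by rw [mul_inv_cancel₀ h]; ring⟩
  set p1 := tr (a ^ 2 ^ i) (b ^ 2 ^ i) U
  set p2 := tr (a ^ 2 ^ i) (b ^ 2 ^ i) V
  set p3 := tr (a ^ 2 ^ i) (b ^ 2 ^ i) (TT k)
  set K := Ideal.span {p1, p2, (C X) ^ 2 ^ i, X ^ 2 ^ i} with hK
  have m1 : p1 ∈ K := Ideal.subset_span (by simp)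
  have m2 : p2 ∈ K := Ideal.subset_span (by simp)
  have m3 : (C X) ^ 2 ^ i ∈ K := Ideal.subset_span (by simp)
  have m4 : X ^ 2 ^ i ∈ K := Ideal.subset_span (by simp)
  have hor : pz p1 ≠ 0 ∨ pz p2 ≠ 0 → ∀ n, CoLE k K n := by
    rintro (h | h) n
    · exact CoLE_pz m3 m4 m1 h n
    · exact CoLE_pz m3 m4 m2 h n
  by_cases hc : Fb (2 ^ i) a b e = 0
  · rw [← hF, mul_eq_zero, or_iff_left (pow_ne_zero _ (by positivity))] at hc
    have := typeI_bad hi hL huv hc (hc'0 _ _ huv hc)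
    rcases this with h | h | h
    · exact ⟨hor (Or.inl h) _, fun _ => hor (Or.inl h) _⟩
    · exact ⟨hor (Or.inr h) _, fun _ => hor (Or.inr h) _⟩
    · refine ⟨?_, fun hne => ?_⟩
      · rcases h.2 with h | h
        · exact order_one m3 m4 m1 h
        · exact order_one m3 m4 m2 h
      · obtain ⟨h1, h2, h3⟩ := hT.1 h.1
        refine absurd ⟨h1, h2, h3, ?_⟩ hne
        rw [← hF, hc, zero_mul]
  · have := typeI_good (by omega) hL hAB (by
      intro h0
      apply hc
      rw [← hF, h0, zero_mul])
    exact ⟨hor this _, fun _ => hor this _⟩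

lemma bound_one (hi : i = 1) (hℓ : Odd ℓ)
    (h : U * V * TT k = (C X) ^ (2 ^ i * ℓ + 1) + X ^ (2 ^ i * ℓ + 1) + 1 + (ww k) ^ (2 ^ i * ℓ + 1))
    (ha : a ^ ℓ = 1) (hb : b ^ ℓ = 1) (he : e ^ ℓ = 1) (hab : a + b + 1 = e)
    (hII : ¬ (a ^ 2 ^ i = a ∧ b ^ 2 ^ i = b)) :
    CoLE k (Ideal.span {tr (a ^ 2 ^ i) (b ^ 2 ^ i) U, tr (a ^ 2 ^ i) (b ^ 2 ^ i) V, (C X) ^ 2 ^ i, X ^ 2 ^ i}) 0 := by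
  have ha0 := ne_of_pow hℓ ha
  have hb0 := ne_of_pow hℓ hb
  have he0 := ne_of_pow hℓ he
  have hL := Loc_tr hℓ h ha hb he hab
  have hF := scal_F (2 ^ i) ha0 hb0 he0
  have hAB : (a * a⁻¹ ^ 2 ^ i + e * e⁻¹ ^ 2 ^ i) ≠ 0 ∨ (b * b⁻¹ ^ 2 ^ i + e * e⁻¹ ^ 2 ^ i) ≠ 0 := by
    by_contra hcon
    push Not at hcon
    have := AB_zero ha0 hb0 he0 hab hcon.1 hcon.2
    exact hII ⟨this.1, this.2.1⟩
  have hT := pzT (i := i) (a := a) (b := b)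
  set A := a * a⁻¹ ^ 2 ^ i + e * e⁻¹ ^ 2 ^ i
  set B := b * b⁻¹ ^ 2 ^ i + e * e⁻¹ ^ 2 ^ i
  set p1 := tr (a ^ 2 ^ i) (b ^ 2 ^ i) U
  set p2 := tr (a ^ 2 ^ i) (b ^ 2 ^ i) V
  set p3 := tr (a ^ 2 ^ i) (b ^ 2 ^ i) (TT k)
  set K := Ideal.span {p1, p2, (C X) ^ 2 ^ i, X ^ 2 ^ i} with hK
  have m1 : p1 ∈ K := Ideal.subset_span (by simp)
  have m2 : p2 ∈ K := Ideal.subset_span (by simp)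
  have m3 : (C X) ^ 2 ^ i ∈ K := Ideal.subset_span (by simp)
  have m4 : X ^ 2 ^ i ∈ K := Ideal.subset_span (by simp)
  have hor : pz p1 ≠ 0 ∨ pz p2 ≠ 0 → CoLE k K 0 := by
    rintro (h | h)
    · exact CoLE_pz m3 m4 m1 h 0
    · exact CoLE_pz m3 m4 m2 h 0
  apply hor
  by_cases h3 : pz p3 = 0
  · exact type_one (by rw [hi]; rfl) hL hAB h3
  · obtain ⟨n1, n2, n3⟩ := hT.1 h3
    refine typeI_good (by omega) hL hAB ?_
    intro h0
    rw [h0, zero_mul] at hF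
    have h2 := two_k (k := k)
    have hF' : Fb (2 ^ i) a b e = (a * b * e) ^ 2 * ((a + b) * (a + 1) * (b + 1)) := by
      rw [hi, Fb, br, br, br, ← hab]
      have h4 : (4 : k) = 0 := by linear_combination 2 * h2
      ring_nf
      grind
    have hT2 := pz_tr_TT (k := k) a b
    have h5 := (pzT (i := 0) (a := a) (b := b)).2 ⟨n1, n2, n3⟩
    rw [pow_zero, pow_one, pow_one, hT2] at h5
    rw [hF'] at hF
    exact mul_ne_zero (pow_ne_zero 2 (by positivity)) h5 hF.symm

lemma bound_II (hi : 1 ≤ i) (hℓ : Odd ℓ)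
    (h : U * V * TT k = (C X) ^ (2 ^ i * ℓ + 1) + X ^ (2 ^ i * ℓ + 1) + 1 + (ww k) ^ (2 ^ i * ℓ + 1))
    (ha : a ^ ℓ = 1) (hb : b ^ ℓ = 1) (he : e ^ ℓ = 1) (hab : a + b + 1 = e)
    (hIa : a ^ 2 ^ i = a) (hIb : b ^ 2 ^ i = b) :
    od (tr a b U) + od (tr a b V) + od (tr a b (TT k)) = 2 ^ i + 1 ∧
    CoLE k (Ideal.span {tr a b U, tr a b V, (C X) ^ 2 ^ i, X ^ 2 ^ i}) (od (tr a b U) * od (tr a b V)) := by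
  have ha0 := ne_of_pow hℓ ha
  have hb0 := ne_of_pow hℓ hb
  have he0 := ne_of_pow hℓ he
  have hL := Loc_tr hℓ h ha hb he hab
  have h2 := two_k (k := k)
  have hIe : e ^ 2 ^ i = e := by rw [← hab, frob_add, frob_add, one_pow, hIa, hIb]
  rw [AB_zero' ha0 he0 hIa hIe, AB_zero' hb0 he0 hIb hIe] at hL
  simp only [inv_pow, hIa, hIb, hIe] at hL
  have hq0 : ((2 ^ i : ℕ) : k) = 0 := by
    push_cast; rw [h2, zero_pow (by omega)]
  have hd : derivative (C a⁻¹ + C b⁻¹ * X ^ (2 ^ i + 1) + C e⁻¹ * (1 + X) ^ (2 ^ i + 1) : k[X]) =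
      C b⁻¹ * X ^ 2 ^ i + C e⁻¹ * (1 + X) ^ 2 ^ i := by
    rw [derivative_add, derivative_add, derivative_C, derivative_C_mul, derivative_C_mul, derivative_X_pow, derivative_pow]
    simp only [Nat.cast_add, hq0]
    simp
  have hfr : ∀ ρ : k, (1 + ρ) ^ 2 ^ i = 1 + ρ ^ 2 ^ i := fun ρ => by rw [frob_add, one_pow]
  refine typeII hi hL rfl ?_ ?_ (Ideal.subset_span (by simp)) (Ideal.subset_span (by simp)) (Ideal.subset_span (by simp)) (Ideal.subset_span (by simp))
  · by_contra hlt
    push Not at hlt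
    have hc := coeff_eq_zero_of_natDegree_lt hlt
    rw [coeff_add, coeff_add, coeff_C_mul, coeff_C_mul, coeff_X_pow, if_neg (by omega), coeff_C, if_neg (by positivity),
      coeff_one_add_X_pow, Nat.choose_succ_self_right, Nat.cast_add, hq0] at hc
    simp [he0] at hc
  · intro ρ h1 h3
    rw [hd] at h3
    simp at h1 h3
    rw [pow_succ, pow_succ, hfr] at h1
    rw [hfr] at h3
    have e1 : a⁻¹ + e⁻¹ * (1 + ρ ^ 2 ^ i) = 0 := by linear_combination h1 - ρ * h3
    have hA : a * a⁻¹ = 1 := mul_inv_cancel₀ ha0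
    have hB : b * b⁻¹ = 1 := mul_inv_cancel₀ hb0
    have hE : e * e⁻¹ = 1 := mul_inv_cancel₀ he0
    have e2 : e = a * (1 + ρ ^ 2 ^ i) := by
      linear_combination a * e * e1 - e * hA - a * (1 + ρ ^ 2 ^ i) * hE - a * (1 + ρ ^ 2 ^ i) * h2
    have e3 : b = a * ρ ^ 2 ^ i := by
      linear_combination a * b * (e1 - h3) - b * hA + a * ρ ^ 2 ^ i * hB
    have : (1 : k) = 0 := by
      linear_combination hab + e2 - e3
    exact one_ne_zero this

end
end ExcAPN

namespace ExcAPN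
open Polynomial
section
variable (k : Type*) [Field k]

/-- roots of unity -/
noncomputable def mu (ℓ : ℕ) : Finset k := nthRootsFinset ℓ (1 : k)

open Classical in
/-- type II points -/
noncomputable def II (q ℓ : ℕ) : Finset (k × k) := (mu k ℓ ×ˢ mu k ℓ).filter
  (fun P => (P.1 + P.2 + 1) ^ ℓ = 1 ∧ P.1 ^ q = P.1 ∧ P.2 ^ q = P.2)

open Classical in
/-- bad points -/
noncomputable def Bd (q ℓ : ℕ) : Finset (k × k) := (mu k ℓ ×ˢ mu k ℓ).filter
  (fun P => (P.1 + P.2 + 1) ^ ℓ = 1 ∧ ¬ (P.1 ^ q = P.1 ∧ P.2 ^ q = P.2) ∧ 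
    (P.1 ≠ P.2 ∧ P.1 ≠ 1 ∧ P.2 ≠ 1 ∧ Fb q P.1 P.2 (P.1 + P.2 + 1) = 0))

variable {k} [CharP k 2]

lemma mem_mu {ℓ : ℕ} (hℓ : Odd ℓ) {a : k} : a ∈ mu k ℓ ↔ a ^ ℓ = 1 := mem_nthRootsFinset hℓ.pos _

variable [IsAlgClosed k] {i ℓ : ℕ} {U V : k[X][X]} 

theorem bezout_sum' (hi : 1 ≤ i) (hℓ : Odd ℓ) (hU : U.Monic) (hV : V.Monic) (hWU : U ∈ Wt k 1 U.natDegree)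
    (hWV : V ∈ Wt k 1 V.natDegree) (hd : U.natDegree + V.natDegree + 2 = 2 ^ i * ℓ)
    (h : U * V * TT k = (C X) ^ (2 ^ i * ℓ + 1) + X ^ (2 ^ i * ℓ + 1) + 1 + (ww k) ^ (2 ^ i * ℓ + 1)) (n : k × k → ℕ)
    (hn : ∀ P ∈ mu k ℓ ×ˢ mu k ℓ, CoLE k (Ideal.span {tr (P.1 ^ 2 ^ i) (P.2 ^ 2 ^ i) U, tr (P.1 ^ 2 ^ i) (P.2 ^ 2 ^ i) V,
      (C X) ^ 2 ^ i, X ^ 2 ^ i}) (n P)) :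
    U.natDegree * V.natDegree ≤ ∑ P ∈ mu k ℓ ×ˢ mu k ℓ, n P := by
  have : Fact (Nat.Prime 2) := ⟨Nat.prime_two⟩
  have : ExpChar k 2 := ExpChar.prime Nat.prime_two
  let s : k → k := fun x => (iterateFrobeniusEquiv k 2 i).symm x
  have hs : ∀ x, (s x) ^ 2 ^ i = x := fun x => (iterateFrobeniusEquiv k 2 i).apply_symm_apply x
  have hs' : ∀ x, s (x ^ 2 ^ i) = x := fun x => frob_inj (hs _)
  have hmu : ∀ x ∈ mu k ℓ, s x ∈ mu k ℓ := by
    intro x hx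
    rw [mem_mu hℓ] at hx ⊢
    apply frob_inj (i := i)
    rw [← pow_mul, mul_comm, pow_mul, hs, hx, one_pow]
  have hmu' : ∀ x ∈ mu k ℓ, x ^ 2 ^ i ∈ mu k ℓ := by
    intro x hx
    rw [mem_mu hℓ] at hx ⊢
    rw [← pow_mul, mul_comm, pow_mul, hx, one_pow]
  refine (bezout_sum hi hℓ hU hV hWU hWV hd h (fun P => n (s P.1, s P.2)) ?_).trans (le_of_eq ?_)
  · intro P hP
    have hP' := Finset.mem_product.1 hP
    have := hn (s P.1, s P.2) (Finset.mem_product.2 ⟨hmu _ hP'.1, hmu _ hP'.2⟩)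
    simpa only [hs] using this
  · refine Finset.sum_nbij' (fun P => (s P.1, s P.2)) (fun P => (P.1 ^ 2 ^ i, P.2 ^ 2 ^ i)) ?_ ?_ ?_ ?_ ?_
    · intro P hP
      have hP' := Finset.mem_product.1 hP
      exact Finset.mem_product.2 ⟨hmu _ hP'.1, hmu _ hP'.2⟩
    · intro P hP
      have hP' := Finset.mem_product.1 hP
      exact Finset.mem_product.2 ⟨hmu' _ hP'.1, hmu' _ hP'.2⟩
    · intro P _; simp only [hs]
    · intro P _; simp only [hs']
    · intro P _; rfl

lemma off_point (hi : 1 ≤ i)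
    (h : U * V * TT k = (C X) ^ (2 ^ i * ℓ + 1) + X ^ (2 ^ i * ℓ + 1) + 1 + (ww k) ^ (2 ^ i * ℓ + 1)) {a b : k}
    (he : (a + b + 1) ^ ℓ ≠ 1) : CoLE k (Ideal.span {tr (a ^ 2 ^ i) (b ^ 2 ^ i) U, tr (a ^ 2 ^ i) (b ^ 2 ^ i) V,
      (C X) ^ 2 ^ i, X ^ 2 ^ i}) 0 := by
  refine point_w hi h _ _ ?_
  intro h1
  apply he
  apply frob_inj (i := i)
  rw [← pow_mul, mul_comm, pow_mul, frob_add, frob_add, one_pow, h1]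

theorem main_ineq (hi : 2 ≤ i) (hℓ : Odd ℓ) (hU : U.Monic) (hV : V.Monic) (hWU : U ∈ Wt k 1 U.natDegree)
    (hWV : V ∈ Wt k 1 V.natDegree) (hd : U.natDegree + V.natDegree + 2 = 2 ^ i * ℓ)
    (h : U * V * TT k = (C X) ^ (2 ^ i * ℓ + 1) + X ^ (2 ^ i * ℓ + 1) + 1 + (ww k) ^ (2 ^ i * ℓ + 1)) :
    U.natDegree * V.natDegree ≤ ∑ P ∈ II k (2 ^ i) ℓ, od (tr P.1 P.2 U) * od (tr P.1 P.2 V) + 2 ^ i * (Bd k (2 ^ i) ℓ).card := by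
  classical
  refine (bezout_sum' (by omega) hℓ hU hV hWU hWV hd h (fun P => (if P ∈ II k (2 ^ i) ℓ then od (tr P.1 P.2 U) * od (tr P.1 P.2 V) else 0)
    + if P ∈ Bd k (2 ^ i) ℓ then 2 ^ i else 0) ?_).trans (le_of_eq ?_)
  · rintro ⟨a, b⟩ hP
    have hP' := Finset.mem_product.1 hP
    simp only [mem_mu hℓ] at hP'
    by_cases he : (a + b + 1) ^ ℓ = 1
    swap
    · exact (off_point (by omega) h he).mono le_rfl (Nat.zero_le _)
    by_cases hII : a ^ 2 ^ i = a ∧ b ^ 2 ^ i = b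
    · have h1 := bound_II (by omega) hℓ h hP'.1 hP'.2 he rfl hII.1 hII.2
      have h2 : (a, b) ∈ II k (2 ^ i) ℓ := by rw [II, Finset.mem_filter]; exact ⟨hP, he, hII⟩
      rw [if_pos h2]
      simp only [hII.1, hII.2]
      exact h1.2.mono le_rfl (by simp)
    · have h1 := bound_I_good hi hℓ h hP'.1 hP'.2 he rfl hII
      by_cases hb : a ≠ b ∧ a ≠ 1 ∧ b ≠ 1 ∧ Fb (2 ^ i) a b (a + b + 1) = 0
      · have h2 : (a, b) ∈ Bd k (2 ^ i) ℓ := by rw [Bd, Finset.mem_filter]; exact ⟨hP, he, hII, hb⟩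
        rw [if_pos h2]
        exact h1.1.mono le_rfl (by simp)
      · exact (h1.2 hb).mono le_rfl (Nat.zero_le _)
  · rw [Finset.sum_add_distrib, ← Finset.sum_filter, ← Finset.sum_filter, Finset.sum_const, smul_eq_mul, mul_comm (2 ^ i)]
    congr 2
    · rw [Finset.filter_mem_eq_inter, Finset.inter_eq_right]
      exact Finset.filter_subset _ _
    · rw [Finset.filter_mem_eq_inter, Finset.inter_eq_right.2]
      exact Finset.filter_subset _ _

theorem case_one (hi : i = 1) (hℓ : Odd ℓ) (hU : U.Monic) (hV : V.Monic) (hWU : U ∈ Wt k 1 U.natDegree)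
    (hWV : V ∈ Wt k 1 V.natDegree) (hd : U.natDegree + V.natDegree + 2 = 2 ^ i * ℓ)
    (h : U * V * TT k = (C X) ^ (2 ^ i * ℓ + 1) + X ^ (2 ^ i * ℓ + 1) + 1 + (ww k) ^ (2 ^ i * ℓ + 1)) :
    U.natDegree * V.natDegree = 0 := by
  have := bezout_sum' (by omega) hℓ hU hV hWU hWV hd h (fun P => 0) ?_
  · simpa using this
  rintro ⟨a, b⟩ hP
  have hP' := Finset.mem_product.1 hP
  simp only [mem_mu hℓ] at hP'
  by_cases he : (a + b + 1) ^ ℓ = 1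
  swap
  · exact (off_point (by omega) h he).mono le_rfl (Nat.zero_le _)
  by_cases hII : a ^ 2 ^ i = a ∧ b ^ 2 ^ i = b
  swap
  · exact bound_one hi hℓ h hP'.1 hP'.2 he rfl hII
  have h1 := bound_II (by omega) hℓ h hP'.1 hP'.2 he rfl hII.1 hII.2
  simp only [hII.1, hII.2]
  refine h1.2.mono le_rfl (le_of_eq ?_)
  have h1' := h1.1
  have hab : ∀ x : k, x ^ ℓ = 1 → x ^ 2 ^ i = x → x = 1 := by
    intro x hx hx'
    rw [hi, pow_one, pow_two] at hx'
    exact mul_right_cancel₀ (ne_of_pow hℓ hx) (hx'.trans (one_mul _).symm)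
  obtain rfl := hab a hP'.1 hII.1
  obtain rfl := hab b hP'.2 hII.2
  have h3 : 3 ≤ od (tr 1 1 (TT k)) := by
    have h2 := two_A (k := k)
    have : tr 1 1 (TT k) = (C X + X) * C X * X := by
      rw [TT]
      simp only [map_mul, map_add, tr_CX, tr_X, map_one]
      rw [show (C X + 1 + (X + 1) : k[X][X]) = C X + X by linear_combination h2,
        show (C X + 1 + 1 : k[X][X]) = C X by linear_combination h2,
        show (X + 1 + 1 : k[X][X]) = X by linear_combination h2]
    have h0 : th 1 1 (tr 1 1 (TT k)) ≠ 0 := fun h => tr_ne TT_ne (th_injective 1 1 one_pos (by rw [h, map_zero]))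
    have h3 : X ^ 3 ∣ th 1 1 (tr 1 1 (TT k)) := by
      rw [this]
      simp only [map_mul, map_add, th_CX, th_X, pow_one]
      exact ⟨(1 + C X) * C X, by ring⟩
    rw [od]
    exact le_natTrailingDegree h0 fun m hm => X_pow_dvd_iff.1 h3 m hm
  rw [hi] at h1'
  have : od (tr 1 1 U) = 0 := by omega
  rw [this, zero_mul]

end
end ExcAPN

namespace ExcAPN
open Polynomial
section
variable {k : Type*} [Field k] [CharP k 2]

lemma card_mu_le (ℓ : ℕ) : (mu k ℓ).card ≤ ℓ := by
  classical
  rw [mu, nthRootsFinset]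
  exact (Multiset.toFinset_card_le _).trans (card_nthRoots _ _)

lemma ab_lower {a b D : ℕ} (h : a + b = D) (h1 : 2 * a ≤ D) (h2 : D ≤ 3 * a) : 2 * D ^ 2 ≤ 9 * (a * b) := by
  subst h
  zify at *
  nlinarith [mul_nonneg (sub_nonneg.2 h2) (show (0:ℤ) ≤ 2 * b - a by linarith)]

lemma od_dvd (p : k[X][X]) : X ^ od p ∣ th 1 1 p := by
  rw [X_pow_dvd_iff]
  intro d hd
  exact coeff_eq_zero_of_lt_natTrailingDegree hd

lemma od_mult {U : k[X][X]} (α β : k) : (X - C β) ^ od (tr α β U) ∣ U.map (evalRingHom α) := by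
  have h2 := two_k (k := k)
  have h := ord_dvd (R := k[X]) (a := 0) (b := X - C β) (z := X - C β) (od_dvd (tr α β U)) (dvd_zero _) dvd_rfl
  have e1 : ∀ p, ev (0 : k[X]) (X - C β) (tr α β p) = p.map (evalRingHom α) := by
    intro p
    have : ((ev (0 : k[X]) (X - C β)).comp (tr α β) : k[X][X] →ₐ[k] k[X]) = 
      { mapRingHom (evalRingHom α) with commutes' := fun r => by simp [alg_A] } := by
      apply ev_ext
      · simp [tr]
      · simp [tr]
    have := DFunLike.congr_fun this p
    simpa using this
  rwa [e1] at h

lemma col_sum {U : k[X][X]} (hU : U.Monic) (α : k) (s : Finset k) : ∑ β ∈ s, od (tr α β U) ≤ U.natDegree := by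
  classical
  have hm : (U.map (evalRingHom α)).Monic := hU.map _
  have hd : ∏ β ∈ s, (X - C β) ^ od (tr α β U) ∣ U.map (evalRingHom α) := by
    apply Finset.prod_dvd_of_coprime
    · intro x _ y _ hxy
      exact (isCoprime_X_sub_C_of_isUnit_sub (sub_ne_zero.2 hxy).isUnit).pow
    · intro x _
      exact od_mult α x
  have := natDegree_le_of_dvd hd hm.ne_zero
  rw [hU.natDegree_map, natDegree_prod_of_monic _ _ (fun β _ => (monic_X_sub_C β).pow _)] at this
  simpa [natDegree_pow] using this

lemma II_sum {U : k[X][X]} (hU : U.Monic) (q ℓ : ℕ) : ∑ P ∈ II k q ℓ, od (tr P.1 P.2 U) ≤ ℓ * U.natDegree := by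
  classical
  calc _ ≤ ∑ P ∈ mu k ℓ ×ˢ mu k ℓ, od (tr P.1 P.2 U) := Finset.sum_le_sum_of_subset (Finset.filter_subset _ _)
    _ = ∑ α ∈ mu k ℓ, ∑ β ∈ mu k ℓ, od (tr α β U) := by rw [Finset.sum_product]
    _ ≤ ∑ α ∈ mu k ℓ, U.natDegree := Finset.sum_le_sum fun α _ => col_sum hU α _
    _ ≤ _ := by rw [Finset.sum_const, smul_eq_mul]; exact Nat.mul_le_mul_right _ (card_mu_le ℓ)

lemma mem_mu_gcd {ℓ q : ℕ} (hℓ : Odd ℓ) (hq : 1 ≤ q) {x : k} (hx : x ^ ℓ = 1) (h : x ^ q = x) : x ^ (Nat.gcd ℓ (q - 1)) = 1 := by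
  have h1 : x ^ (q - 1) = 1 := by
    apply mul_right_cancel₀ (ne_of_pow hℓ hx)
    rw [← pow_succ, Nat.sub_add_cancel hq, h, one_mul]
  rw [pow_gcd_eq_one]
  exact ⟨hx, h1⟩

lemma II_card {ℓ q : ℕ} (hℓ : Odd ℓ) (hq : 1 ≤ q) : (II k q ℓ).card ≤ (Nat.gcd ℓ (q - 1)) ^ 2 := by
  classical
  have hg : Odd (Nat.gcd ℓ (q - 1)) := hℓ.of_dvd_nat (Nat.gcd_dvd_left _ _)
  have : II k q ℓ ⊆ mu k (Nat.gcd ℓ (q - 1)) ×ˢ mu k (Nat.gcd ℓ (q - 1)) := by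
    rintro ⟨a, b⟩ hP
    rw [II, Finset.mem_filter, Finset.mem_product, mem_mu hℓ, mem_mu hℓ] at hP
    rw [Finset.mem_product, mem_mu hg, mem_mu hg]
    exact ⟨mem_mu_gcd hℓ hq hP.1.1 hP.2.2.1, mem_mu_gcd hℓ hq hP.1.2 hP.2.2.2⟩
  refine (Finset.card_le_card this).trans ?_
  rw [Finset.card_product, pow_two]
  exact Nat.mul_le_mul (card_mu_le _) (card_mu_le _)

lemma Bd_card (ℓ q : ℕ) : (Bd k q ℓ).card ≤ ℓ ^ 2 := by
  classical
  refine (Finset.card_le_card (Finset.filter_subset _ _)).trans ?_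
  rw [Finset.card_product, pow_two]
  exact Nat.mul_le_mul (card_mu_le _) (card_mu_le _)

variable [IsAlgClosed k] {i ℓ : ℕ} {U V : k[X][X]} 

lemma II_st (hi : 1 ≤ i) (hℓ : Odd ℓ)
    (h : U * V * TT k = (C X) ^ (2 ^ i * ℓ + 1) + X ^ (2 ^ i * ℓ + 1) + 1 + (ww k) ^ (2 ^ i * ℓ + 1)) {P : k × k}
    (hP : P ∈ II k (2 ^ i) ℓ) :  od (tr P.1 P.2 U) + od (tr P.1 P.2 V) + od (tr P.1 P.2 (TT k)) = 2 ^ i + 1 := by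
  classical
  rw [II, Finset.mem_filter, Finset.mem_product, mem_mu hℓ, mem_mu hℓ] at hP
  exact (bound_II hi hℓ h hP.1.1 hP.1.2 hP.2.1 rfl hP.2.2.1 hP.2.2.2).1

lemma st_le {s t Q : ℕ} (h : s + t ≤ Q) : 4 * (s * t) ≤ Q ^ 2 := by
  have : (s + t) ^ 2 ≤ Q ^ 2 := Nat.pow_le_pow_left h 2
  zify at *
  nlinarith [sq_nonneg ((s : ℤ) - t)]

lemma II_le (hi : 1 ≤ i) (hℓ : Odd ℓ)
    (h : U * V * TT k = (C X) ^ (2 ^ i * ℓ + 1) + X ^ (2 ^ i * ℓ + 1) + 1 + (ww k) ^ (2 ^ i * ℓ + 1)) :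
    4 * ∑ P ∈ II k (2 ^ i) ℓ, od (tr P.1 P.2 U) * od (tr P.1 P.2 V) ≤ (II k (2 ^ i) ℓ).card * (2 ^ i + 1) ^ 2 := by
  rw [Finset.mul_sum, ← smul_eq_mul, ← Finset.sum_const]
  refine Finset.sum_le_sum fun P hP => st_le ?_
  have := II_st hi hℓ h hP
  omega

lemma Bd_empty {q : ℕ} (hq : 1 ≤ q) (hℓ : Odd ℓ) (hd : ℓ ∣ q - 1) : Bd k q ℓ = ∅ := by
  classical
  rw [Bd, Finset.filter_eq_empty_iff]
  rintro ⟨a, b⟩ hP h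
  rw [Finset.mem_product, mem_mu hℓ, mem_mu hℓ] at hP
  obtain ⟨c, hc⟩ := hd
  have key : ∀ x : k, x ^ ℓ = 1 → x ^ q = x := by
    intro x hx
    rw [← Nat.sub_add_cancel hq, pow_succ, hc, pow_mul, hx, one_pow, one_mul]
  exact h.2.1 ⟨key _ hP.1, key _ hP.2⟩

end
end ExcAPN

namespace ExcAPN
open Polynomial
section

lemma numA {g l q D ab s N B : ℤ} (hg0 : 0 ≤ g) (hg : 3 * g ≤ l) (hl : 3 ≤ l) (hq : 8 ≤ q) (hD : D + 2 = q * l)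
    (h1 : 2 * D ^ 2 ≤ 9 * ab) (h2 : ab ≤ s + q * B) (h3 : 4 * s ≤ N * (q + 1) ^ 2) (h4 : N ≤ g ^ 2) (h5 : B ≤ l ^ 2) : False := by
  have e1 : N * (q + 1) ^ 2 ≤ g ^ 2 * (q + 1) ^ 2 := mul_le_mul_of_nonneg_right h4 (sq_nonneg _)
  have e2 : (3 * g) ^ 2 * (q + 1) ^ 2 ≤ l ^ 2 * (q + 1) ^ 2 := mul_le_mul_of_nonneg_right
    (pow_le_pow_left₀ (by linarith) hg 2) (sq_nonneg _)
  have e3 : q * B ≤ q * l ^ 2 := mul_le_mul_of_nonneg_left h5 (by linarith)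
  obtain rfl : D = q * l - 2 := by linarith
  have e4 : 0 ≤ (l - 3) * (7 * q ^ 2 - 38 * q - 1) := mul_nonneg (by linarith) (by nlinarith)
  have e5 : 0 ≤ l * (l * (7 * q ^ 2 - 38 * q - 1) - 32 * q) := mul_nonneg (by linarith) (by nlinarith)
  nlinarith

lemma numC1 {l q D ab N : ℤ} (hl : 5 ≤ l) (hq : 8 ≤ q) (hD : D + 2 = q * l)
    (h1 : 2 * D ^ 2 ≤ 9 * ab) (h3 : 4 * ab ≤ N * (q + 1) ^ 2) (h4 : 2 * N ≤ l ^ 2 + 1) : False := by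
  have e1 : (2 * N) * (q + 1) ^ 2 ≤ (l ^ 2 + 1) * (q + 1) ^ 2 := mul_le_mul_of_nonneg_right h4 (sq_nonneg _)
  obtain rfl : D = q * l - 2 := by linarith
  have e2 : 16 * (q * l - 2) ^ 2 ≤ 9 * (l ^ 2 + 1) * (q + 1) ^ 2 := by nlinarith
  have e3 : 9 * (l ^ 2 + 1) ≤ (3 * l + 1) ^ 2 := by nlinarith
  have e4 : (4 * (q * l - 2)) ^ 2 ≤ ((3 * l + 1) * (q + 1)) ^ 2 := by
    have := mul_le_mul_of_nonneg_right e3 (sq_nonneg (q + 1))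
    nlinarith
  have e5 : 4 * (q * l - 2) ≤ (3 * l + 1) * (q + 1) := by
    apply le_of_sq_le_sq e4
    positivity
  nlinarith [mul_nonneg (show 0 ≤ l - 5 by linarith) (show 0 ≤ q - 8 by linarith)]

lemma numC3 {q D ab N : ℤ} (hq : 16 ≤ q) (hD : D + 2 = q * 3)
    (h1 : 2 * D ^ 2 ≤ 9 * ab) (h3 : 4 * ab ≤ N * q ^ 2) (h4 : N ≤ 7) : False := by
  have e1 : N * q ^ 2 ≤ 7 * q ^ 2 := mul_le_mul_of_nonneg_right h4 (sq_nonneg _)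
  obtain rfl : D = q * 3 - 2 := by linarith
  nlinarith

lemma numC2 {l q D a b N S T : ℤ} (hl : 7 ≤ l) (hq : (l + 1) ^ 2 ≤ q) (hD : D + 2 = q * l) (hab : a + b = D)
    (h1 : 2 * a ≤ D) (h2 : D ≤ 3 * a) (hN0 : 0 ≤ N) (hN : N ≤ l ^ 2 - l + 1) (hS : S ≤ l * a) (h3 : a * b ≤ T) (h4 : 4 * T ≤ N * (q + 1) ^ 2)
    (h5 : ∀ x y : ℤ, y ^ 2 * T ≤ S * (y ^ 2 * (q + 1) - 2 * x * y) + N * x ^ 2) : False := by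
  obtain ⟨M, hM⟩ : ∃ M, M = l ^ 2 - l + 1 := ⟨_, rfl⟩
  obtain ⟨Q, hQ⟩ : ∃ Q, Q = q + 1 := ⟨_, rfl⟩
  rw [← hM] at hN
  rw [← hQ] at h4 h5
  have hMpos : 0 < M := by nlinarith
  have hqpos : 0 < q := by nlinarith
  have hql : (l + 1) ^ 2 * l ≤ q * l := mul_le_mul_of_nonneg_right hq (by linarith)
  have hapos : 0 < a := by nlinarith
  rcases le_or_gt (2 * l * a) (M * Q) with hc | hc
  · have f1 := h5 (l * a) M
    have f2 : N * (l * a) ^ 2 ≤ M * (l * a) ^ 2 := mul_le_mul_of_nonneg_right hN (sq_nonneg _)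
    have f3 : S * (M ^ 2 * Q - 2 * (l * a) * M) ≤ (l * a) * (M ^ 2 * Q - 2 * (l * a) * M) :=
      mul_le_mul_of_nonneg_right hS (by nlinarith)
    have f4 : M ^ 2 * (a * b) ≤ M ^ 2 * T := mul_le_mul_of_nonneg_left h3 (sq_nonneg _)
    have f5 : (M * a) * (M * b) ≤ (M * a) * (l * M * Q - l ^ 2 * a) := by linarith
    have f6 := le_of_mul_le_mul_left f5 (mul_pos hMpos hapos)
    have f7 : (l - 1) * a ≤ M * (l + 2) := by
      have : b = q * l - 2 - a := by linarith
      rw [this, hQ] at f6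
      have e : l ^ 2 = M + l - 1 := by rw [hM]; ring
      rw [e] at f6
      linarith
    have f8 : (l - 1) * ((l + 1) ^ 2 * l - 2) ≤ (l - 1) * (3 * a) := mul_le_mul_of_nonneg_left (by linarith) (by linarith)
    obtain ⟨r, rfl⟩ : ∃ r, l = r + 7 := ⟨l - 7, by ring⟩
    have hr : 0 ≤ r := by linarith
    rw [hM] at f7
    have : (r + 7 - 1) * ((r + 7 + 1) ^ 2 * (r + 7) - 2) ≤ 3 * (((r + 7) ^ 2 - (r + 7) + 1) * (r + 7 + 2)) := by linarith
    have g2 := pow_nonneg hr 2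
    have g3 := pow_nonneg hr 3
    have g4 := pow_nonneg hr 4
    ring_nf at this
    linarith
  · have hQpos : 0 < Q := by linarith
    have f1 : 0 ≤ (2 * l * a - M * Q) * (2 * l * b - M * Q) := mul_nonneg (by linarith) (by nlinarith)
    have f2 : N * Q ^ 2 ≤ M * Q ^ 2 := mul_le_mul_of_nonneg_right hN (sq_nonneg _)
    have f3 : 4 * (a * b) ≤ M * Q ^ 2 := by linarith
    have f4 : l ^ 2 * (4 * (a * b)) ≤ l ^ 2 * (M * Q ^ 2) := mul_le_mul_of_nonneg_left f3 (sq_nonneg _)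
    have f5 : (M * Q) * (2 * l * D) ≤ (M * Q) * (l ^ 2 * Q + M * Q) := by rw [← hab]; linarith
    have f6 := le_of_mul_le_mul_left f5 (mul_pos hMpos hQpos)
    have f7 : D = q * l - 2 := by linarith
    rw [f7, hM, hQ] at f6
    have f8 : (l - 1) * (l + 1) ^ 2 ≤ (l - 1) * q := mul_le_mul_of_nonneg_left hq (by linarith)
    nlinarith

lemma numB1 {l ab B s : ℤ} (hl : 5 ≤ l) (h1 : 2 * (4 * l - 2) ^ 2 ≤ 9 * ab) (h2 : ab ≤ s + 4 * B) (hs : s ≤ 6)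
    (h5 : l < 19 → B ≤ (l - 1) * (l - 2)) (h6 : B ≤ (l - 1) * 16) (hl' : l < 19 → l ≤ 17) : False := by
  rcases lt_or_ge l 19 with h | h
  · have := h5 h
    have := hl' h
    nlinarith
  · nlinarith

lemma numB3 {l ab B s : ℤ} (hl : 9 ≤ l) (h1 : 2 * (4 * l - 2) ^ 2 ≤ 9 * ab) (h2 : ab ≤ s + 4 * B) (hs : s ≤ 54)
    (h5 : l < 19 → B ≤ (l - 3) * (l - 2)) (h6 : B ≤ (l - 3) * 16) (hl' : l < 19 → l ≤ 17) : False := by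
  rcases lt_or_ge l 19 with h | h
  · have := h5 h
    have := hl' h
    nlinarith
  · nlinarith
end
end ExcAPN

namespace ExcAPN
open Polynomial
section
variable {k : Type*} [Field k] [CharP k 2]

/-- data of a splitting -/
structure Split (i ℓ : ℕ) (U V : k[X][X]) : Prop where
  odd : Odd ℓ
  hU : U.Monic
  hV : V.Monic
  hWU : U ∈ Wt k 1 U.natDegree
  hWV : V ∈ Wt k 1 V.natDegree
  hd : U.natDegree + V.natDegree + 2 = 2 ^ i * ℓ
  h : U * V * TT k = (C X) ^ (2 ^ i * ℓ + 1) + X ^ (2 ^ i * ℓ + 1) + 1 + (ww k) ^ (2 ^ i * ℓ + 1)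
  h1 : 2 * U.natDegree ≤ U.natDegree + V.natDegree
  h2 : U.natDegree + V.natDegree ≤ 3 * U.natDegree

variable [IsAlgClosed k] {i ℓ : ℕ} {U V : k[X][X]}

lemma Split.ineq (S : Split i ℓ U V) (hi : 2 ≤ i) : U.natDegree * V.natDegree ≤
    ∑ P ∈ II k (2 ^ i) ℓ, od (tr P.1 P.2 U) * od (tr P.1 P.2 V) + 2 ^ i * (Bd k (2 ^ i) ℓ).card :=
  main_ineq hi S.odd S.hU S.hV S.hWU S.hWV S.hd S.h

lemma Split.lower (S : Split i ℓ U V) : 2 * (U.natDegree + V.natDegree) ^ 2 ≤ 9 * (U.natDegree * V.natDegree) :=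
  ab_lower rfl S.h1 S.h2

lemma gcd_third {ℓ n : ℕ} (hℓ : Odd ℓ) (hnd : ¬ ℓ ∣ n) : 3 * Nat.gcd ℓ n ≤ ℓ := by
  obtain ⟨c, hc⟩ := Nat.gcd_dvd_left ℓ n
  have hc' : Odd c := hℓ.of_dvd_nat ⟨_, by rw [mul_comm]; exact hc⟩
  have : c ≠ 1 := by
    rintro rfl
    rw [mul_one] at hc
    exact hnd (hc ▸ Nat.gcd_dvd_right ℓ n)
  obtain ⟨t, rfl⟩ := hc'
  have : 1 ≤ t := by omega
  calc 3 * Nat.gcd ℓ n ≤ Nat.gcd ℓ n * (2 * t + 1) := by nlinarith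
    _ = ℓ := hc.symm

lemma caseA (S : Split i ℓ U V) (hi : 3 ≤ i) (hnd : ¬ ℓ ∣ 2 ^ i - 1) : False := by
  have hg := gcd_third S.odd hnd
  have hg1 : 1 ≤ Nat.gcd ℓ (2 ^ i - 1) := Nat.gcd_pos_of_pos_left _ S.odd.pos
  have hq : 2 ^ 3 ≤ 2 ^ i := Nat.pow_le_pow_right (by norm_num) hi
  have e1 := S.ineq (by omega)
  have e2 := S.lower
  have e3 := II_le (by omega) S.odd S.h
  have e4 := II_card (k := k) (q := 2 ^ i) S.odd (by omega)
  have e5 := Bd_card (k := k) ℓ (2 ^ i)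
  have hd := S.hd
  zify at *
  push_cast at *
  exact numA (g := Nat.gcd ℓ (2 ^ i - 1)) (by positivity) hg (by linarith) hq hd e2 e1 e3 e4 e5

lemma caseC1 (S : Split i ℓ U V) (hi : 3 ≤ i) (hℓ5 : 5 ≤ ℓ) (hd : ℓ ∣ 2 ^ i - 1)
    (hN : 2 * (II k (2 ^ i) ℓ).card ≤ ℓ ^ 2 + 1) : False := by
  have hq : 2 ^ 3 ≤ 2 ^ i := Nat.pow_le_pow_right (by norm_num) hi
  have e1 := S.ineq (by omega)
  rw [Bd_empty (by omega) S.odd hd, Finset.card_empty, mul_zero, add_zero] at e1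
  have e2 := S.lower
  have e3 := II_le (by omega) S.odd S.h
  have e4 := (Nat.mul_le_mul_left 4 e1).trans e3
  have hd := S.hd
  zify at *
  push_cast at *
  exact numC1 hℓ5 hq hd e2 e4 hN

lemma caseC2 (S : Split i ℓ U V) (hi : 3 ≤ i) (hℓ5 : 7 ≤ ℓ) (hq : (ℓ + 1) ^ 2 ≤ 2 ^ i) (hd : ℓ ∣ 2 ^ i - 1)
    (hN : (II k (2 ^ i) ℓ).card + ℓ ≤ ℓ ^ 2 + 1) : False := by
  have hq1 : 2 ^ 3 ≤ 2 ^ i := Nat.pow_le_pow_right (by norm_num) hi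
  have e1 := S.ineq (by omega)
  rw [Bd_empty (by omega) S.odd hd, Finset.card_empty, mul_zero, add_zero] at e1
  have e3 := II_le (by omega) S.odd S.h
  have e4 := II_sum S.hU (2 ^ i) ℓ
  have e5 : ∀ x y : ℤ, y ^ 2 * ((∑ P ∈ II k (2 ^ i) ℓ, od (tr P.1 P.2 U) * od (tr P.1 P.2 V) : ℕ) : ℤ) ≤
      ((∑ P ∈ II k (2 ^ i) ℓ, od (tr P.1 P.2 U) : ℕ) : ℤ) * (y ^ 2 * (((2 ^ i : ℕ) : ℤ) + 1) - 2 * x * y)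
      + ((II k (2 ^ i) ℓ).card : ℤ) * x ^ 2 := by
    intro x y
    rw [← smul_eq_mul (a := ((II k (2 ^ i) ℓ).card : ℤ)), natCast_zsmul, ← Finset.sum_const, Nat.cast_sum, Nat.cast_sum, Finset.mul_sum, Finset.sum_mul, ← Finset.sum_add_distrib]
    refine Finset.sum_le_sum fun P hP => ?_
    have := II_st (by omega) S.odd S.h hP
    generalize od (tr P.1 P.2 U) = s at *
    generalize od (tr P.1 P.2 V) = t at *
    have h1 : s + t ≤ 2 ^ i + 1 := by omega
    zify at h1
    push_cast
    have h2 : (s : ℤ) * t ≤ s * (2 ^ i + 1 - s) := mul_le_mul_of_nonneg_left (by linarith) (by positivity)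
    have h3 := mul_le_mul_of_nonneg_left h2 (sq_nonneg y)
    nlinarith [sq_nonneg (y * s - x)]
  have hd := S.hd
  have h1 := S.h1
  have h2 := S.h2
  have hN0 : 0 ≤ (II k (2 ^ i) ℓ).card := Nat.zero_le _
  zify at *
  push_cast at *
  exact numC2 hℓ5 hq hd rfl h1 h2 hN0 (by linarith) e4 e1 e3 e5

lemma caseC3 (S : Split i 3 U V) (hi : 4 ≤ i) (hd : 3 ∣ 2 ^ i - 1)
    (hN : (II k (2 ^ i) 3).card + 3 ≤ 3 ^ 2 + 1) : False := by
  classical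
  have hq1 : 2 ^ 4 ≤ 2 ^ i := Nat.pow_le_pow_right (by norm_num) hi
  have e1 := S.ineq (by omega)
  rw [Bd_empty (by omega) S.odd hd, Finset.card_empty, mul_zero, add_zero] at e1
  have e2 := S.lower
  have e3 : 4 * ∑ P ∈ II k (2 ^ i) 3, od (tr P.1 P.2 U) * od (tr P.1 P.2 V) ≤ (II k (2 ^ i) 3).card * (2 ^ i) ^ 2 := by
    rw [Finset.mul_sum, ← smul_eq_mul, ← Finset.sum_const]
    refine Finset.sum_le_sum fun P hP => st_le ?_
    have h1 := II_st (by omega) S.odd S.h hP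
    have h2 : 1 ≤ od (tr P.1 P.2 (TT k)) := by
      apply od_pos (tr_ne TT_ne)
      rw [pz_tr_TT]
      rw [II, Finset.mem_filter, Finset.mem_product, mem_mu S.odd, mem_mu S.odd] at hP
      obtain ⟨⟨ha, hb⟩, he, -⟩ := hP
      have h2 := two_k (k := k)
      generalize P.1 = a at *
      generalize P.2 = b at *
      have f1 : (a + 1) * (a ^ 2 + a + 1) = 0 := by linear_combination ha + (a ^ 2 + a + 1) * h2
      have f2 : (b + 1) * (b ^ 2 + b + 1) = 0 := by linear_combination hb + (b ^ 2 + b + 1) * h2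
      by_contra hne
      have n1 := left_ne_zero_of_mul (left_ne_zero_of_mul hne)
      have n2 := right_ne_zero_of_mul (left_ne_zero_of_mul hne)
      have n3 := right_ne_zero_of_mul hne
      have f1' := (mul_eq_zero.1 f1).resolve_left n2
      have f2' := (mul_eq_zero.1 f2).resolve_left n3
      have f3 : (a + b) * (a + b + 1) = 0 := by linear_combination f1' + f2' + (a * b - 1) * h2
      have f4 := (mul_eq_zero.1 f3).resolve_left n1
      rw [f4] at he
      norm_num at he
    omega
  have e4 := (Nat.mul_le_mul_left 4 e1).trans e3
  have hd := S.hd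
  zify at *
  push_cast at *
  exact numC3 hq1 hd e2 e4 (by linarith)

end
end ExcAPN

namespace ExcAPN
open Polynomial
section
variable {k : Type*} [Field k] [CharP k 2]

lemma p4 (x z : k) : (x + z) ^ 4 = x ^ 4 + z ^ 4 := by
  have h2 := two_k (k := k)
  linear_combination (2 * x ^ 3 * z + 3 * x ^ 2 * z ^ 2 + 2 * x * z ^ 3) * h2

lemma p5 (x z : k) : (x + z) ^ 5 = x ^ 5 + x ^ 4 * z + z ^ 4 * x + z ^ 5 := by
  rw [pow_succ, p4]; ring

lemma Fb4 (a b : k) : Fb 4 a b (a + b + 1) = a ^ 4 * ((a * b ^ 4 + b * a ^ 4) ^ 4 * (b + b ^ 4) + (b + b ^ 4) ^ 4 * (a * b ^ 4 + b * a ^ 4) + (b + b ^ 4) ^ 5)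
   + b ^ 4 * ((a * b ^ 4 + b * a ^ 4) ^ 4 * (a + a ^ 4) + (a + a ^ 4) ^ 4 * (a * b ^ 4 + b * a ^ 4) + (a + a ^ 4) ^ 5) 
   + (a * b ^ 4 + b * a ^ 4) ^ 5 := by
  have h2 := two_k (k := k)
  have e1 : br 4 b (a + b + 1) = (a * b ^ 4 + b * a ^ 4) + (b + b ^ 4) := by
    rw [br, p4, p4, one_pow]; linear_combination b ^ 5 * h2
  have e2 : br 4 a (a + b + 1) = (a * b ^ 4 + b * a ^ 4) + (a + a ^ 4) := by
    rw [br, p4, p4, one_pow]; linear_combination a ^ 5 * h2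
  rw [Fb, e1, e2, p4, p4, one_pow, br, p5 _ (b + b ^ 4), p5 _ (a + a ^ 4)]
  generalize a * b ^ 4 + b * a ^ 4 = x
  linear_combination (a ^ 4 + b ^ 4) * x ^ 5 * h2

lemma Fb4_fix {a b : k} (hb : b ^ 4 = b) (hb0 : b ≠ 0) (hb1 : b ≠ 1) (h : Fb 4 a b (a + b + 1) = 0) : a ^ 4 = a := by
  have h2 := two_k (k := k)
  rw [Fb4, hb] at h
  have : (b * (b + 1)) * (a + a ^ 4) ^ 5 = 0 := by
    have e : a * b + b * a ^ 4 = b * (a + a ^ 4) := by ring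
    rw [e] at h
    generalize a + a ^ 4 = y at *
    rw [← h, mul_pow, mul_pow, hb]
    have hz : b + b = 0 := by linear_combination b * h2
    rw [hz]
    linear_combination (-y ^ 5 * b) * hb - b ^ 2 * y ^ 5 * h2
  rcases mul_eq_zero.1 this with h | h
  · rcases mul_eq_zero.1 h with h | h
    · exact absurd h hb0
    · exact absurd (by linear_combination h - h2) hb1
  · have := pow_eq_zero_iff (by norm_num) |>.1 h
    linear_combination this - a * h2

/-- the polynomial of degree at most 16 -/
noncomputable def H16 (b : k) : k[X] :=
  ((X * (C (b ^ 4) + C b * X ^ 3)) ^ 4 * C (b + b ^ 4) + C ((b + b ^ 4) ^ 4) * (X * (C (b ^ 4) + C b * X ^ 3)) + C ((b + b ^ 4) ^ 5))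
  + C (b ^ 4) * (X * (C (b ^ 4) + C b * X ^ 3) ^ 4 * (1 + X ^ 3) + X * (1 + X ^ 3) ^ 4 * (C (b ^ 4) + C b * X ^ 3) + X * (1 + X ^ 3) ^ 5)
  + X * (C (b ^ 4) + C b * X ^ 3) ^ 5

lemma H16_deg (b : k) : (H16 b).natDegree ≤ 16 := by
  rw [H16]; compute_degree

lemma H16_zero {b : k} (hb : b ^ 4 ≠ b) : H16 b ≠ 0 := by
  intro h
  have := congrArg (eval 0) h
  have h2 := two_k (k := k)
  simp [H16] at this
  exact hb (by linear_combination this - b * h2)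

lemma H16_eval (a b : k) : a ^ 4 * (H16 b).eval a = Fb 4 a b (a + b + 1) := by
  rw [Fb4]
  simp only [H16, eval_add, eval_mul, eval_pow, eval_X, eval_C, eval_one]
  ring

lemma Bd_mem {ℓ : ℕ} (hℓ : Odd ℓ) {a b : k} (h : (a, b) ∈ Bd k 4 ℓ) : a ^ ℓ = 1 ∧ b ^ ℓ = 1 ∧ a ≠ b ∧ a ≠ 1 ∧ b ≠ 1 ∧ b ^ 4 ≠ b ∧ (H16 b).eval a = 0 := by
  classical
  rw [Bd, Finset.mem_filter, Finset.mem_product, mem_mu hℓ, mem_mu hℓ] at h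
  obtain ⟨⟨ha, hb⟩, -, h1, h2, h3, h4, h5⟩ := h
  simp only at *
  have ha0 := ne_of_pow hℓ ha
  have hb0 := ne_of_pow hℓ hb
  refine ⟨ha, hb, h2, h3, h4, ?_, ?_⟩
  · intro h6
    exact h1 ⟨Fb4_fix h6 hb0 h4 h5, h6⟩
  · rw [← H16_eval] at h5
    exact (mul_eq_zero.1 h5).resolve_left (pow_ne_zero _ ha0)

/-- if every fibre over `s` has at most `M` elements -/
lemma card_fib {S : Finset (k × k)} {s : Finset k} {M : ℕ} (h1 : ∀ P ∈ S, P.2 ∈ s) (h2 : ∀ b ∈ s, ∃ t : Finset k, t.card ≤ M ∧ ∀ a, (a, b) ∈ S → a ∈ t) :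
    S.card ≤ s.card * M := by
  classical
  rw [mul_comm]
  apply Finset.card_le_mul_card_image_of_maps_to (f := Prod.snd) (s := S) (t := s) h1
  intro b hb
  obtain ⟨t, ht, h⟩ := h2 b hb
  refine le_trans ?_ ht
  apply Finset.card_le_card_of_injOn Prod.fst
  · rintro ⟨a, b'⟩ hP
    have hP := Finset.mem_coe.1 hP
    rw [Finset.mem_filter] at hP
    have h0 := hP.1
    have h5 : b' = b := hP.2
    rw [h5] at h0
    exact h a h0
  · rintro ⟨a, b1⟩ h1 ⟨a', b2⟩ h2 h3
    have h1 := Finset.mem_coe.1 h1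
    have h2 := Finset.mem_coe.1 h2
    rw [Finset.mem_filter] at h1 h2
    ext
    · exact h3
    · exact h1.2.trans h2.2.symm

lemma Bd_le {ℓ g : ℕ} (hℓ : Odd ℓ) {s : Finset k} (hs : s ⊆ mu k ℓ) (hs4 : ∀ x ∈ s, x ^ 4 = x) (hsg : s.card = g) :
    (Bd k 4 ℓ).card ≤ (ℓ - g) * (ℓ - 2) ∧ (Bd k 4 ℓ).card ≤ (ℓ - g) * 16 := by
  classical
  have hc : (mu k ℓ \ s).card ≤ ℓ - g := by
    rw [Finset.card_sdiff_of_subset hs, hsg]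
    have := card_mu_le (k := k) ℓ
    omega
  have hm : ∀ P ∈ Bd k 4 ℓ, P.2 ∈ (mu k ℓ \ s).filter (fun b => b ^ 4 ≠ b ∧ b ≠ 1) := by
    rintro ⟨a, b⟩ hP
    obtain ⟨ha, hb, h1, h2, h3, h4, h5⟩ := Bd_mem hℓ hP
    rw [Finset.mem_filter, Finset.mem_sdiff, mem_mu hℓ]
    exact ⟨⟨hb, fun h => h4 (hs4 _ h)⟩, h4, h3⟩
  have hc' := (Finset.card_filter_le (mu k ℓ \ s) (fun b => b ^ 4 ≠ b ∧ b ≠ 1)).trans hc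
  constructor
  · refine (card_fib hm (M := ℓ - 2) ?_).trans (Nat.mul_le_mul_right _ hc')
    intro b hb
    rw [Finset.mem_filter, Finset.mem_sdiff] at hb
    refine ⟨mu k ℓ \ {1, b}, ?_, ?_⟩
    · rw [Finset.card_sdiff_of_subset, Finset.card_pair hb.2.2.symm]
      · have := card_mu_le (k := k) ℓ
        omega
      · intro x hx
        rw [Finset.mem_insert, Finset.mem_singleton] at hx
        rcases hx with rfl | rfl
        · rw [mem_mu hℓ, one_pow]
        · exact hb.1.1
    · intro a ha
      obtain ⟨ha, hb, h1, h2, h3, h4, h5⟩ := Bd_mem hℓ ha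
      rw [Finset.mem_sdiff, mem_mu hℓ, Finset.mem_insert, Finset.mem_singleton]
      exact ⟨ha, by tauto⟩
  · refine (card_fib hm (M := 16) ?_).trans (Nat.mul_le_mul_right _ hc')
    intro b hb
    rw [Finset.mem_filter, Finset.mem_sdiff] at hb
    refine ⟨(H16 b).roots.toFinset, ?_, ?_⟩
    · exact (Multiset.toFinset_card_le _).trans ((card_roots' _).trans (H16_deg b))
    · intro a ha
      obtain ⟨ha, hb', h1, h2, h3, h4, h5⟩ := Bd_mem hℓ ha
      rw [Multiset.mem_toFinset, mem_roots (H16_zero h4)]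
      exact h5

variable [IsAlgClosed k] {ℓ : ℕ} {U V : k[X][X]}

lemma card_mu3 : (mu k 3).card = 3 := by
  have : NeZero ((3 : ℕ) : k) := ⟨by
    have h2 := two_k (k := k)
    have : ((3 : ℕ) : k) = 1 := by push_cast; linear_combination h2
    rw [this]; exact one_ne_zero⟩
  obtain ⟨ζ, hζ⟩ := HasEnoughRootsOfUnity.exists_primitiveRoot k 3
  exact hζ.card_nthRootsFinset

lemma caseB (S : Split 2 ℓ U V) (hnd : ¬ ℓ ∣ 3) : False := by
  classical
  have hℓ := S.odd
  have hl5 : 5 ≤ ℓ := by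
    obtain ⟨t, ht⟩ := hℓ
    by_contra h
    have : t = 0 ∨ t = 1 := by omega
    rcases this with rfl | rfl <;> subst ht <;> norm_num at hnd
  have hl17 : ℓ < 19 → ℓ ≤ 17 := by
    obtain ⟨t, ht⟩ := hℓ
    omega
  have e1 := S.ineq le_rfl
  have e2 := S.lower
  have e4 := II_card (k := k) (q := 2 ^ 2) hℓ (by omega)
  have e3 : ∑ P ∈ II k (2 ^ 2) ℓ, od (tr P.1 P.2 U) * od (tr P.1 P.2 V) ≤ (II k (2 ^ 2) ℓ).card * 6 := by
    rw [← smul_eq_mul, ← Finset.sum_const]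
    refine Finset.sum_le_sum fun P hP => ?_
    have h1 := II_st (by omega) hℓ S.h hP
    have := st_le (s := od (tr P.1 P.2 U)) (t := od (tr P.1 P.2 V)) (Q := 5) (by omega)
    omega
  have hd := S.hd
  have hD : U.natDegree + V.natDegree = 4 * ℓ - 2 := by omega
  rw [hD] at e2
  norm_num at e1 e3 e4
  by_cases h3 : 3 ∣ ℓ
  · have hg : Nat.gcd ℓ 3 = 3 := Nat.gcd_eq_right h3
    rw [hg] at e4
    have hB := Bd_le (g := 3) hℓ (s := mu k 3) (by
      intro x hx
      rw [mem_mu (by decide)] at hx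
      rw [mem_mu hℓ]
      obtain ⟨c, rfl⟩ := h3
      rw [pow_mul, hx, one_pow]) (by
      intro x hx
      rw [mem_mu (by decide)] at hx
      rw [pow_succ, hx, one_mul]) card_mu3
    have hl9 : 9 ≤ ℓ := by
      obtain ⟨c, rfl⟩ := h3
      have : c ≠ 2 := by rintro rfl; revert hℓ; decide
      omega
    obtain ⟨hB1, hB2⟩ := hB
    zify [show 2 ≤ 4 * ℓ by omega, show 3 ≤ ℓ by omega, show 2 ≤ ℓ by omega] at *
    exact numB3 hl9 e2 e1 (by linarith) (fun _ => hB1) hB2 hl17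
  · have hg : Nat.gcd ℓ 3 = 1 := ((Nat.Prime.coprime_iff_not_dvd Nat.prime_three).2 h3).symm
    rw [hg] at e4
    have hB := Bd_le (g := 1) hℓ (s := ({1} : Finset k)) (by
      intro x hx
      rw [Finset.mem_singleton] at hx
      rw [mem_mu hℓ, hx, one_pow]) (by
      intro x hx
      rw [Finset.mem_singleton] at hx
      rw [hx, one_pow]) (Finset.card_singleton _)
    obtain ⟨hB1, hB2⟩ := hB
    zify [show 2 ≤ 4 * ℓ by omega, show 1 ≤ ℓ by omega, show 2 ≤ ℓ by omega] at *
    exact numB1 hl5 e2 e1 (by linarith) (fun _ => hB1) hB2 hl17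

end
end ExcAPN

namespace ExcAPN
open Polynomial
section
variable {k : Type*} [Field k] [CharP k 2]

lemma II_fib {q ℓ M : ℕ} (hℓ : Odd ℓ)
    (h : ∀ b : k, b ^ ℓ = 1 → b ≠ 1 → ∃ t : Finset k, t.card ≤ M ∧ ∀ a, (a, b) ∈ II k q ℓ → a ∈ t) :
    (II k q ℓ).card ≤ ℓ + (ℓ - 1) * M := by
  classical
  rw [← Finset.card_filter_add_card_filter_not (s := II k q ℓ) (fun P => P.2 = 1)]
  apply add_le_add
  · refine (card_fib (s := {1}) (M := ℓ) ?_ ?_).trans ?_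
    · intro P hP
      rw [Finset.mem_filter] at hP
      rw [Finset.mem_singleton, hP.2]
    · intro b _
      refine ⟨mu k ℓ, card_mu_le ℓ, ?_⟩
      intro a ha
      rw [Finset.mem_filter, II, Finset.mem_filter, Finset.mem_product] at ha
      exact ha.1.1.1
    · rw [Finset.card_singleton, one_mul]
  · have hc : ((mu k ℓ).erase 1).card ≤ ℓ - 1 := by
      rw [Finset.card_erase_of_mem (by rw [mem_mu hℓ, one_pow])]
      have := card_mu_le (k := k) ℓ
      omega
    refine (card_fib (s := (mu k ℓ).erase 1) (M := M) ?_ ?_).trans (Nat.mul_le_mul_right _ hc)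
    · intro P hP
      rw [Finset.mem_filter, II, Finset.mem_filter, Finset.mem_product] at hP
      rw [Finset.mem_erase]
      exact ⟨hP.2, hP.1.1.2⟩
    · intro b hb
      rw [Finset.mem_erase, mem_mu hℓ] at hb
      obtain ⟨t, ht, h⟩ := h b hb.2 hb.1
      exact ⟨t, ht, fun a ha => h a (Finset.mem_filter.1 ha).1⟩

lemma II_pow {q ℓ j : ℕ} (hℓ : Odd ℓ) (hj : ℓ + 1 = 2 ^ j) : (II k q ℓ).card + ℓ ≤ ℓ ^ 2 + 1 := by
  classical
  have h2 := two_k (k := k)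
  have := II_fib (k := k) (q := q) (M := ℓ - 1) hℓ (by
    intro b hb hb1
    refine ⟨(mu k ℓ).erase (b + 1), ?_, ?_⟩
    · rw [Finset.card_erase_of_mem]
      · have := card_mu_le (k := k) ℓ
        omega
      · rw [mem_mu hℓ]
        have h1 : (b + 1) ^ (ℓ + 1) = b + 1 := by
          rw [hj, frob_add, ← hj, pow_succ, hb, one_mul, one_pow]
        have h3 : b + 1 ≠ 0 := fun h => hb1 (by linear_combination h - h2)
        apply mul_right_cancel₀ h3
        rw [← pow_succ, h1, one_mul]
    · intro a ha
      rw [II, Finset.mem_filter, Finset.mem_product] at ha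
      rw [Finset.mem_erase]
      refine ⟨?_, ha.1.1⟩
      rintro rfl
      have := ha.2.1
      have e : b + 1 + b + 1 = 0 := by linear_combination (b + 1) * h2
      simp only [e] at this
      rw [zero_pow hℓ.pos.ne'] at this
      exact zero_ne_one this)
  obtain ⟨r, rfl⟩ : ∃ r, ℓ = r + 1 := ⟨ℓ - 1, by have := hℓ.pos; omega⟩
  simp only [Nat.add_sub_cancel] at this
  nlinarith

lemma II_half {q ℓ j m : ℕ} (hℓ : Odd ℓ) (hm : Odd m) (hm3 : 3 ≤ m) (hj : ℓ + 1 = 2 ^ j * m) :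
    2 * (II k q ℓ).card ≤ ℓ ^ 2 + 1 := by
  classical
  have h2 := two_k (k := k)
  have hj1 : j ≠ 0 := by
    rintro rfl
    rw [pow_zero, one_mul] at hj
    rw [← hj] at hm
    exact (Nat.not_odd_iff_even.2 hℓ.add_one) hm
  have hmm : 2 * m ≤ ℓ + 1 := by
    rw [hj]
    apply Nat.mul_le_mul_right
    calc 2 = 2 ^ 1 := rfl
      _ ≤ 2 ^ j := Nat.pow_le_pow_right (by norm_num) (by omega)
  have := II_fib (k := k) (q := q) (M := m - 1) hℓ (by
    intro b hb hb1
    have hc : b + 1 ≠ 0 := fun h => hb1 (by linear_combination h - h2)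
    obtain ⟨c, rfl⟩ : ∃ c, c = b + 1 := ⟨_, rfl⟩
    let p : k[X] := (X + C ((b + 1) ^ (2 ^ j))) ^ m - X ^ m - C (b + 1)
    have hp1 : p.coeff (m - 1) = (b + 1) ^ (2 ^ j) := by
      simp only [p, coeff_sub, coeff_X_add_C_pow, coeff_X_pow, coeff_C]
      rw [if_neg (by omega), if_neg (by omega), show m - (m - 1) = 1 by omega, pow_one, Nat.choose_symm_of_eq_add (b := 1) (by omega), Nat.choose_one_right]
      obtain ⟨t, rfl⟩ := hm
      push_cast
      linear_combination (t * (b + 1) ^ (2 ^ j)) * h2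
    have hp0 : p ≠ 0 := by
      intro h
      rw [h, coeff_zero] at hp1
      exact pow_ne_zero _ hc hp1.symm
    have hpd : p.natDegree ≤ m - 1 := by
      rw [natDegree_le_iff_coeff_eq_zero]
      intro N hN
      simp only [p, coeff_sub, coeff_X_add_C_pow, coeff_X_pow, coeff_C]
      rw [if_neg (show N ≠ 0 by omega), sub_zero]
      rcases eq_or_ne N m with rfl | h
      · simp
      · rw [if_neg h, Nat.choose_eq_zero_of_lt (by omega)]; simp
    refine ⟨(mu k ℓ).filter (fun a => p.eval (a ^ 2 ^ j) = 0), ?_, ?_⟩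
    · refine le_trans ?_ ((Multiset.toFinset_card_le p.roots).trans ((card_roots' _).trans hpd))
      apply Finset.card_le_card_of_injOn (fun a => a ^ 2 ^ j)
      · intro a ha
        have ha := Finset.mem_coe.1 ha
        rw [Finset.mem_filter] at ha
        rw [Finset.mem_coe, Multiset.mem_toFinset, mem_roots hp0]
        exact ha.2
      · intro x _ y _ hxy
        exact frob_inj hxy
    · intro a ha
      rw [II, Finset.mem_filter, Finset.mem_product, mem_mu hℓ, mem_mu hℓ] at ha
      rw [Finset.mem_filter, mem_mu hℓ]
      refine ⟨ha.1.1, ?_⟩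
      have e1 : a ^ (ℓ + 1) = a := by rw [pow_succ, ha.1.1, one_mul]
      have e2 : (a + (b + 1)) ^ (ℓ + 1) = a + (b + 1) := by rw [pow_succ, ← add_assoc, ha.2.1, one_mul]
      rw [hj, pow_mul] at e1 e2
      rw [frob_add] at e2
      simp only [p, eval_sub, eval_pow, eval_add, eval_X, eval_C]
      rw [e1, e2]
      ring)
  obtain ⟨r, rfl⟩ : ∃ r, ℓ = r + 1 := ⟨ℓ - 1, by have := hℓ.pos; omega⟩
  obtain ⟨s, rfl⟩ : ∃ s, m = s + 1 := ⟨m - 1, by omega⟩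
  simp only [Nat.add_sub_cancel] at this
  nlinarith
end
end ExcAPN

namespace ExcAPN
open Polynomial
section
variable {k : Type*} [Field k] [CharP k 2]

lemma sub_one_dvd {i j : ℕ} (h : 2 ^ j - 1 ∣ 2 ^ i - 1) : j ∣ i := by
  have h1 := Nat.pow_sub_one_gcd_pow_sub_one 2 j i
  rw [Nat.gcd_eq_left h] at h1
  have h2 : 2 ^ j = 2 ^ Nat.gcd j i := by
    have := Nat.one_le_two_pow (n := j)
    have := Nat.one_le_two_pow (n := Nat.gcd j i)
    omega
  have h3 := Nat.pow_right_injective (le_refl 2) h2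
  rw [h3]
  exact Nat.gcd_dvd_right j i

variable [IsAlgClosed k]

theorem no_split {d : ℕ} (hodd : Odd d) (hd7 : 7 ≤ d) (hgold : ¬ ∃ k, 1 ≤ k ∧ d = 2 ^ k + 1)
    (hkas : ¬ ∃ k, 1 ≤ k ∧ d = 2 ^ (2 * k) - 2 ^ k + 1) {U V : k[X][X]} (hU : U.Monic) (hV : V.Monic)
    (hP : PP k d = U * V) (h1 : 2 * U.natDegree ≤ d - 3) (h2 : d - 3 ≤ 3 * U.natDegree) : False := by
  have hW := PP_Wt (k := k) d
  obtain ⟨-, hdeg⟩ := monic_of_Wt hW (PP_lead hodd (by omega))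
  have hdeg' : U.natDegree + V.natDegree = d - 3 := by
    rw [← hU.natDegree_mul hV, ← hP, hdeg]
  obtain ⟨hWU, hWV⟩ := factor_Wt hU hV (by rw [hdeg', ← hP]; exact hW)
  obtain ⟨i, ℓ, hℓ, hdi⟩ := Nat.exists_eq_two_pow_mul_odd (n := d - 1) (by omega)
  have hdi' : d = 2 ^ i * ℓ + 1 := by omega
  have hmul := PP_mul (two_k (k := k)) d
  rw [hP, hdi'] at hmul
  have S : Split i ℓ U V := ⟨hℓ, hU, hV, hWU, hWV, by omega, hmul, by omega, by omega⟩
  have hi1 : 1 ≤ i := by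
    by_contra h
    obtain rfl : i = 0 := by omega
    rw [pow_zero, one_mul] at hdi'
    rw [hdi'] at hodd
    exact (Nat.not_odd_iff_even.2 hℓ.add_one) hodd
  have hl1 : ℓ ≠ 1 := by
    rintro rfl
    exact hgold ⟨i, hi1, by omega⟩
  have hl3 : 3 ≤ ℓ := by
    obtain ⟨t, ht⟩ := hℓ
    omega
  rcases Nat.eq_or_lt_of_le hi1 with hi | hi
  · have := case_one hi.symm hℓ hU hV hWU hWV S.hd hmul
    rcases Nat.mul_eq_zero.1 this with h | h <;> omega
  have hi2 : 2 ≤ i := hi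
  by_cases hdv : ℓ ∣ 2 ^ i - 1
  swap
  · rcases Nat.eq_or_lt_of_le hi2 with h | h
    · subst h
      exact caseB S (by simpa using hdv)
    · exact caseA S h hdv
  have hle : ℓ ≤ 2 ^ i - 1 := Nat.le_of_dvd (by
    have : 2 ^ 1 ≤ 2 ^ i := Nat.pow_le_pow_right (by norm_num) hi1
    omega) hdv
  obtain ⟨j, m, hm, hj⟩ := Nat.exists_eq_two_pow_mul_odd (n := ℓ + 1) (by omega)
  by_cases hm1 : m = 1
  · subst hm1
    rw [mul_one] at hj
    have hlj : ℓ = 2 ^ j - 1 := by omega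
    have hji : j ∣ i := sub_one_dvd (by rw [← hlj]; exact hdv)
    have hN := II_pow (k := k) (q := 2 ^ i) hℓ hj
    obtain ⟨t, rfl⟩ := hji
    have ht0 : t ≠ 0 := by rintro rfl; omega
    have ht1 : t ≠ 1 := by
      rintro rfl
      rw [mul_one] at hdi' hi1
      apply hkas ⟨j, hi1, ?_⟩
      rw [hdi', hlj, Nat.mul_sub, mul_one, two_mul, pow_add]
    have hj2 : 2 ≤ j := by
      by_contra h
      have : j = 0 ∨ j = 1 := by omega
      rcases this with rfl | rfl <;> omega
    have h2j : j * 2 ≤ j * t := Nat.mul_le_mul_left _ (by omega)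
    have hq : (ℓ + 1) ^ 2 ≤ 2 ^ (j * t) := by
      rw [hj, ← pow_mul]
      exact Nat.pow_le_pow_right (by norm_num) h2j
    rcases Nat.eq_or_lt_of_le hl3 with h | h
    · subst h
      exact caseC3 S (by omega) hdv hN
    · have hl7 : 7 ≤ ℓ := by
        have : j ≠ 2 := by rintro rfl; omega
        have : 2 ^ 3 ≤ 2 ^ j := Nat.pow_le_pow_right (by norm_num) (by omega)
        omega
      exact caseC2 S (by omega) hl7 hq hdv hN
  · have hm3 : 3 ≤ m := by
      obtain ⟨t, ht⟩ := hm
      omega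
    have hN := II_half (k := k) (q := 2 ^ i) hℓ hm hm3 hj
    have hj0 : j ≠ 0 := by
      rintro rfl
      rw [pow_zero, one_mul] at hj
      rw [← hj] at hm
      exact (Nat.not_odd_iff_even.2 hℓ.add_one) hm
    have : 2 ^ 1 ≤ 2 ^ j := Nat.pow_le_pow_right (by norm_num) (by omega)
    have hl5 : 5 ≤ ℓ := by nlinarith
    have hi3 : 3 ≤ i := by
      by_contra h
      obtain rfl : i = 2 := by omega
      omega
    exact caseC1 S hi3 hl5 hdv hN

end
end ExcAPN

namespace ExcAPN
open Polynomial
section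
universe u
variable {k : Type u} [Field k] [CharP k 2] [IsAlgClosed k]

lemma core_lin {f : k[X]} (hf : f.natDegree = 1) {e : ℕ} (he : 2 ≤ e) : ¬ APNat f e := by
  intro h
  obtain ⟨A, hA, hAm⟩ := card_frob_fixed (k := k) e (by omega)
  have h4 : 2 < A.card := by
    rw [hA]
    calc 2 < 2 ^ 2 := by norm_num
      _ ≤ 2 ^ e := Nat.pow_le_pow_right (by norm_num) he
  obtain ⟨x, y, z, hx, hy, hz, hxy, hxz, hyz⟩ := Finset.two_lt_card_iff.1 h4
  apply h x y z ((hAm x).1 hx) ((hAm y).1 hy) ((hAm z).1 hz) hxy hxz hyz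
  have h2 := two_k (k := k)
  rw [eq_X_add_C_of_natDegree_le_one hf.le]
  simp only [eval_add, eval_mul, eval_C, eval_X]
  linear_combination (f.coeff 1 * (x + y + z) + 2 * f.coeff 0) * h2

theorem core (f : k[X]) (hodd : Odd f.natDegree) (hgold : ¬ ∃ k, 1 ≤ k ∧ f.natDegree = 2 ^ k + 1)
    (hkas : ¬ ∃ k, 1 ≤ k ∧ f.natDegree = 2 ^ (2 * k) - 2 ^ k + 1) (S : Set ℕ)
    (hS : ∀ e ∈ S, APNat f e ∧ ∀ j, (f.coeff j) ^ (2 ^ e) = f.coeff j) : S.Finite := by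
  by_contra hinf
  have hinf : S.Infinite := hinf
  by_cases h1 : f.natDegree = 1
  · obtain ⟨e, he, he2⟩ := hinf.exists_gt 2
    exact core_lin h1 (by omega) (hS e he).1
  have h7 : 7 ≤ f.natDegree := by
    have h3 : f.natDegree ≠ 3 := fun h => hgold ⟨1, by norm_num, by rw [h]; norm_num⟩
    have h5 : f.natDegree ≠ 5 := fun h => hgold ⟨2, by norm_num, by rw [h]; norm_num⟩
    obtain ⟨t, ht⟩ := hodd
    omega
  obtain ⟨e0, he0⟩ := apn_split f hodd (by omega)
  let Λ : Set k := {μ | μ ≠ 0 ∧ ∃ e ∈ S, e0 ≤ e ∧ μ ^ 2 ^ e = μ}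
  have hΛ : Λ.Infinite := by
    intro hfin
    obtain ⟨e, he, hlt⟩ := hinf.exists_gt (max (max e0 1) (hfin.toFinset.card + 1))
    have q1 : e0 < e := lt_of_le_of_lt ((le_max_left _ _).trans (le_max_left _ _)) hlt
    have q2 : hfin.toFinset.card + 1 < e := lt_of_le_of_lt (le_max_right _ _) hlt
    obtain ⟨A, hA, hAm⟩ := card_frob_fixed (k := k) e (by omega)
    classical
    have hsub : A ⊆ insert 0 hfin.toFinset := by
      intro μ hμ
      rw [Finset.mem_insert, Set.Finite.mem_toFinset]
      by_cases h0 : μ = 0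
      · exact Or.inl h0
      · exact Or.inr ⟨h0, e, he, q1.le, (hAm μ).1 hμ⟩
    have := (Finset.card_le_card hsub).trans (Finset.card_insert_le _ _)
    have := Nat.lt_two_pow_self (n := e)
    omega
  let c : ℕ → k := fun j => f.coeff j / f.leadingCoeff
  have hex : ∀ μ ∈ Λ, ∃ a ∈ Finset.range f.natDegree, (2 * a ≤ f.natDegree - 3 ∧ f.natDegree - 3 ≤ 3 * a) ∧
      ∃ U V : k[X][X], U.Monic ∧ V.Monic ∧ GG k c f.natDegree μ = U * V ∧ U.natDegree = a := by
    rintro μ ⟨h0, e, he, hee, hμ⟩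
    obtain ⟨U, V, hU, hV, hUV, d1, d2⟩ := he0 e hee (hS e he).1 (hS e he).2 μ h0 hμ
    exact ⟨U.natDegree, Finset.mem_range.2 (by omega), ⟨d1, d2⟩, U, V, hU, hV, hUV, rfl⟩
  have hpig : ∃ a, {μ ∈ Λ | (2 * a ≤ f.natDegree - 3 ∧ f.natDegree - 3 ≤ 3 * a) ∧
      ∃ U V : k[X][X], U.Monic ∧ V.Monic ∧ GG k c f.natDegree μ = U * V ∧ U.natDegree = a}.Infinite := by
    by_contra hno
    push Not at hno
    apply hΛ
    refine Set.Finite.subset (Set.Finite.biUnion (Finset.range f.natDegree).finite_toSet (fun a _ => hno a)) ?_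
    intro μ hμ
    obtain ⟨a, ha, h⟩ := hex μ hμ
    exact Set.mem_biUnion (Finset.mem_coe.2 ha) ⟨hμ, h⟩
  obtain ⟨a, ha⟩ := hpig
  obtain ⟨-, -, ⟨d1, d2⟩, -⟩ := ha.nonempty
  have hf0 : f.leadingCoeff ≠ 0 := by
    rw [Ne, leadingCoeff_eq_zero]
    rintro rfl
    simp at h7
  obtain ⟨κ, _, _, _, U, V, hU, hV, hUV, hUa⟩ := specialize hodd (by omega) c
    (div_self hf0) _ ha a (fun μ hμ => hμ.2.2)
  exact no_split hodd h7 hgold hkas hU hV hUV (by omega) (by omega)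

end
end ExcAPN

namespace ExcAPN
open Polynomial
section

lemma apnat_of_isAPN {K k : Type} [Field K] [Finite K] [Field k] [CharP k 2] [IsAlgClosed k] {e : ℕ} (he : e ≠ 0)
    (hcard : Nat.card K = 2 ^ e) (ψ : K →+* k) (g : K[X]) (h : IsAPN (fun x => eval x g)) :
    APNat (g.map ψ) e ∧ ∀ j, ((g.map ψ).coeff j) ^ (2 ^ e) = (g.map ψ).coeff j := by
  classical
  have := Fintype.ofFinite K
  have hfix : ∀ x : K, x ^ (2 ^ e) = x := by
    intro x
    rw [← hcard, Nat.card_eq_fintype_card, FiniteField.pow_card]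
  have hfix' : ∀ x : K, (ψ x) ^ (2 ^ e) = ψ x := fun x => by rw [← map_pow, hfix]
  refine ⟨?_, fun j => by rw [coeff_map, hfix']⟩
  have hsurj : ∀ y : k, y ^ (2 ^ e) = y → ∃ x, ψ x = y := by
    obtain ⟨A, hA, hAm⟩ := card_frob_fixed (k := k) e he
    have himg : Finset.univ.image ψ = A := by
      apply Finset.eq_of_subset_of_card_le
      · intro y hy
        obtain ⟨x, -, rfl⟩ := Finset.mem_image.1 hy
        exact (hAm _).2 (hfix' x)
      · rw [Finset.card_image_of_injective _ ψ.injective, hA, Finset.card_univ, ← Nat.card_eq_fintype_card, hcard]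
    intro y hy
    have := (hAm y).2 hy
    rw [← himg] at this
    obtain ⟨x, -, hx⟩ := Finset.mem_image.1 this
    exact ⟨x, hx⟩
  intro X Y Z hX hY hZ hXY hXZ hYZ h0
  obtain ⟨x, rfl⟩ := hsurj X hX
  obtain ⟨y, rfl⟩ := hsurj Y hY
  obtain ⟨z, rfl⟩ := hsurj Z hZ
  have hxy : x ≠ y := fun h => hXY (by rw [h])
  have hxz : x ≠ z := fun h => hXZ (by rw [h])
  have hyz : y ≠ z := fun h => hYZ (by rw [h])
  rw [← map_add, ← map_add, eval_map_apply, eval_map_apply, eval_map_apply, eval_map_apply, ← map_add, ← map_add, ← map_add,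
    map_eq_zero] at h0
  have h2 : (2 : K) = 0 := by
    have : ψ 2 = 0 := by rw [map_ofNat]; exact two_k (k := k)
    exact (map_eq_zero ψ).1 this
  have ha : x + z ≠ 0 := fun h => hxz (by linear_combination h - z * h2)
  have hle := h (x + z) (eval x g + eval z g) ha
  have e1 : x + (x + z) = z := by linear_combination x * h2
  have e2 : z + (x + z) = x := by linear_combination z * h2
  have e3 : y + (x + z) = x + y + z := by ring
  have hsub : (({x, y, z} : Finset K) : Set K) ⊆ {t : K | eval (t + (x + z)) g + eval t g = eval x g + eval z g} := by
    intro t ht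
    rw [Finset.mem_coe, Finset.mem_insert, Finset.mem_insert, Finset.mem_singleton] at ht
    rw [Set.mem_setOf_eq]
    rcases ht with rfl | rfl | rfl
    · rw [e1, add_comm]
    · rw [e3]
      linear_combination h0 - (eval x g + eval z g) * h2
    · rw [e2]
  have hc := Set.ncard_le_ncard hsub (Set.toFinite _)
  rw [Set.ncard_coe_finset, Finset.card_eq_three.2 ⟨x, y, z, hxy, hxz, hyz, rfl⟩] at hc
  simp only at hle
  omega

theorem final (n : ℕ) (hn : 1 ≤ n)
    (f : Polynomial (GaloisField 2 n)) (hodd : Odd f.natDegree)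
    (hgold : ¬ ∃ k : ℕ, 1 ≤ k ∧ f.natDegree = 2 ^ k + 1)
    (hkasami : ¬ ∃ k : ℕ, 1 ≤ k ∧ f.natDegree = 2 ^ (2 * k) - 2 ^ k + 1) :
    {m : ℕ | 1 ≤ m ∧ ∀ ι : GaloisField 2 n →+* GaloisField 2 (n * m),
      IsAPN (fun x => Polynomial.eval x (f.map ι))}.Finite := by
  let k := AlgebraicClosure (GaloisField 2 n)
  have : CharP k 2 := charP_of_injective_algebraMap (algebraMap (GaloisField 2 n) k).injective 2
  let F : k[X] := f.map (algebraMap (GaloisField 2 n) k)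
  have hF : F.natDegree = f.natDegree := natDegree_map _
  have key := core F (by rw [hF]; exact hodd) (by rw [hF]; exact hgold) (by rw [hF]; exact hkasami)
    ((fun m => n * m) '' {m : ℕ | 1 ≤ m ∧ ∀ ι : GaloisField 2 n →+* GaloisField 2 (n * m),
      IsAPN (fun x => Polynomial.eval x (f.map ι))}) (by
    rintro e ⟨m, ⟨hm, h⟩, rfl⟩
    have hnm : n * m ≠ 0 := by positivity
    obtain ⟨ι0⟩ := FiniteField.nonempty_algHom_of_finrank_dvd (F := ZMod 2) (K := GaloisField 2 n) (L := GaloisField 2 (n * m))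
      (by rw [GaloisField.finrank 2 (by omega), GaloisField.finrank 2 hnm]; exact Dvd.intro m rfl)
    let ι : GaloisField 2 n →+* GaloisField 2 (n * m) := ι0.toRingHom
    letI : Algebra (GaloisField 2 n) (GaloisField 2 (n * m)) := ι.toAlgebra
    have : Module.Finite (GaloisField 2 n) (GaloisField 2 (n * m)) := Module.Finite.of_finite
    let ψ : GaloisField 2 (n * m) →ₐ[GaloisField 2 n] k := IsAlgClosed.lift
    have hψ : (f.map ι).map ψ.toRingHom = F := by
      rw [map_map]
      congr 1
      exact ψ.comp_algebraMap
    have := apnat_of_isAPN hnm (GaloisField.card 2 (n * m) hnm) ψ.toRingHom (f.map ι) (h ι)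
    rw [hψ] at this
    exact this)
  refine key.of_finite_image ?_
  intro x _ y _ hxy
  exact Nat.eq_of_mul_eq_mul_left (by omega) hxy

end
end ExcAPN

/-- Aubry–McGuire–Rodier: Let `L = F_{2^n}` and `f ∈ L[x]` of odd degree that is
neither a Gold number `2^k + 1` nor a Kasami–Welch number `2^(2k) - 2^k + 1` for any `k ≥ 1`.
Then `f` is not exceptional APN: there are only finitely many `m ≥ 1` such that `f` is APN on
`F_{2^(nm)}`. -/
theorem odd_degree_not_gold_kasami_not_exceptional_APN (n : ℕ) (hn : 1 ≤ n)
    (f : Polynomial (GaloisField 2 n)) (hodd : Odd f.natDegree)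
    (hgold : ¬ ∃ k : ℕ, 1 ≤ k ∧ f.natDegree = 2 ^ k + 1)
    (hkasami : ¬ ∃ k : ℕ, 1 ≤ k ∧ f.natDegree = 2 ^ (2 * k) - 2 ^ k + 1) :
    {m : ℕ | 1 ≤ m ∧ ∀ ι : GaloisField 2 n →+* GaloisField 2 (n * m),
      IsAPN (fun x => Polynomial.eval x (f.map ι))}.Finite := by
  exact ExcAPN.final n hn f hodd hgold hkasami
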